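/- Let α ∈ ℝ∖ℚ be of bounded type and fix E ∈ ℝ and 1 ≤ s < 2. Then the Lyapunov exponent is continuous with respect to the potential in the G^s-topology: if v, v_1, v_2, … ∈ G^s(𝕊¹) and there is K > 0 with |v_n − v|_{s,K} → 0 as n → ∞, then L(S_{E,v_n}) → L(S_{E,v}). -/

import Mathlib

open Real MeasureTheory Filter
open scoped ENNReal

noncomputable section

/-- The Gevrey `(s,K)` weighted sup-norm of `f` on the set `I` (valued in `ℝ≥0∞`):
`|f|_{s,K} = (4π²/3) · sup_k (1+k)²/(K^k (k!)^s) · sup_{x∈I} |f^{(k)}(x)|`. -/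
def gevreyNormOn (s K : ℝ) (I : Set ℝ) (f : ℝ → ℝ) : ℝ≥0∞ :=
  ⨆ k : ℕ,
    ENNReal.ofReal (4 * π ^ 2 / 3 * ((1 + (k : ℝ)) ^ 2 / (K ^ k * ((k.factorial : ℝ)) ^ s))) *
      ⨆ x ∈ I, ENNReal.ofReal |iteratedDeriv k f x|

/-- The Gevrey `(s,K)` norm of a function on the circle `𝕊¹ = ℝ/2πℤ`, viewed as a
`2π`-periodic function on `ℝ`. -/
def gevreyNorm (s K : ℝ) (f : ℝ → ℝ) : ℝ≥0∞ := gevreyNormOn s K Set.univ f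

/-- `f` belongs to the Gevrey class `G^s(𝕊¹)`: it is smooth, `2π`-periodic and has finite
Gevrey `(s,K)` norm for some `K > 0`. -/
def GevreyCircle (s : ℝ) (f : ℝ → ℝ) : Prop :=
  ContDiff ℝ (⊤ : ℕ∞) f ∧ Function.Periodic f (2 * π) ∧ ∃ K > 0, gevreyNorm s K f < ⊤

/-- The operator norm of a `2×2` real matrix acting on Euclidean `ℝ²`. -/
def mnorm (A : Matrix (Fin 2) (Fin 2) ℝ) : ℝ :=
  ‖Matrix.toEuclideanCLM (𝕜 := ℝ) A‖

/-- The iterates of the quasiperiodic cocycle `(α, A)`: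
`A_n(x) = A(x + 2π(n-1)α) ⋯ A(x + 2πα) A(x)`. -/
def cocycleIter (α : ℝ) (A : ℝ → Matrix (Fin 2) (Fin 2) ℝ) : ℕ → ℝ → Matrix (Fin 2) (Fin 2) ℝ
  | 0, _ => 1
  | n + 1, x => A (x + 2 * π * n * α) * cocycleIter α A n x

/-- The Lyapunov exponent of the quasiperiodic cocycle `(α, A)`:
`L(A) = inf_{n ≥ 1} (1/n) ∫_{𝕊¹} log ‖A_n(x)‖ dx` (normalized measure on the circle). -/
def lyapunovExp (α : ℝ) (A : ℝ → Matrix (Fin 2) (Fin 2) ℝ) : ℝ :=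
  ⨅ n : ℕ, (1 / ((n : ℝ) + 1)) *
    ((2 * π)⁻¹ * ∫ x in (0 : ℝ)..(2 * π), Real.log (mnorm (cocycleIter α A (n + 1) x)))

/-- The denominator `q_n` of the `n`-th continued fraction convergent of `α`. -/
def cfDen (α : ℝ) (n : ℕ) : ℝ := (GenContFract.of α).dens n

/-- `α` is of bounded type with constant `M`: the continued fraction convergent denominators
satisfy `q_{n+1} ≤ M q_n` for all `n`. -/
def BoundedType (α M : ℝ) : Prop := ∀ n : ℕ, cfDen α (n + 1) ≤ M * cfDen α n

/-- The Schrödinger cocycle map `S_{E,v}(x) = [[E - v x, -1], [1, 0]]`. -/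
def schrodingerMap (E : ℝ) (v : ℝ → ℝ) (x : ℝ) : Matrix (Fin 2) (Fin 2) ℝ :=
  !![E - v x, -1; 1, 0]

section

open scoped Matrix.Norms.Frobenius

/-- Square complex matrices of size two. -/
abbrev Mat2 := Matrix (Fin 2) (Fin 2) ℂ

lemma Mat2.norm_sq (A : Mat2) :
    ‖A‖ ^ 2 = ‖A 0 0‖ ^ 2 + ‖A 0 1‖ ^ 2 + ‖A 1 0‖ ^ 2 + ‖A 1 1‖ ^ 2 := by
  rw [Matrix.frobenius_norm_def, ← Real.sqrt_eq_rpow, Real.sq_sqrt (by positivity)]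
  simp [Fin.sum_univ_two]
  ring

lemma Mat2.one_le_norm {A : Mat2} (hA : A.det = 1) : 1 ≤ ‖A‖ := by
  have h1 : ‖A 0 0 * A 1 1 - A 0 1 * A 1 0‖ = 1 := by
    rw [← Matrix.det_fin_two, hA, norm_one]
  have h2 := norm_sub_le (A 0 0 * A 1 1) (A 0 1 * A 1 0)
  rw [h1, norm_mul, norm_mul] at h2
  have h3 := Mat2.norm_sq A
  nlinarith [norm_nonneg A, sq_nonneg (‖A 0 0‖ - ‖A 1 1‖), sq_nonneg (‖A 0 1‖ - ‖A 1 0‖)]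

/-- The tensor identity behind the avalanche principle for unimodular `2 × 2` matrices. -/
lemma Mat2.abs_norm_mul_sub_le (A B C : Mat2) (hB : B.det = 1) :
    |‖A * B * C‖ * ‖B‖ - ‖A * B‖ * ‖B * C‖| ≤ ‖A‖ * ‖C‖ := by
  let u : EuclideanSpace ℂ (Fin 2 × Fin 2 × Fin 2 × Fin 2) := WithLp.toLp 2
    fun p => (A * B * C) p.1 p.2.1 * B p.2.2.1 p.2.2.2
  let w : EuclideanSpace ℂ (Fin 2 × Fin 2 × Fin 2 × Fin 2) := WithLp.toLp 2
    fun p => (A * B) p.1 p.2.2.2 * (B * C) p.2.2.1 p.2.1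
  have hu : ‖u‖ = ‖A * B * C‖ * ‖B‖ := by
    rw [← sq_eq_sq₀ (by positivity) (by positivity), mul_pow, Mat2.norm_sq, Mat2.norm_sq,
      EuclideanSpace.norm_sq_eq]
    simp only [Fintype.sum_prod_type, Fin.sum_univ_two, u, norm_mul]
    ring
  have hw : ‖w‖ = ‖A * B‖ * ‖B * C‖ := by
    rw [← sq_eq_sq₀ (by positivity) (by positivity), mul_pow, Mat2.norm_sq, Mat2.norm_sq,
      EuclideanSpace.norm_sq_eq]
    simp only [Fintype.sum_prod_type, Fin.sum_univ_two, w, norm_mul]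
    ring
  let J : Mat2 := !![0, 1; -1, 0]
  let z : EuclideanSpace ℂ (Fin 2 × Fin 2 × Fin 2 × Fin 2) := WithLp.toLp 2
    fun p => (A * J) p.1 p.2.2.1 * (J * C) p.2.2.2 p.2.1
  have hJ : ∀ D : Mat2, ‖D * J‖ = ‖D‖ ∧ ‖J * D‖ = ‖D‖ := by
    intro D
    constructor <;> rw [← sq_eq_sq₀ (by positivity) (by positivity), Mat2.norm_sq, Mat2.norm_sq] <;>
      simp [J, Matrix.mul_apply, Fin.sum_univ_two] <;> ring
  have hz : ‖z‖ = ‖A‖ * ‖C‖ := by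
    rw [← (hJ A).1, ← (hJ C).2, ← sq_eq_sq₀ (by positivity) (by positivity), mul_pow,
      Mat2.norm_sq, Mat2.norm_sq, EuclideanSpace.norm_sq_eq]
    simp only [Fintype.sum_prod_type, Fin.sum_univ_two, z, norm_mul]
    ring
  have huw : w - u = z := by
    have hd : B 0 0 * B 1 1 - B 0 1 * B 1 0 = 1 := by rw [← Matrix.det_fin_two, hB]
    ext ⟨a, b, c, d⟩
    simp only [u, w, z, PiLp.sub_apply, Matrix.mul_apply, Fin.sum_univ_two, J]
    fin_cases c <;> fin_cases d <;> simp
    · linear_combination -(A a 1 * C 1 b) * hd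
    · linear_combination (A a 1 * C 0 b) * hd
    · linear_combination (A a 0 * C 1 b) * hd
    · linear_combination -(A a 0 * C 0 b) * hd
  rw [← hu, ← hw, ← hz, ← huw, norm_sub_rev]
  exact abs_norm_sub_norm_le u w

lemma avalanche_step {b₁ b₂ p₁ p₂ p₃ bb κ : ℝ} (hκ : 0 < κ) (hb₁ : 0 < b₁) (hb₂ : 0 < b₂)
    (hp₁ : 0 < p₁) (hp₂ : 0 < p₂) (hp₃ : 0 < p₃) (hbb : 0 < bb) (hq : 4 ≤ κ ^ 2 * b₁ ^ 2)
    (h1 : κ * (b₂ * b₁) ≤ bb) (h2 : κ / 2 * (b₁ * p₁) ≤ p₂)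
    (key : |p₃ * b₁ - bb * p₂| ≤ b₂ * p₁) :
    κ / 2 * (b₂ * p₂) ≤ p₃ ∧ |Real.log p₃ - Real.log p₂ - Real.log bb + Real.log b₁| ≤ 1 := by
  have hsmall : b₂ * p₁ ≤ 1 / 2 * (bb * p₂) := by
    have h3 : (κ * (b₂ * b₁)) * (κ / 2 * (b₁ * p₁)) ≤ bb * p₂ :=
      mul_le_mul h1 h2 (by positivity) (by positivity)
    have h4 : 0 ≤ b₂ * p₁ := by positivity
    nlinarith [mul_le_mul_of_nonneg_right hq h4]
  obtain ⟨k1, k2⟩ := abs_le.1 (key.trans hsmall)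
  refine ⟨?_, ?_⟩
  · have h6 : κ * (b₂ * b₁) * p₂ ≤ bb * p₂ := by gcongr
    refine le_of_mul_le_mul_right (a := b₁) ?_ hb₁
    calc κ / 2 * (b₂ * p₂) * b₁ = 1 / 2 * (κ * (b₂ * b₁) * p₂) := by ring
      _ ≤ p₃ * b₁ := by linarith
  · have h0 : 0 < bb * p₂ := by positivity
    have l1 : Real.log (p₃ * b₁) ≤ Real.log 2 + Real.log (bb * p₂) := by
      rw [← Real.log_mul (by norm_num) (by positivity)]
      exact Real.log_le_log (by positivity) (by linarith)
    have l2 : Real.log (bb * p₂) ≤ Real.log 2 + Real.log (p₃ * b₁) := by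
      rw [← Real.log_mul (by norm_num) (by positivity)]
      exact Real.log_le_log (by positivity) (by linarith)
    have l3 : Real.log 2 ≤ 1 := by linarith [Real.log_two_lt_d9]
    rw [Real.log_mul hp₃.ne' hb₁.ne', Real.log_mul hbb.ne' hp₂.ne'] at l1 l2
    rw [abs_le]
    constructor <;> linarith

/-- Avalanche principle for unimodular `2 × 2` matrices, with an `O(1)` error per step. -/
lemma avalanche (B P : ℕ → Mat2) (hdet : ∀ i, (B i).det = 1) (hP1 : P 1 = B 0)
    (hP : ∀ i, P (i + 1) = B i * P i) (hPdet : ∀ i, (P i).det = 1)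
    {κ μ : ℝ} (hκ : 0 < κ) (hμ : 0 < μ) (hκμ : 4 ≤ κ ^ 2 * μ ^ 2) (k : ℕ)
    (hB : ∀ i, i ≤ k + 1 → μ ≤ ‖B i‖)
    (hBB : ∀ i, i ≤ k → κ * (‖B (i + 1)‖ * ‖B i‖) ≤ ‖B (i + 1) * B i‖) :
    |Real.log ‖P (k + 2)‖ - ∑ i ∈ Finset.range (k + 1), Real.log ‖B (i + 1) * B i‖
      + ∑ i ∈ Finset.range k, Real.log ‖B (i + 1)‖| ≤ k := by
  have hdet2 : ∀ i, (B (i + 1) * B i).det = 1 := by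
    intro i; rw [Matrix.det_mul, hdet, hdet, one_mul]
  suffices h : κ / 2 * (‖B (k + 1)‖ * ‖P (k + 1)‖) ≤ ‖P (k + 2)‖ ∧
      |Real.log ‖P (k + 2)‖ - ∑ i ∈ Finset.range (k + 1), Real.log ‖B (i + 1) * B i‖
      + ∑ i ∈ Finset.range k, Real.log ‖B (i + 1)‖| ≤ k from h.2
  induction k with
  | zero =>
    have h := hBB 0 le_rfl
    rw [hP 1, hP1]
    simp only [zero_add] at h ⊢
    refine ⟨?_, by simp⟩
    have : 0 ≤ κ * (‖B 1‖ * ‖B 0‖) := by positivity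
    linarith
  | succ k ih =>
    obtain ⟨ih1, ih2⟩ := ih (fun i hi => hB i (by omega)) (fun i hi => hBB i (by omega))
    have hb1 : 0 < ‖B (k + 1)‖ := lt_of_lt_of_le one_pos (Mat2.one_le_norm (hdet _))
    have hb2 : 0 < ‖B (k + 2)‖ := lt_of_lt_of_le one_pos (Mat2.one_le_norm (hdet _))
    have hp2 : 0 < ‖P (k + 2)‖ := lt_of_lt_of_le one_pos (Mat2.one_le_norm (hPdet _))
    have hp3 : 0 < ‖P (k + 3)‖ := lt_of_lt_of_le one_pos (Mat2.one_le_norm (hPdet _))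
    have hbb : 0 < ‖B (k + 2) * B (k + 1)‖ :=
      lt_of_lt_of_le one_pos (Mat2.one_le_norm (hdet2 _))
    have h1 := hBB (k + 1) le_rfl
    have h2 := hB (k + 1) (by omega)
    have key := Mat2.abs_norm_mul_sub_le (B (k + 2)) (B (k + 1)) (P (k + 1)) (hdet _)
    rw [Matrix.mul_assoc, ← hP (k + 1), ← hP (k + 2)] at key
    have hq : 4 ≤ κ ^ 2 * ‖B (k + 1)‖ ^ 2 := by
      refine hκμ.trans ?_
      gcongr
    have hp1 : 0 < ‖P (k + 1)‖ := lt_of_lt_of_le one_pos (Mat2.one_le_norm (hPdet _))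
    obtain ⟨s1, s2⟩ := avalanche_step hκ hb1 hb2 hp1 hp2 hp3 hbb hq h1 ih1 key
    refine ⟨s1, ?_⟩
    rw [Finset.sum_range_succ _ (k + 1),
      Finset.sum_range_succ (fun i => Real.log ‖B (i + 1)‖) k, show k + 1 + 2 = k + 3 from rfl,
      show k + 1 + 1 = k + 2 from rfl]
    obtain ⟨m1, m2⟩ := abs_le.1 ih2
    obtain ⟨m3, m4⟩ := abs_le.1 s2
    push_cast
    rw [abs_le]
    constructor <;> linarith

/-- The length `2π` of the circle. -/
def circPeriod : ℝ := 2 * π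

instance fact_circPeriod_pos : Fact (0 < circPeriod) := ⟨Real.two_pi_pos⟩

/-- The circle `ℝ / 2πℤ`. -/
abbrev Circ := AddCircle circPeriod

/-- The normalized Haar measure on the circle. -/
abbrev circMeas : Measure Circ := AddCircle.haarAddCircle

/-- Iterates of a complex cocycle over the rotation by `ω`. -/
def cyc (ω : Circ) (A : Circ → Mat2) : ℕ → Circ → Mat2
  | 0, _ => 1
  | n + 1, x => A (x + n • ω) * cyc ω A n x

/-- The logarithm of the norm of the iterates. -/
def logNorm (ω : Circ) (A : Circ → Mat2) (n : ℕ) (x : Circ) : ℝ := Real.log ‖cyc ω A n x‖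

/-- The finite-scale Lyapunov exponent. -/
def finLyap (ω : Circ) (A : Circ → Mat2) (n : ℕ) : ℝ := (∫ x, logNorm ω A n x ∂circMeas) / n

/-- The variance of `logNorm / n`. -/
def finVar (ω : Circ) (A : Circ → Mat2) (n : ℕ) : ℝ :=
  ∫ x, (logNorm ω A n x / n - finLyap ω A n) ^ 2 ∂circMeas

lemma cyc_add (ω : Circ) (A : Circ → Mat2) (m n : ℕ) (x : Circ) :
    cyc ω A (m + n) x = cyc ω A m (x + n • ω) * cyc ω A n x := by
  induction m with
  | zero => simp [cyc]
  | succ m ih =>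
    rw [show m + 1 + n = (m + n) + 1 by ring, cyc, cyc, ih, Matrix.mul_assoc]
    congr 2
    rw [add_nsmul]; abel

lemma cyc_det {ω : Circ} {A : Circ → Mat2} (hA : ∀ x, (A x).det = 1) (n : ℕ) (x : Circ) :
    (cyc ω A n x).det = 1 := by
  induction n with
  | zero => simp [cyc]
  | succ n ih => rw [cyc, Matrix.det_mul, hA, ih, one_mul]

lemma cyc_norm_pos {ω : Circ} {A : Circ → Mat2} (hA : ∀ x, (A x).det = 1) (n : ℕ) (x : Circ) :
    0 < ‖cyc ω A n x‖ := lt_of_lt_of_le one_pos (Mat2.one_le_norm (cyc_det hA n x))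

lemma cyc_continuous {ω : Circ} {A : Circ → Mat2} (hA : Continuous A) (n : ℕ) :
    Continuous (cyc ω A n) := by
  induction n with
  | zero => exact continuous_const
  | succ n ih => exact (hA.comp (by fun_prop)).mul ih

lemma logNorm_continuous {ω : Circ} {A : Circ → Mat2} (hA : Continuous A)
    (hd : ∀ x, (A x).det = 1) (n : ℕ) : Continuous (logNorm ω A n) :=
  (cyc_continuous hA n).norm.log fun x => (cyc_norm_pos hd n x).ne'

lemma logNorm_nonneg {ω : Circ} {A : Circ → Mat2} (hd : ∀ x, (A x).det = 1) (n : ℕ) (x : Circ) :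
    0 ≤ logNorm ω A n x := Real.log_nonneg (Mat2.one_le_norm (cyc_det hd n x))

lemma logNorm_add_le {ω : Circ} {A : Circ → Mat2} (hd : ∀ x, (A x).det = 1) (m n : ℕ) (x : Circ) :
    logNorm ω A (m + n) x ≤ logNorm ω A m (x + n • ω) + logNorm ω A n x := by
  rw [logNorm, cyc_add, logNorm, logNorm,
    ← Real.log_mul (cyc_norm_pos hd _ _).ne' (cyc_norm_pos hd _ _).ne']
  refine Real.log_le_log ?_ (norm_mul_le _ _)
  rw [← cyc_add]
  exact cyc_norm_pos hd _ _

lemma logNorm_le {ω : Circ} {A : Circ → Mat2} {Λ : ℝ} (hd : ∀ x, (A x).det = 1)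
    (hΛ : ∀ x, ‖A x‖ ≤ Real.exp Λ) (n : ℕ) (hn : 1 ≤ n) (x : Circ) :
    logNorm ω A n x ≤ n * Λ := by
  induction n, hn using Nat.le_induction with
  | base =>
    have : cyc ω A 1 x = A x := by simp [cyc]
    rw [logNorm, this, Nat.cast_one, one_mul, Real.log_le_iff_le_exp]
    · exact hΛ x
    · exact lt_of_lt_of_le one_pos (Mat2.one_le_norm (hd x))
  | succ n hn ih =>
    have h := logNorm_add_le (ω := ω) hd 1 n x
    have h1 : logNorm ω A 1 (x + n • ω) ≤ Λ := by
      have : cyc ω A 1 (x + n • ω) = A (x + n • ω) := by simp [cyc]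
      rw [logNorm, this, Real.log_le_iff_le_exp]
      · exact hΛ _
      · exact lt_of_lt_of_le one_pos (Mat2.one_le_norm (hd _))
    rw [add_comm 1 n] at h
    push_cast
    linarith

lemma continuous_integrable {f : Circ → ℝ} (hf : Continuous f) : Integrable f circMeas :=
  hf.integrable_of_hasCompactSupport (HasCompactSupport.of_compactSpace f)

lemma integral_shift (f : Circ → ℝ) (c : Circ) :
    ∫ x, f (x + c) ∂circMeas = ∫ x, f x ∂circMeas := integral_add_right_eq_self f c

lemma finLyap_subadditive {ω : Circ} {A : Circ → Mat2} (hA : Continuous A)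
    (hd : ∀ x, (A x).det = 1) : Subadditive fun n => ∫ x, logNorm ω A n x ∂circMeas := by
  intro m n
  beta_reduce
  rw [← integral_shift (logNorm ω A m) (n • ω), ← integral_add]
  · refine integral_mono (continuous_integrable (logNorm_continuous hA hd _))
      (continuous_integrable ?_) fun x => logNorm_add_le hd m n x
    exact ((logNorm_continuous hA hd _).comp (by fun_prop)).add (logNorm_continuous hA hd _)
  · exact continuous_integrable ((logNorm_continuous hA hd _).comp (by fun_prop))
  · exact continuous_integrable (logNorm_continuous hA hd _)

lemma finLyap_nonneg {ω : Circ} {A : Circ → Mat2} (hd : ∀ x, (A x).det = 1) (n : ℕ) :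
    0 ≤ finLyap ω A n :=
  div_nonneg (integral_nonneg fun x => logNorm_nonneg hd n x) (Nat.cast_nonneg _)

lemma finLyap_le {ω : Circ} {A : Circ → Mat2} {Λ : ℝ} (hA : Continuous A)
    (hd : ∀ x, (A x).det = 1) (hΛ : ∀ x, ‖A x‖ ≤ Real.exp Λ) (n : ℕ) (hn : 1 ≤ n) :
    finLyap ω A n ≤ Λ := by
  have hn' : (0 : ℝ) < n := by exact_mod_cast hn
  rw [finLyap, div_le_iff₀ hn', mul_comm]
  calc _ ≤ ∫ _, (n * Λ : ℝ) ∂circMeas :=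
        integral_mono (continuous_integrable (logNorm_continuous hA hd _))
          (integrable_const _) fun x => logNorm_le hd hΛ n hn x
    _ = n * Λ := by simp

lemma finLyap_two_mul_le {ω : Circ} {A : Circ → Mat2} (hA : Continuous A)
    (hd : ∀ x, (A x).det = 1) (n : ℕ) : finLyap ω A (2 * n) ≤ finLyap ω A n := by
  rcases Nat.eq_zero_or_pos n with rfl | hn
  · simp
  have hn' : (0 : ℝ) < n := by exact_mod_cast hn
  have h := finLyap_subadditive (ω := ω) hA hd n n
  simp only [finLyap]
  rw [div_le_div_iff₀ (by positivity) hn', two_mul n]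
  push_cast
  nlinarith

lemma sq_dev_continuous {ω : Circ} {A : Circ → Mat2} (hA : Continuous A)
    (hd : ∀ x, (A x).det = 1) (n : ℕ) :
    Continuous fun x => (logNorm ω A n x / n - finLyap ω A n) ^ 2 :=
  (((logNorm_continuous hA hd n).div_const _).sub continuous_const).pow 2

lemma avalanche_pointwise {ω : Circ} {A : Circ → Mat2} {Λ γ : ℝ}
    (hd : ∀ x, (A x).det = 1) (hΛ : ∀ x, ‖A x‖ ≤ Real.exp Λ) (hγ : 0 < γ) (n : ℕ) (hn : 1 ≤ n)
    (hnγ : 2 ≤ n * γ) (hL : γ ≤ finLyap ω A n)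
    (hdef : finLyap ω A n - finLyap ω A (2 * n) ≤ γ / 10) (k : ℕ) (x : Circ) :
    |logNorm ω A ((k + 2) * n) x
      - ∑ i ∈ Finset.range (k + 1), logNorm ω A (2 * n) (x + (i * n) • ω)
      + ∑ i ∈ Finset.range k, logNorm ω A n (x + ((i + 1) * n) • ω)| ≤
    k + 4 * (k + 2) * n * Λ * (∑ i ∈ Finset.range (k + 2),
      ((logNorm ω A n (x + (i * n) • ω) / n - finLyap ω A n) ^ 2 +
      (logNorm ω A (2 * n) (x + (i * n) • ω) / (2 * n : ℕ) - finLyap ω A (2 * n)) ^ 2)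
        / (γ / 20) ^ 2) := by
  have hn' : (0 : ℝ) < n := by exact_mod_cast hn
  have hΛ0 : 0 ≤ Λ := by
    have h1 := logNorm_le (ω := ω) hd hΛ n hn x
    have h2 := logNorm_nonneg (ω := ω) hd n x
    by_contra! h
    nlinarith
  by_cases hgood : ∀ i, i < k + 2 → |logNorm ω A n (x + (i * n) • ω) / n - finLyap ω A n| ≤ γ / 20 ∧
      |logNorm ω A (2 * n) (x + (i * n) • ω) / (2 * n : ℕ) - finLyap ω A (2 * n)| ≤ γ / 20
  · have hS : 0 ≤ ∑ i ∈ Finset.range (k + 2),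
      ((logNorm ω A n (x + (i * n) • ω) / n - finLyap ω A n) ^ 2 +
      (logNorm ω A (2 * n) (x + (i * n) • ω) / (2 * n : ℕ) - finLyap ω A (2 * n)) ^ 2)
        / (γ / 20) ^ 2 := Finset.sum_nonneg fun i _ => by positivity
    refine le_trans ?_ (le_add_of_nonneg_right (by positivity))
    have hgood1 : ∀ i, i < k + 2 → n * (finLyap ω A n - γ / 20) ≤ logNorm ω A n (x + (i * n) • ω) ∧
        logNorm ω A n (x + (i * n) • ω) ≤ n * (finLyap ω A n + γ / 20) := by
      intro i hi
      obtain ⟨h1, h2⟩ := abs_le.1 (hgood i hi).1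
      constructor
      · have : finLyap ω A n - γ / 20 ≤ logNorm ω A n (x + (i * n) • ω) / n := by linarith
        rwa [le_div_iff₀ hn', mul_comm] at this
      · have : logNorm ω A n (x + (i * n) • ω) / n ≤ finLyap ω A n + γ / 20 := by linarith
        rwa [div_le_iff₀' hn'] at this
    have hgood2 : ∀ i, i < k + 2 →
        2 * n * (finLyap ω A (2 * n) - γ / 20) ≤ logNorm ω A (2 * n) (x + (i * n) • ω) := by
      intro i hi
      obtain ⟨h1, h2⟩ := abs_le.1 (hgood i hi).2
      have : finLyap ω A (2 * n) - γ / 20 ≤ logNorm ω A (2 * n) (x + (i * n) • ω) / (2 * n : ℕ) := by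
        linarith
      rw [le_div_iff₀ (by push_cast; positivity), mul_comm] at this
      exact_mod_cast this
    have hBB : ∀ i : ℕ, cyc ω A n (x + ((i + 1) * n) • ω) * cyc ω A n (x + (i * n) • ω) =
        cyc ω A (2 * n) (x + (i * n) • ω) := by
      intro i
      rw [two_mul, cyc_add, add_assoc, ← add_nsmul]
      congr 4; ring
    have key := avalanche (fun i => cyc ω A n (x + (i * n) • ω)) (fun i => cyc ω A (i * n) x)
      (fun i => cyc_det hd _ _) (by simp) (fun i => by rw [← cyc_add]; congr 1; ring)
      (fun i => cyc_det hd _ _) (κ := Real.exp (2 * n * (finLyap ω A (2 * n) - γ / 20)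
        - 2 * (n * (finLyap ω A n + γ / 20))))
      (μ := Real.exp (n * (finLyap ω A n - γ / 20))) (Real.exp_pos _) (Real.exp_pos _) ?_ k ?_ ?_
    · simpa only [hBB, logNorm] using key
    · rw [← Real.exp_nat_mul, ← Real.exp_nat_mul, ← Real.exp_add]
      push_cast
      have h4 : (4 : ℝ) ≤ Real.exp 2 := by
        have := Real.exp_one_gt_d9
        have h2 : Real.exp 2 = Real.exp 1 * Real.exp 1 := by rw [← Real.exp_add]; norm_num
        rw [h2]; nlinarith
      refine h4.trans (Real.exp_le_exp.2 ?_)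
      have h5 : n * (finLyap ω A n - finLyap ω A (2 * n)) ≤ n * (γ / 10) := by gcongr
      have h6 : n * γ ≤ n * finLyap ω A n := by gcongr
      nlinarith
    · intro i hi
      rw [← Real.le_log_iff_exp_le (cyc_norm_pos hd _ _)]
      exact (hgood1 i (by omega)).1
    · intro i hi
      rw [hBB i, ← Real.exp_log (cyc_norm_pos hd (2 * n) (x + (i * n) • ω)),
        ← Real.exp_log (cyc_norm_pos hd n (x + (i * n) • ω)),
        ← Real.exp_log (cyc_norm_pos hd n (x + ((i + 1) * n) • ω)), ← Real.exp_add, ← Real.exp_add]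
      apply Real.exp_le_exp.2
      have h1 := (hgood1 i (by omega)).2
      have h2 := (hgood1 (i + 1) (by omega)).2
      have h3 := hgood2 i (by omega)
      simp only [logNorm] at h1 h2 h3
      linarith
  · push Not at hgood
    obtain ⟨i, hi, hbad⟩ := hgood
    have hS : 1 ≤ ∑ i ∈ Finset.range (k + 2),
      ((logNorm ω A n (x + (i * n) • ω) / n - finLyap ω A n) ^ 2 +
      (logNorm ω A (2 * n) (x + (i * n) • ω) / (2 * n : ℕ) - finLyap ω A (2 * n)) ^ 2)
        / (γ / 20) ^ 2 := by
      refine le_trans ?_ (Finset.single_le_sum (f := fun i : ℕ =>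
        ((logNorm ω A n (x + (i * n) • ω) / n - finLyap ω A n) ^ 2 +
      (logNorm ω A (2 * n) (x + (i * n) • ω) / (2 * n : ℕ) - finLyap ω A (2 * n)) ^ 2)
        / (γ / 20) ^ 2) (fun i _ => by positivity) (Finset.mem_range.2 hi))
      rw [le_div_iff₀ (by positivity), one_mul]
      by_cases h : |logNorm ω A n (x + (i * n) • ω) / n - finLyap ω A n| ≤ γ / 20
      · have := hbad h
        rw [← sq_abs (logNorm ω A (2 * n) (x + (i * n) • ω) / (2 * n : ℕ) - finLyap ω A (2 * n))]
        nlinarith [sq_nonneg (logNorm ω A n (x + (i * n) • ω) / n - finLyap ω A n)]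
      · push Not at h
        rw [← sq_abs (logNorm ω A n (x + (i * n) • ω) / n - finLyap ω A n)]
        nlinarith [sq_nonneg
          (logNorm ω A (2 * n) (x + (i * n) • ω) / (2 * n : ℕ) - finLyap ω A (2 * n))]
    have h1 : 0 ≤ ∑ i ∈ Finset.range (k + 1), logNorm ω A (2 * n) (x + (i * n) • ω) :=
      Finset.sum_nonneg fun i _ => logNorm_nonneg hd _ _
    have h2 : 0 ≤ ∑ i ∈ Finset.range k, logNorm ω A n (x + ((i + 1) * n) • ω) :=
      Finset.sum_nonneg fun i _ => logNorm_nonneg hd _ _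
    have h3 : ∑ i ∈ Finset.range (k + 1), logNorm ω A (2 * n) (x + (i * n) • ω) ≤
        (k + 1) * (2 * n * Λ) := by
      refine (Finset.sum_le_card_nsmul _ _ (2 * n * Λ) fun i _ => ?_).trans (by simp)
      exact_mod_cast logNorm_le hd hΛ (2 * n) (by omega) _
    have h4 : ∑ i ∈ Finset.range k, logNorm ω A n (x + ((i + 1) * n) • ω) ≤ k * (n * Λ) := by
      refine (Finset.sum_le_card_nsmul _ _ (n * Λ) fun i _ => ?_).trans (by simp)
      exact logNorm_le hd hΛ n hn _
    have h5 := logNorm_nonneg (ω := ω) hd ((k + 2) * n) x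
    have h6 := logNorm_le (ω := ω) hd hΛ ((k + 2) * n) (by nlinarith) x
    push_cast at h6
    have h7 : 4 * (k + 2) * n * Λ * 1 ≤ 4 * (k + 2) * n * Λ * (∑ i ∈ Finset.range (k + 2),
      ((logNorm ω A n (x + (i * n) • ω) / n - finLyap ω A n) ^ 2 +
      (logNorm ω A (2 * n) (x + (i * n) • ω) / (2 * n : ℕ) - finLyap ω A (2 * n)) ^ 2)
        / (γ / 20) ^ 2) := mul_le_mul_of_nonneg_left hS (by positivity)
    have h8 : 0 ≤ n * Λ := by positivity
    have h9 : 0 ≤ k * (n * Λ) := by positivity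
    have h10 : (0 : ℝ) ≤ k := Nat.cast_nonneg k
    rw [abs_le]
    constructor <;> nlinarith


/-- The averaged avalanche step. -/
lemma avalanche_averaged {ω : Circ} {A : Circ → Mat2} {Λ γ : ℝ} (hA : Continuous A)
    (hd : ∀ x, (A x).det = 1) (hΛ : ∀ x, ‖A x‖ ≤ Real.exp Λ) (hγ : 0 < γ) (n : ℕ) (hn : 1 ≤ n)
    (hnγ : 2 ≤ n * γ) (hL : γ ≤ finLyap ω A n)
    (hdef : finLyap ω A n - finLyap ω A (2 * n) ≤ γ / 10) (k : ℕ) :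
    |finLyap ω A ((k + 2) * n) - (2 * finLyap ω A (2 * n) - finLyap ω A n)| ≤
      1 / n + 4 * (k + 2) * Λ * (finVar ω A n + finVar ω A (2 * n)) / (γ / 20) ^ 2
        + 2 * Λ / (k + 2) := by
  have hn' : (0 : ℝ) < n := by exact_mod_cast hn
  have hc : ∀ m (c : Circ), Continuous fun x => logNorm ω A m (x + c) := fun m c =>
    (logNorm_continuous hA hd m).comp (by fun_prop)
  have hI : ∀ m (c : Circ), ∫ x, logNorm ω A m (x + c) ∂circMeas =
      ∫ x, logNorm ω A m x ∂circMeas := fun m c => integral_shift _ c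
  have hcV : ∀ (m : ℕ) (c : Circ),
      Continuous fun x => (logNorm ω A m (x + c) / m - finLyap ω A m) ^ 2 := fun m c =>
    (sq_dev_continuous hA hd m).comp (continuous_add_const c)
  have hIV : ∀ (m : ℕ) (c : Circ), ∫ x, (logNorm ω A m (x + c) / m - finLyap ω A m) ^ 2 ∂circMeas
      = finVar ω A m := fun m c =>
    integral_shift (fun x => (logNorm ω A m x / m - finLyap ω A m) ^ 2) c
  have hI0 : ∀ {f : Circ → ℝ}, Continuous f → Integrable f circMeas := continuous_integrable
  have hsum : ∀ (N : ℕ) (f : ℕ → Circ → ℝ), (∀ i, Continuous (f i)) →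
      ∫ x, ∑ i ∈ Finset.range N, f i x ∂circMeas = ∑ i ∈ Finset.range N, ∫ x, f i x ∂circMeas :=
    fun N f hf => integral_finsetSum _ fun i _ => hI0 (hf i)
  have hcs : ∀ (N : ℕ) (f : ℕ → Circ → ℝ), (∀ i, Continuous (f i)) →
      Continuous fun x => ∑ i ∈ Finset.range N, f i x :=
    fun N f hf => continuous_finsetSum _ fun i _ => hf i
  have hc1 := hcs (k + 1) (fun i x => logNorm ω A (2 * n) (x + (i * n) • ω)) fun i => hc _ _
  have hc2 := hcs k (fun i x => logNorm ω A n (x + ((i + 1) * n) • ω)) fun i => hc _ _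
  have hc3 : ∀ i : ℕ, Continuous fun x => ((logNorm ω A n (x + (i * n) • ω) / n - finLyap ω A n) ^ 2 +
      (logNorm ω A (2 * n) (x + (i * n) • ω) / (2 * n : ℕ) - finLyap ω A (2 * n)) ^ 2)
        / (γ / 20) ^ 2 := fun i => ((hcV n _).add (hcV (2 * n) _)).div_const _
  have hc4 := hcs (k + 2) _ hc3
  have key : |∫ x, (logNorm ω A ((k + 2) * n) x
      - ∑ i ∈ Finset.range (k + 1), logNorm ω A (2 * n) (x + (i * n) • ω)
      + ∑ i ∈ Finset.range k, logNorm ω A n (x + ((i + 1) * n) • ω)) ∂circMeas| ≤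
      ∫ x, (k + 4 * (k + 2) * n * Λ * (∑ i ∈ Finset.range (k + 2),
      ((logNorm ω A n (x + (i * n) • ω) / n - finLyap ω A n) ^ 2 +
      (logNorm ω A (2 * n) (x + (i * n) • ω) / (2 * n : ℕ) - finLyap ω A (2 * n)) ^ 2)
        / (γ / 20) ^ 2)) ∂circMeas := by
    refine (abs_integral_le_integral_abs).trans (integral_mono (hI0 ?_) (hI0 ?_) fun x =>
      avalanche_pointwise hd hΛ hγ n hn hnγ hL hdef k x)
    · exact (((logNorm_continuous hA hd _).sub hc1).add hc2).abs
    · exact continuous_const.add (continuous_const.mul hc4)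
  have hc5 : Continuous fun x => logNorm ω A ((k + 2) * n) x
      - ∑ i ∈ Finset.range (k + 1), logNorm ω A (2 * n) (x + (i * n) • ω) :=
    (logNorm_continuous hA hd _).sub hc1
  have hc6 : Continuous fun x => 4 * (k + 2) * n * Λ * (∑ i ∈ Finset.range (k + 2),
      ((logNorm ω A n (x + (i * n) • ω) / n - finLyap ω A n) ^ 2 +
      (logNorm ω A (2 * n) (x + (i * n) • ω) / (2 * n : ℕ) - finLyap ω A (2 * n)) ^ 2)
        / (γ / 20) ^ 2) := continuous_const.mul hc4
  rw [integral_add (hI0 hc5) (hI0 hc2),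
    integral_sub (hI0 (logNorm_continuous hA hd _)) (hI0 hc1),
    integral_add (integrable_const _) (hI0 hc6), integral_const_mul,
    hsum _ (fun i x => logNorm ω A (2 * n) (x + (i * n) • ω)) fun i => hc _ _,
    hsum _ (fun i x => logNorm ω A n (x + ((i + 1) * n) • ω)) fun i => hc _ _, hsum _ _ hc3] at key
  simp only [hI, integral_div] at key
  have h5 : ∀ i : ℕ, ∫ x, ((logNorm ω A n (x + (i * n) • ω) / n - finLyap ω A n) ^ 2 +
      (logNorm ω A (2 * n) (x + (i * n) • ω) / (2 * n : ℕ) - finLyap ω A (2 * n)) ^ 2) ∂circMeas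
      = finVar ω A n + finVar ω A (2 * n) := fun i => by
    rw [integral_add (hI0 (hcV n _)) (hI0 (hcV (2 * n) _)), hIV, hIV]
  simp only [h5] at key
  simp only [Finset.sum_const, Finset.card_range, nsmul_eq_mul, integral_const, probReal_univ,
    one_smul] at key
  have hM : ∀ m : ℕ, 1 ≤ m → ∫ x, logNorm ω A m x ∂circMeas = m * finLyap ω A m := fun m hm => by
    have : (m : ℝ) ≠ 0 := by positivity
    rw [finLyap]; field_simp
  rw [hM _ (by nlinarith), hM (2 * n) (by omega), hM n hn] at key
  push_cast at key
  have hl1 := finLyap_nonneg (ω := ω) hd n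
  have hl2 := finLyap_two_mul_le (ω := ω) hA hd n
  have hl3 := finLyap_le (ω := ω) hA hd hΛ n hn
  have hl4 := finLyap_nonneg (ω := ω) hd (2 * n)
  set V := finVar ω A n + finVar ω A (2 * n)
  have hk : (0 : ℝ) < k + 2 := by positivity
  have e1 : finLyap ω A ((k + 2) * n) - (2 * finLyap ω A (2 * n) - finLyap ω A n) =
      ((k + 2) * n * finLyap ω A ((k + 2) * n) - (k + 1) * (2 * n * finLyap ω A (2 * n))
        + k * (n * finLyap ω A n)) / ((k + 2) * n)
      - (2 * finLyap ω A (2 * n) - 2 * finLyap ω A n) / (k + 2) := by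
    field_simp; ring
  rw [e1]
  refine (abs_sub _ _).trans ?_
  refine add_le_add ?_ ?_
  · rw [abs_div, abs_of_pos (by positivity : (0 : ℝ) < (k + 2) * n)]
    rw [div_le_iff₀ (by positivity)]
    refine key.trans ?_
    have e2 : (1 / n + 4 * (k + 2) * Λ * V / (γ / 20) ^ 2) * ((k + 2) * n) =
      (k + 2) + 4 * (k + 2) * n * Λ * ((k + 2) * (V / (γ / 20) ^ 2)) := by
      field_simp
    rw [e2]; linarith
  · rw [abs_div, abs_of_pos hk]
    gcongr
    rw [abs_le]; constructor <;> linarith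

/-- Inductive scale argument: an approximate doubling relation with polynomially small error
bounds the limit from below in terms of two consecutive scales. -/
lemma scale_induction {σ C₀ Λ γ : ℝ} (hσ : 0 < σ) (hσ1 : σ ≤ 1) (hC₀ : 0 ≤ C₀) (hΛ : 0 ≤ Λ)
    (hγ : 0 < γ) (n₁ : ℕ) :
    ∃ n₀ : ℕ, ∃ B : ℝ, 0 ≤ B ∧ ∀ L V : ℕ → ℝ, (∀ n, L (2 * n) ≤ L n) →
      (∀ n, n₁ ≤ n → V n ≤ C₀ * (n : ℝ) ^ (-σ)) →
      (∀ n : ℕ, 1 ≤ n → 2 ≤ n * γ → γ ≤ L n → L n - L (2 * n) ≤ γ / 10 → ∀ k : ℕ,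
        |L ((k + 2) * n) - (2 * L (2 * n) - L n)| ≤
          1 / n + 4 * (k + 2) * Λ * (V n + V (2 * n)) / (γ / 20) ^ 2 + 2 * Λ / (k + 2)) →
      ∀ l, Tendsto L atTop (nhds l) → ∀ n, n₀ ≤ n → L n - L (2 * n) ≤ γ / 10 →
        γ ≤ L n - 2 * (L n - L (2 * n)) - B / (n : ℝ) ^ (σ / 2) →
        L n - 2 * (L n - L (2 * n)) - B / (n : ℝ) ^ (σ / 2) ≤ l := by
  set κ := σ / 2 with hκ
  have hκ0 : 0 < κ := by positivity
  set C := 1 + 25600 * C₀ * Λ / γ ^ 2 + 2 * Λ with hC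
  have hC1 : 0 < C := by positivity
  have h2κ : 1 < (2 : ℝ) ^ κ := Real.one_lt_rpow (by norm_num) hκ0
  set B := 5 * C / (1 - 1 / (2 : ℝ) ^ κ) with hB
  have hden : 0 < 1 - 1 / (2 : ℝ) ^ κ := by
    rw [sub_pos, div_lt_one (by positivity)]; exact h2κ
  have hB0 : 0 ≤ B := by positivity
  have hBe : B - B / (2 : ℝ) ^ κ = 5 * C := by
    have : B * (1 - 1 / (2 : ℝ) ^ κ) = 5 * C := by rw [hB]; exact div_mul_cancel₀ _ hden.ne'
    rw [← this]; ring
  have hev : ∀ᶠ n : ℕ in atTop, 20 * C / γ ≤ (n : ℝ) ^ κ :=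
    ((tendsto_rpow_atTop hκ0).comp tendsto_natCast_atTop_atTop).eventually_ge_atTop _
  have hev2 : ∀ᶠ n : ℕ in atTop, 2 / γ ≤ (n : ℝ) :=
    tendsto_natCast_atTop_atTop.eventually_ge_atTop _
  obtain ⟨n₀, hn₀⟩ := eventually_atTop.1
    ((hev.and hev2).and ((eventually_ge_atTop n₁).and (eventually_ge_atTop 1)))
  refine ⟨n₀, B, hB0, fun L V hL2 hV hstep l hl => ?_⟩
  set Φ : ℕ → ℝ := fun n => L n - 2 * (L n - L (2 * n)) - B / (n : ℝ) ^ κ with hΦ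
  have main : ∀ n, n₀ ≤ n → L n - L (2 * n) ≤ γ / 10 → γ ≤ Φ n →
      ∃ N, n + 1 ≤ N ∧ L N - L (2 * N) ≤ γ / 10 ∧ Φ n ≤ Φ N := by
    intro n hn hd hΦn
    obtain ⟨⟨hx1, hx2⟩, hx3, hx4⟩ := hn₀ n hn
    have hn1 : (1 : ℝ) ≤ n := by exact_mod_cast hx4
    have hn0 : (0 : ℝ) < n := by linarith
    set x := (n : ℝ) ^ κ with hx
    have hxone : 1 ≤ x := Real.one_le_rpow hn1 hκ0.le
    have hx0 : 0 < x := by linarith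
    have hxn : x ≤ n := by
      calc x ≤ (n : ℝ) ^ (1 : ℝ) := Real.rpow_le_rpow_of_exponent_le hn1 (by rw [hκ]; linarith)
        _ = n := Real.rpow_one _
    have hxσ : (n : ℝ) ^ (-σ) = 1 / x ^ 2 := by
      rw [hx, ← Real.rpow_natCast, ← Real.rpow_mul hn0.le, Real.rpow_neg hn0.le, one_div]
      congr 2; rw [hκ]; push_cast; ring
    have hV1 : V n ≤ C₀ / x ^ 2 := by
      have := hV n hx3
      rw [hxσ] at this; convert this using 1; ring
    have hV2 : V (2 * n) ≤ C₀ / x ^ 2 := by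
      have h := hV (2 * n) (by omega)
      have h2 : ((2 * n : ℕ) : ℝ) ^ (-σ) ≤ (n : ℝ) ^ (-σ) :=
        Real.rpow_le_rpow_of_nonpos hn0 (by push_cast; linarith) (by linarith)
      have h3 := mul_le_mul_of_nonneg_left h2 hC₀
      rw [hxσ] at h3
      calc _ ≤ _ := h.trans h3
        _ = _ := by ring
    have hLγ : γ ≤ L n := by
      have h1 := hL2 n
      have h2 : 0 ≤ B / x := by positivity
      simp only [hΦ] at hΦn
      linarith
    have hnγ : 2 ≤ n * γ := by rwa [div_le_iff₀ hγ] at hx2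
    have herr : ∀ k : ℕ, x ≤ k + 2 → (k : ℝ) + 2 ≤ 8 * x →
        |L ((k + 2) * n) - (2 * L (2 * n) - L n)| ≤ C / x := by
      intro k hk1 hk2
      refine (hstep n hx4 hnγ hLγ hd k).trans ?_
      have a1 : 1 / (n : ℝ) ≤ 1 / x := by gcongr
      have a2 : 2 * Λ / (k + 2) ≤ 2 * Λ / x := by gcongr
      have a3 : 4 * (k + 2) * Λ * (V n + V (2 * n)) / (γ / 20) ^ 2 ≤
          4 * (8 * x) * Λ * (C₀ / x ^ 2 + C₀ / x ^ 2) / (γ / 20) ^ 2 := by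
        have : 0 ≤ C₀ / x ^ 2 + C₀ / x ^ 2 := by positivity
        calc _ ≤ 4 * (k + 2) * Λ * (C₀ / x ^ 2 + C₀ / x ^ 2) / (γ / 20) ^ 2 := by gcongr
          _ ≤ _ := by gcongr
      have a4 : 4 * (8 * x) * Λ * (C₀ / x ^ 2 + C₀ / x ^ 2) / (γ / 20) ^ 2 =
          25600 * C₀ * Λ / γ ^ 2 / x := by field_simp; ring
      have a5 : C / x = 1 / x + 25600 * C₀ * Λ / γ ^ 2 / x + 2 * Λ / x := by
        rw [hC]; ring
      linarith
    set k := ⌈x⌉₊ with hk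
    have hk1 : x ≤ k := Nat.le_ceil x
    have hk2 : (k : ℝ) < x + 1 := Nat.ceil_lt_add_one hx0.le
    have e1 := herr k (by linarith) (by linarith)
    have e2 := herr (2 * k + 2) (by push_cast; linarith) (by push_cast; linarith)
    rw [show (2 * k + 2 + 2) * n = 2 * ((k + 2) * n) by ring] at e2
    rw [abs_le] at e1 e2
    set N := (k + 2) * n with hN
    have hCx : C / x ≤ γ / 20 := by
      rw [div_le_div_iff₀ hx0 (by norm_num)]
      rw [div_le_iff₀ hγ] at hx1
      linarith
    refine ⟨N, by nlinarith, by linarith, ?_⟩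
    have hNx : (2 : ℝ) ^ κ * x ≤ (N : ℝ) ^ κ := by
      rw [hx, ← Real.mul_rpow (by norm_num) hn0.le]
      refine Real.rpow_le_rpow (by positivity) ?_ hκ0.le
      rw [hN]; push_cast
      gcongr
      have : (0 : ℝ) ≤ k := Nat.cast_nonneg k
      linarith
    have hBN : B / (N : ℝ) ^ κ ≤ B / ((2 : ℝ) ^ κ * x) := by gcongr
    have hBx : B / x - B / ((2 : ℝ) ^ κ * x) = 5 * (C / x) := by
      rw [← div_div, ← sub_div, hBe]; ring
    simp only [hΦ]
    linarith
  intro n hn hd hΦn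
  have iter : ∀ j : ℕ, ∃ N, n + j ≤ N ∧ L N - L (2 * N) ≤ γ / 10 ∧ Φ n ≤ Φ N := by
    intro j
    induction j with
    | zero => exact ⟨n, le_rfl, hd, le_rfl⟩
    | succ j ih =>
      obtain ⟨N, h1, h2, h3⟩ := ih
      obtain ⟨N', h4, h5, h6⟩ := main N (by omega) h2 (hΦn.trans h3)
      exact ⟨N', by omega, h5, h3.trans h6⟩
  refine ge_of_tendsto_of_frequently hl (frequently_atTop.2 fun j => ?_)
  obtain ⟨N, h1, h2, h3⟩ := iter j
  refine ⟨N, by omega, ?_⟩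
  have h4 := hL2 N
  have h5 : 0 ≤ B / (N : ℝ) ^ κ := by positivity
  simp only [hΦ] at h3
  linarith

end

section Diophantine

open GenContFract

lemma not_terminatedAt_of_irrational {α : ℝ} (hα : Irrational α) (n : ℕ) :
    ¬(GenContFract.of α).TerminatedAt n := by
  intro h
  obtain ⟨q, hq⟩ := (GenContFract.terminates_iff_rat α).1 ⟨n, h⟩
  exact hα ⟨q, hq.symm⟩

lemma contsAux_int {α : ℝ} (hα : Irrational α) (n : ℕ) :
    (∃ a : ℤ, ((GenContFract.of α).contsAux n).a = a) ∧
      ∃ b : ℤ, ((GenContFract.of α).contsAux n).b = b := by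
  induction n using Nat.strong_induction_on with
  | _ n ih =>
  match n with
  | 0 => exact ⟨⟨1, by simp⟩, ⟨0, by simp⟩⟩
  | 1 => exact ⟨⟨⌊α⌋, by simp [GenContFract.of_h_eq_floor]⟩, ⟨1, by simp⟩⟩
  | n + 2 =>
    obtain ⟨⟨a, ha⟩, ⟨b, hb⟩⟩ := ih n (by omega)
    obtain ⟨⟨a', ha'⟩, ⟨b', hb'⟩⟩ := ih (n + 1) (by omega)
    obtain ⟨gp, hgp⟩ := Option.ne_none_iff_exists'.1 (not_terminatedAt_of_irrational hα n)
    obtain ⟨h1, z, hz⟩ := GenContFract.of_partNum_eq_one_and_exists_int_partDen_eq hgp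
    rw [GenContFract.contsAux_recurrence hgp rfl rfl]
    simp only [h1, hz, ha, hb, ha', hb']
    exact ⟨⟨z * a' + 1 * a, by push_cast; ring⟩, ⟨z * b' + 1 * b, by push_cast; ring⟩⟩

/-- Irrationals of bounded type are badly approximable. -/
lemma BoundedType.exists_badly_approximable {α M : ℝ} (hα : Irrational α) (hM : 0 < M)
    (hbdd : BoundedType α M) :
    ∃ c > 0, ∀ k : ℤ, k ≠ 0 → ∀ p : ℤ, c / |(k : ℝ)| ≤ |k * α - p| := by
  have hP : ∀ n, ∃ a : ℤ, (GenContFract.of α).nums n = a := fun n => (contsAux_int hα (n + 1)).1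
  have hQ : ∀ n, ∃ a : ℤ, (GenContFract.of α).dens n = a := fun n => (contsAux_int hα (n + 1)).2
  choose P hP using hP
  choose Q hQ using hQ
  have hmono : ∀ n, Q n ≤ Q (n + 1) := fun n => by
    have h := GenContFract.of_den_mono (v := α) (n := n)
    rw [hQ, hQ] at h; exact_mod_cast h
  have hQ0 : Q 0 = 1 := by
    have h := GenContFract.zeroth_den_eq_one (g := GenContFract.of α)
    rw [hQ] at h; exact_mod_cast h
  have hQ1 : ∀ n, 1 ≤ Q n := fun n => hQ0 ▸ monotone_nat_of_le_succ hmono (Nat.zero_le n)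
  have hQM : ∀ n, (Q (n + 1) : ℝ) ≤ M * Q n := fun n => by
    have h := hbdd n
    rwa [cfDen, cfDen, hQ, hQ] at h
  have hdet : ∀ n, P n * Q (n + 1) - Q n * P (n + 1) = (-1) ^ (n + 1) := fun n => by
    have h := SimpContFract.determinant (s := SimpContFract.of α) (n := n)
      (not_terminatedAt_of_irrational hα n)
    have h' : (P n * Q (n + 1) - Q n * P (n + 1) : ℝ) = (-1) ^ (n + 1) := by
      rw [← hP, ← hP, ← hQ, ← hQ]; exact h
    exact_mod_cast h'
  have herr : ∀ n, |Q n * α - P n| ≤ 1 / Q (n + 1) := fun n => by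
    have h := GenContFract.abs_sub_convs_le (v := α) (not_terminatedAt_of_irrational hα n)
    rw [GenContFract.conv_eq_num_div_den, hP, hQ, hQ] at h
    have h1 : (0 : ℝ) < Q n := by exact_mod_cast hQ1 n
    have h2 : (Q n * α - P n : ℝ) = Q n * (α - P n / Q n) := by field_simp
    rw [h2, abs_mul, abs_of_pos h1]
    calc (Q n : ℝ) * |α - P n / Q n| ≤ Q n * (1 / (Q n * Q (n + 1))) := by gcongr
      _ = 1 / Q (n + 1) := by field_simp
  have hunb : ∀ x : ℤ, ∃ n, x ≤ Q n := fun x => by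
    have h : ∀ n : ℕ, (Nat.fib (n + 1) : ℝ) ≤ Q n := fun n => by
      have h := GenContFract.succ_nth_fib_le_of_nth_den (v := α) (n := n)
        (Or.inr (not_terminatedAt_of_irrational hα _))
      rwa [hQ] at h
    refine ⟨x.toNat + 4, ?_⟩
    have h1 := h (x.toNat + 4)
    have h2 := Nat.le_fib_self (n := x.toNat + 4 + 1) (by omega)
    have h3 : (Nat.fib (x.toNat + 4 + 1) : ℤ) ≤ Q (x.toNat + 4) := by exact_mod_cast h1
    omega
  have main : ∀ k : ℤ, 0 < k → ∀ p : ℤ, 1 / (4 * M ^ 2) / (k : ℝ) ≤ |k * α - p| := by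
    intro k hk p
    have hk' : (0 : ℝ) < k := by exact_mod_cast hk
    classical
    have hex := hunb (2 * k)
    have hm := Nat.find_spec hex
    obtain ⟨m, hm'⟩ : ∃ m, Nat.find hex = m + 1 := by
      refine Nat.exists_eq_succ_of_ne_zero fun h => ?_
      rw [h, hQ0] at hm; omega
    have hlt : Q m < 2 * k := by
      have := Nat.find_min hex (m := m) (by omega)
      omega
    rw [hm'] at hm
    have hlt' : (Q m : ℝ) ≤ 2 * k := by exact_mod_cast hlt.le
    have hb2 : (Q (m + 2) : ℝ) ≤ 2 * M ^ 2 * k := by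
      calc (Q (m + 2) : ℝ) ≤ M * Q (m + 1) := hQM _
        _ ≤ M * (M * (2 * k)) := by
            gcongr
            exact (hQM m).trans (by gcongr)
        _ = _ := by ring
    have hb1 : (Q (m + 1) : ℝ) ≤ 2 * M ^ 2 * k := by
      refine le_trans ?_ hb2
      exact_mod_cast hmono (m + 1)
    have key : ∀ j, 2 * k ≤ Q (j + 1) → (Q j : ℝ) ≤ 2 * M ^ 2 * k → P j * k - Q j * p ≠ 0 →
        1 / (4 * M ^ 2) / (k : ℝ) ≤ |k * α - p| := by
      intro j h1 h2 h3
      have h4 : (1 : ℝ) ≤ |(P j * k - Q j * p : ℝ)| := by exact_mod_cast Int.one_le_abs h3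
      have h5 : (P j * k - Q j * p : ℝ) = Q j * (k * α - p) - k * (Q j * α - P j) := by ring
      have h6 : (0 : ℝ) < Q j := by exact_mod_cast hQ1 j
      have h7 : (2 * k : ℝ) ≤ Q (j + 1) := by exact_mod_cast h1
      have h8 : (k : ℝ) * |Q j * α - P j| ≤ 1 / 2 := by
        calc (k : ℝ) * |Q j * α - P j| ≤ k * (1 / (2 * k)) := by
              gcongr
              exact (herr j).trans (by gcongr)
          _ = 1 / 2 := by field_simp
      rw [h5] at h4
      have h9 := h4.trans (abs_sub _ _)
      rw [abs_mul, abs_mul, abs_of_pos h6, abs_of_pos hk'] at h9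
      have h10 : (Q j : ℝ) * |k * α - p| ≤ 2 * M ^ 2 * k * |k * α - p| := by gcongr
      rw [div_div, div_le_iff₀ (by positivity)]
      nlinarith
    by_cases h : P (m + 1) * k - Q (m + 1) * p = 0
    · by_cases h' : P (m + 2) * k - Q (m + 2) * p = 0
      · exfalso
        have h1 := hdet (m + 1)
        have h2 : k * (P (m + 1) * Q (m + 1 + 1) - Q (m + 1) * P (m + 1 + 1)) = 0 := by
          linear_combination Q (m + 2) * h - Q (m + 1) * h'
        rw [h1] at h2
        rcases mul_eq_zero.1 h2 with h3 | h3
        · omega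
        · exact absurd h3 (pow_ne_zero _ (by norm_num))
      · exact key (m + 2) (hm.trans ((hmono _).trans (hmono _))) hb2 h'
    · exact key (m + 1) (hm.trans (hmono _)) hb1 h
  refine ⟨1 / (4 * M ^ 2), by positivity, fun k hk p => ?_⟩
  rcases lt_or_gt_of_ne hk with h | h
  · have h1 := main (-k) (by omega) (-p)
    push_cast at h1
    rw [abs_of_neg (by exact_mod_cast h), ← abs_neg]
    convert h1 using 2; ring
  · rw [abs_of_pos (by exact_mod_cast h)]
    exact main k h p

end Diophantine

section

open scoped Matrix.Norms.Frobenius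

/-- The Diophantine condition `‖kα‖ ≥ c / |k|`. -/
def BadlyApprox (c α : ℝ) : Prop := ∀ k : ℤ, k ≠ 0 → ∀ p : ℤ, c / |(k : ℝ)| ≤ |k * α - p|

/-- The weight attached to the `j`-th cell of a separated point set on the circle. -/
def cellWeight (c : ℝ) (j : ℕ) : ℝ := (1 + 1 / c ^ 2) * (1 / ((j + 1 : ℕ) : ℝ) ^ 2)

lemma cellWeight_summable (c : ℝ) : Summable (cellWeight c) :=
  (((summable_nat_add_iff 1).2 (Real.summable_one_div_nat_pow.2 (one_lt_two)))).mul_left _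

lemma cellWeight_nonneg (c : ℝ) (j : ℕ) : 0 ≤ cellWeight c j := by
  unfold cellWeight; positivity

lemma sq_le_cellWeight_of_le_fract {c a f : ℝ} (hc : 0 < c) (ha : 0 ≤ a) (ha1 : a ≤ 1) {q : ℕ}
    (hq : 1 ≤ q) (haf : a * (2 * q * f) ≤ 1) (hf : 0 ≤ f) :
    a ^ 2 ≤ cellWeight c ⌊f * q / c⌋₊ := by
  set j := ⌊f * q / c⌋₊ with hj
  have hjle : (j : ℝ) ≤ f * q / c := Nat.floor_le (by positivity)
  unfold cellWeight
  rcases Nat.eq_zero_or_pos j with h | h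
  · rw [h]
    have : 0 ≤ 1 / c ^ 2 := by positivity
    norm_num
    have h2 : a ^ 2 ≤ 1 := pow_le_one₀ ha ha1
    have h3 : 0 ≤ (c ^ 2)⁻¹ := by positivity
    linarith
  · have hj1 : (1 : ℝ) ≤ j := by exact_mod_cast h
    rw [le_div_iff₀ hc] at hjle
    have h1 : a * (c * (j + 1)) ≤ 1 := by
      exact (mul_le_mul_of_nonneg_left (by nlinarith) ha).trans haf
    have h2 : a ≤ 1 / (c * (j + 1)) := by rwa [le_div_iff₀ (by positivity)]
    calc a ^ 2 ≤ (1 / (c * (j + 1))) ^ 2 := by gcongr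
      _ = 1 / c ^ 2 * (1 / ((j + 1 : ℕ) : ℝ) ^ 2) := by push_cast; field_simp
      _ ≤ _ := by gcongr; linarith

lemma sum_cellWeight_le {c α : ℝ} (hc : 0 < c) (hα : BadlyApprox c α) {q : ℕ} (hq : 1 ≤ q)
    (s : Finset ℤ) (hs : ∀ k ∈ s, ∀ l ∈ s, |k - l| < q) :
    ∑ k ∈ s, cellWeight c ⌊Int.fract (k * α) * q / c⌋₊ ≤ ∑' j, cellWeight c j := by
  classical
  have hq0 : (0 : ℝ) < q := by exact_mod_cast hq
  have hinj : ∀ k ∈ s, ∀ l ∈ s, ⌊Int.fract (k * α) * q / c⌋₊ = ⌊Int.fract (l * α) * q / c⌋₊ →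
      k = l := by
    intro k hk l hl h
    by_contra hne
    have hkl : (k - l : ℤ) ≠ 0 := sub_ne_zero.2 hne
    have h1 := hα (k - l) hkl (⌊(k * α : ℝ)⌋ - ⌊(l * α : ℝ)⌋)
    have h2 : ((k - l : ℤ) : ℝ) * α - ((⌊(k * α : ℝ)⌋ - ⌊(l * α : ℝ)⌋ : ℤ) : ℝ) =
        Int.fract (k * α) - Int.fract (l * α) := by
      rw [Int.fract, Int.fract]; push_cast; ring
    rw [h2] at h1
    have h3 : c / q ≤ |Int.fract (k * α) - Int.fract (l * α)| := by
      refine le_trans ?_ h1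
      have : |((k - l : ℤ) : ℝ)| ≤ q := by exact_mod_cast (hs k hk l hl).le
      have h4 : 0 < |((k - l : ℤ) : ℝ)| := abs_pos.2 (by exact_mod_cast hkl)
      gcongr
    have h5 : ∀ x : ℝ, 0 ≤ x * q / c → (⌊x * q / c⌋₊ : ℝ) ≤ x * q / c ∧
      x * q / c < ⌊x * q / c⌋₊ + 1 := fun x hx => ⟨Nat.floor_le hx, Nat.lt_floor_add_one _⟩
    have hk5 := h5 (Int.fract (k * α)) (by have := Int.fract_nonneg (k * α); positivity)
    have hl5 := h5 (Int.fract (l * α)) (by have := Int.fract_nonneg (l * α); positivity)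
    rw [h] at hk5
    have h6 : |Int.fract (k * α) * q / c - Int.fract (l * α) * q / c| < 1 := by
      rw [abs_lt]; constructor <;> linarith
    have h7 : Int.fract (k * α) * q / c - Int.fract (l * α) * q / c =
        (q / c) * (Int.fract (k * α) - Int.fract (l * α)) := by ring
    rw [h7, abs_mul, abs_of_pos (by positivity)] at h6
    have h8 : (q / c) * (c / q) ≤ (q / c) * |Int.fract (k * α) - Int.fract (l * α)| := by gcongr
    have h9 : (q / c : ℝ) * (c / q) = 1 := by field_simp
    linarith
  rw [← Finset.sum_image (f := cellWeight c) (g := fun k : ℤ => ⌊Int.fract (k * α) * q / c⌋₊) hinj]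
  exact (cellWeight_summable c).sum_le_tsum _ fun j _ => cellWeight_nonneg c j

lemma BadlyApprox.neg {c α : ℝ} (hα : BadlyApprox c α) : BadlyApprox c (-α) := fun k hk p => by
  have := hα k hk (-p)
  rwa [abs_sub_comm, show (p - k * -α : ℝ) = k * α - ((-p : ℤ) : ℝ) by push_cast; ring]

/-- Large sieve type bound over a block of frequencies. -/
lemma sum_sq_block_le {c α : ℝ} (hc : 0 < c) (hα : BadlyApprox c α) {q : ℕ} (hq : 1 ≤ q)
    (s : Finset ℤ) (hs : ∀ k ∈ s, ∀ l ∈ s, |k - l| < q) (a : ℤ → ℝ) (ha : ∀ k, 0 ≤ a k)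
    (ha1 : ∀ k, a k ≤ 1) (hak : ∀ k : ℤ, a k * (2 * q * |k * α - round (k * α)|) ≤ 1) :
    ∑ k ∈ s, a k ^ 2 ≤ 2 * ∑' j, cellWeight c j := by
  have h : ∀ k ∈ s, a k ^ 2 ≤ cellWeight c ⌊Int.fract (k * α) * q / c⌋₊ +
      cellWeight c ⌊Int.fract (k * -α) * q / c⌋₊ := by
    intro k _
    have h1 := hak k
    rw [abs_sub_round_eq_min] at h1
    rcases le_total (Int.fract (k * α)) (1 - Int.fract (k * α)) with h2 | h2
    · rw [min_eq_left h2] at h1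
      have := sq_le_cellWeight_of_le_fract hc (ha k) (ha1 k) hq h1 (Int.fract_nonneg _)
      have := cellWeight_nonneg c ⌊Int.fract (k * -α) * q / c⌋₊
      linarith
    · rw [min_eq_right h2] at h1
      have h3 : Int.fract (k * -α) = 1 - Int.fract (k * α) := by
        rw [mul_neg, Int.fract_neg]
        intro h0; rw [h0] at h2; norm_num at h2
      rw [← h3] at h1
      have := sq_le_cellWeight_of_le_fract hc (ha k) (ha1 k) hq h1 (Int.fract_nonneg _)
      have := cellWeight_nonneg c ⌊Int.fract (k * α) * q / c⌋₊
      linarith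
  refine (Finset.sum_le_sum h).trans ?_
  rw [Finset.sum_add_distrib]
  have h1 := sum_cellWeight_le hc hα hq s hs
  have h2 := sum_cellWeight_le hc hα.neg hq s hs
  linarith

/-- The sum of the inverse squares over the integers. -/
def invSqSum : ℝ := ∑' m : ℤ, 1 / (m : ℝ) ^ 2

lemma sum_sq_high_le {c α : ℝ} (hc : 0 < c) (hα : BadlyApprox c α) {q : ℕ} (hq : 1 ≤ q)
    (s : Finset ℤ) (hs : ∀ k ∈ s, (q : ℤ) ≤ |k|) (a : ℤ → ℝ) (ha : ∀ k, 0 ≤ a k)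
    (ha1 : ∀ k, a k ≤ 1) (hak : ∀ k : ℤ, a k * (2 * q * |k * α - round (k * α)|) ≤ 1) :
    ∑ k ∈ s, (a k / |(k : ℝ)|) ^ 2 ≤ 8 * (∑' j, cellWeight c j) * invSqSum / (q : ℝ) ^ 2 := by
  classical
  have hq0 : (0 : ℤ) < q := by exact_mod_cast hq
  have hq0' : (0 : ℝ) < q := by exact_mod_cast hq
  rw [← Finset.sum_fiberwise_of_maps_to (s := s) (t := s.image (· / (q : ℤ))) (g := (· / (q : ℤ)))
    fun k hk => Finset.mem_image_of_mem _ hk]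
  have hfib : ∀ m ∈ s.image (· / (q : ℤ)), ∑ k ∈ s with k / (q : ℤ) = m, (a k / |(k : ℝ)|) ^ 2 ≤
      8 * (∑' j, cellWeight c j) / (q : ℝ) ^ 2 * (1 / (m : ℝ) ^ 2) := by
    intro m _
    have h1 : ∀ k ∈ s.filter (fun k => k / (q : ℤ) = m), (a k / |(k : ℝ)|) ^ 2 ≤
        a k ^ 2 * (4 / (q : ℝ) ^ 2 * (1 / (m : ℝ) ^ 2)) := by
      intro k hk
      rw [Finset.mem_filter] at hk
      obtain ⟨hk1, rfl⟩ := hk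
      have hkq := hs k hk1
      have hm0 : k / (q : ℤ) ≠ 0 := by
        intro h0
        have h1 := Int.ediv_mul_add_emod k q
        rw [h0] at h1
        have h2 := Int.emod_nonneg k hq0.ne'
        have h3 := Int.emod_lt_of_pos k hq0
        rw [abs_of_nonneg (by omega)] at hkq
        omega
      have h2 : |k / (q : ℤ)| * q ≤ 2 * |k| := by
        have h1 := Int.ediv_mul_add_emod k q
        have h2 := Int.emod_nonneg k hq0.ne'
        have h3 := Int.emod_lt_of_pos k hq0
        have h4 : |k / (q : ℤ)| * q = |k - k % q| := by
          rw [← abs_of_pos hq0, ← abs_mul, abs_of_pos hq0]; congr 1; linarith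
        rw [h4]
        have h5 := abs_sub k (k % q)
        rw [abs_of_nonneg h2] at h5
        omega
      have h2' : |((k / (q : ℤ) : ℤ) : ℝ)| * q ≤ 2 * |(k : ℝ)| := by exact_mod_cast h2
      have h3 : 0 < |((k / (q : ℤ) : ℤ) : ℝ)| := abs_pos.2 (by exact_mod_cast hm0)
      have h4 : a k / |(k : ℝ)| ≤ a k * (2 / (q * |((k / (q : ℤ) : ℤ) : ℝ)|)) := by
        rw [div_eq_mul_inv]
        refine mul_le_mul_of_nonneg_left ?_ (ha k)
        rw [inv_eq_one_div, div_le_div_iff₀ (by nlinarith [mul_pos h3 hq0']) (by positivity)]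
        linarith
      calc (a k / |(k : ℝ)|) ^ 2 ≤ (a k * (2 / (q * |((k / (q : ℤ) : ℤ) : ℝ)|))) ^ 2 := by
            have := ha k
            gcongr
        _ = _ := by
            rw [mul_pow, div_pow, mul_pow, sq_abs]; ring
    refine (Finset.sum_le_sum h1).trans ?_
    rw [← Finset.sum_mul]
    have h2 := sum_sq_block_le hc hα hq (s.filter (fun k => k / (q : ℤ) = m)) ?_ a ha ha1 hak
    · calc _ ≤ (2 * ∑' j, cellWeight c j) * (4 / (q : ℝ) ^ 2 * (1 / (m : ℝ) ^ 2)) := by gcongr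
        _ = _ := by ring
    · intro k hk l hl
      rw [Finset.mem_filter] at hk hl
      have h1 := Int.ediv_mul_add_emod k q
      have h1' := Int.ediv_mul_add_emod l q
      have h2 := Int.emod_nonneg k hq0.ne'
      have h3 := Int.emod_lt_of_pos k hq0
      have h4 := Int.emod_nonneg l hq0.ne'
      have h5 := Int.emod_lt_of_pos l hq0
      rw [hk.2] at h1
      rw [hl.2] at h1'
      rw [abs_lt]; omega
  refine (Finset.sum_le_sum hfib).trans ?_
  rw [← Finset.mul_sum]
  have h3 : ∑ m ∈ s.image (· / (q : ℤ)), 1 / (m : ℝ) ^ 2 ≤ invSqSum :=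
    (Real.summable_one_div_int_pow.2 one_lt_two).sum_le_tsum _ fun _ _ => by positivity
  have h4 : 0 ≤ ∑' j, cellWeight c j := tsum_nonneg (cellWeight_nonneg c)
  calc _ ≤ 8 * (∑' j, cellWeight c j) / (q : ℝ) ^ 2 * invSqSum := by gcongr
    _ = _ := by ring


/-- Geometric averages of unimodular numbers. -/
lemma norm_geom_average_le {R : ℕ} (hR : 1 ≤ R) {z : ℂ} (hz : ‖z‖ = 1) :
    ‖(1 / (R : ℂ)) * ∑ j ∈ Finset.range R, z ^ j‖ ≤ 1 ∧
      ‖(1 / (R : ℂ)) * ∑ j ∈ Finset.range R, z ^ j‖ * (R * ‖z - 1‖) ≤ 2 := by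
  have hR0 : (0 : ℝ) < R := by exact_mod_cast hR
  have hn : ‖(1 / (R : ℂ)) * ∑ j ∈ Finset.range R, z ^ j‖ =
      ‖∑ j ∈ Finset.range R, z ^ j‖ / R := by
    rw [norm_mul, norm_div, norm_one, Complex.norm_natCast]; ring
  rw [hn]
  constructor
  · rw [div_le_one hR0]
    refine (norm_sum_le _ _).trans ?_
    simp [hz]
  · have h1 : ‖∑ j ∈ Finset.range R, z ^ j‖ / R * (R * ‖z - 1‖) = ‖z ^ R - 1‖ := by
      rw [← geom_sum_mul, norm_mul]; field_simp
    rw [h1]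
    refine (norm_sub_le _ _).trans ?_
    rw [norm_pow, hz, one_pow, norm_one]; norm_num

lemma four_mul_dist_round_le (θ : ℝ) :
    4 * |θ - round θ| ≤ ‖Complex.exp (2 * π * Complex.I * θ) - 1‖ := by
  have h1 : Complex.exp (2 * π * Complex.I * θ) =
      Complex.exp (Complex.I * ((2 * π * (θ - round θ) : ℝ) : ℂ)) := by
    rw [show (2 * π * Complex.I * θ : ℂ) = Complex.I * ((2 * π * (θ - round θ) : ℝ) : ℂ) +
      (round θ : ℤ) * (2 * π * Complex.I) by push_cast; ring]
    exact Complex.exp_periodic.int_mul _ _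
  rw [h1, Complex.norm_exp_I_mul_ofReal_sub_one, show 2 * π * (θ - round θ) / 2 =
    π * (θ - round θ) by ring, norm_mul, Real.norm_eq_abs, Real.norm_eq_abs, abs_of_pos (two_pos (α := ℝ))]
  have h2 := abs_sub_round θ
  have h3 := Real.mul_abs_le_abs_sin (x := π * (θ - round θ)) (by
    rw [abs_mul, abs_of_pos Real.pi_pos]
    nlinarith [Real.pi_pos])
  rw [abs_mul, abs_of_pos Real.pi_pos] at h3
  have h4 : 2 / π * (π * |θ - round θ|) = 2 * |θ - round θ| := by
    field_simp
  linarith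

/-- Parseval's identity for continuous functions on the circle. -/
lemma hasSum_sq_fourierCoeff_of_continuous {f : Circ → ℂ} (hf : Continuous f) :
    HasSum (fun k => ‖fourierCoeff f k‖ ^ 2) (∫ x, ‖f x‖ ^ 2 ∂circMeas) := by
  have h := hasSum_sq_fourierCoeff
    (ContinuousMap.toLp (E := ℂ) 2 AddCircle.haarAddCircle ℂ (⟨f, hf⟩ : C(Circ, ℂ)))
  simp only [fourierCoeff_toLp] at h
  have h2 : ∫ x, ‖ContinuousMap.toLp (E := ℂ) 2 AddCircle.haarAddCircle ℂ
      (⟨f, hf⟩ : C(Circ, ℂ)) x‖ ^ 2 ∂circMeas = ∫ x, ‖f x‖ ^ 2 ∂circMeas := by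
    refine integral_congr_ae ?_
    filter_upwards [ContinuousMap.coeFn_toLp (E := ℂ) (p := 2) (𝕜 := ℂ) AddCircle.haarAddCircle
      (⟨f, hf⟩ : C(Circ, ℂ))] with x hx
    rw [hx]; rfl
  rw [h2] at h
  exact h

lemma fourier_arg_add (n : ℤ) (x y : Circ) :
    (fourier n (x + y) : ℂ) = fourier n x * fourier n y := by
  simp only [fourier_apply, smul_add, AddCircle.toCircle_add, Circle.coe_mul]

lemma fourierCoeff_shift (f : Circ → ℂ) (c : Circ) (k : ℤ) :
    fourierCoeff (fun x => f (x + c)) k = fourier k c * fourierCoeff f k := by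
  have h1 : ∀ x : Circ, fourier (-k) x • f (x + c) =
      fourier k c * (fun y => fourier (-k) y • f y) (x + c) := by
    intro x
    simp only [smul_eq_mul]
    have h2 : (fourier k c : ℂ) * fourier (-k) (x + c) = fourier (-k) x := by
      rw [fourier_arg_add, mul_left_comm, ← fourier_add]
      simp
    rw [← mul_assoc, h2]
  rw [fourierCoeff, fourierCoeff]
  simp_rw [h1]
  rw [integral_const_mul, integral_add_right_eq_self (fun y => fourier (-k) y • f y) c]


lemma fourier_arg_nsmul (n : ℤ) (j : ℕ) (x : Circ) :
    (fourier n (j • x) : ℂ) = (fourier n x : ℂ) ^ j := by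
  induction j with
  | zero => simp
  | succ j ih => rw [succ_nsmul, fourier_arg_add, ih, pow_succ]

/-- The multiplier of the Birkhoff average of length `R` at frequency `k`. -/
def birkhoffMult (ω : Circ) (R : ℕ) (k : ℤ) : ℂ :=
  (1 / (R : ℂ)) * ∑ j ∈ Finset.range R, (fourier k ω : ℂ) ^ j

lemma fourierCoeff_birkhoff {U : Circ → ℂ} (hU : Continuous U) (ω : Circ) (R : ℕ) (k : ℤ) :
    fourierCoeff (fun x => (1 / (R : ℂ)) * ∑ j ∈ Finset.range R, U (x + j • ω)) k =
      birkhoffMult ω R k * fourierCoeff U k := by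
  rw [fourierCoeff.const_mul, birkhoffMult, mul_assoc]
  congr 1
  have h := fourierCoeff.sum (T := circPeriod) (Finset.range R) (fun j x => U (x + j • ω))
    fun j _ => (hU.comp (continuous_add_const _)).integrable_of_hasCompactSupport
      (HasCompactSupport.of_compactSpace _)
  have h2 : (∑ j ∈ Finset.range R, fun x => U (x + j • ω)) =
      fun x => ∑ j ∈ Finset.range R, U (x + j • ω) := by
    ext x; simp
  rw [← h2, h, Finset.sum_apply, Finset.sum_mul]
  refine Finset.sum_congr rfl fun j _ => ?_
  rw [fourierCoeff_shift, fourier_arg_nsmul]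

lemma birkhoffMult_le {α : ℝ} {R : ℕ} (hR : 1 ≤ R) (k : ℤ) :
    ‖birkhoffMult ((2 * π * α : ℝ) : Circ) R k‖ ≤ 1 ∧
      ‖birkhoffMult ((2 * π * α : ℝ) : Circ) R k‖ * (2 * R * |k * α - round (k * α)|) ≤ 1 := by
  have hz : ‖(fourier k ((2 * π * α : ℝ) : Circ) : ℂ)‖ = 1 := Circle.norm_coe _
  obtain ⟨h1, h2⟩ := norm_geom_average_le hR hz
  refine ⟨h1, ?_⟩
  have h3 := four_mul_dist_round_le (k * α)
  have h4 : (fourier k ((2 * π * α : ℝ) : Circ) : ℂ) =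
      Complex.exp (2 * π * Complex.I * ((k * α : ℝ) : ℂ)) := by
    rw [fourier_coe_apply]
    congr 1
    have : (π : ℂ) ≠ 0 := by exact_mod_cast Real.pi_ne_zero
    simp only [circPeriod]
    push_cast
    field_simp
  rw [← h4] at h3
  have h5 : ‖birkhoffMult ((2 * π * α : ℝ) : Circ) R k‖ * (R * (4 * |k * α - round (k * α)|)) ≤ 2 :=
    le_trans (by unfold birkhoffMult; gcongr) h2
  linarith

/-- `L²` deviation bound for an almost invariant function with decaying Fourier coefficients. -/
lemma integral_sq_dev_le {c α : ℝ} (hc : 0 < c) (hα : BadlyApprox c α) {U : Circ → ℝ}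
    (hU : Continuous U) {D S G : ℝ} (hD : ∀ x, |U (x + ((2 * π * α : ℝ) : Circ)) - U x| ≤ D)
    (hS : ∀ x, |U x| ≤ S) {q R : ℕ} (hq : 1 ≤ q) (hqR : q ≤ R)
    (hG : ∀ k : ℤ, (q : ℤ) ≤ |k| → ‖fourierCoeff (fun x => (U x : ℂ)) k‖ ≤ G / |(k : ℝ)|) :
    ∫ x, (U x - ∫ y, U y ∂circMeas) ^ 2 ∂circMeas ≤ 2 * (D * R) ^ 2 +
      2 * ((q / (2 * c * R)) ^ 2 * S ^ 2 +
        G ^ 2 * (8 * (∑' j, cellWeight c j) * invSqSum / (q : ℝ) ^ 2)) := by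
  set ω : Circ := ((2 * π * α : ℝ) : Circ) with hω
  have hR : 1 ≤ R := hq.trans hqR
  have hR0 : (0 : ℝ) < R := by exact_mod_cast hR
  have hq0 : (0 : ℝ) < q := by exact_mod_cast hq
  have hqR' : (q : ℝ) ≤ R := by exact_mod_cast hqR
  set avg := ∫ y, U y ∂circMeas with havg
  set W : Circ → ℝ := fun x => (1 / (R : ℝ)) * ∑ j ∈ Finset.range R, U (x + j • ω) with hW
  have hWc : Continuous W := continuous_const.mul (continuous_finsetSum _ fun j _ =>
    hU.comp (continuous_add_const _))
  have hD0 : 0 ≤ D := (abs_nonneg _).trans (hD 0)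
  have hUW : ∀ x, |U x - W x| ≤ D * R := by
    intro x
    have h1 : ∀ j : ℕ, |U (x + j • ω) - U x| ≤ j * D := by
      intro j
      induction j with
      | zero => simp
      | succ j ih =>
        have h2 := hD (x + j • ω)
        rw [add_assoc, ← succ_nsmul] at h2
        calc _ ≤ |U (x + (j + 1) • ω) - U (x + j • ω)| + |U (x + j • ω) - U x| := abs_sub_le _ _ _
          _ ≤ _ := by push_cast; linarith
    have h2 : U x - W x = (1 / (R : ℝ)) * ∑ j ∈ Finset.range R, (U x - U (x + j • ω)) := by
      rw [Finset.sum_sub_distrib, mul_sub, hW]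
      simp only [Finset.sum_const, Finset.card_range, nsmul_eq_mul]
      field_simp
    rw [h2, abs_mul, abs_of_pos (by positivity)]
    have h3 : |∑ j ∈ Finset.range R, (U x - U (x + j • ω))| ≤ R * (R * D) := by
      refine (Finset.abs_sum_le_sum_abs _ _).trans ?_
      refine (Finset.sum_le_card_nsmul _ _ (R * D) fun j hj => ?_).trans (by simp)
      rw [abs_sub_comm]
      refine (h1 j).trans ?_
      have : (j : ℝ) ≤ R := by exact_mod_cast (Finset.mem_range.1 hj).le
      gcongr
    calc _ ≤ 1 / (R : ℝ) * (R * (R * D)) := by gcongr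
      _ = _ := by field_simp
  set Wc : Circ → ℂ := fun x => ((W x - avg : ℝ) : ℂ) with hWcdef
  have hWcc : Continuous Wc := Complex.continuous_ofReal.comp (hWc.sub continuous_const)
  have hUc : Continuous fun x => (U x : ℂ) := Complex.continuous_ofReal.comp hU
  have hpars := hasSum_sq_fourierCoeff_of_continuous hWcc
  have hparsU := hasSum_sq_fourierCoeff_of_continuous hUc
  have hWeq : (fun x => (W x : ℂ)) =
      fun x => (1 / (R : ℂ)) * ∑ j ∈ Finset.range R, ((U (x + j • ω) : ℝ) : ℂ) := by
    ext x; simp [hW]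
  have hconst : ∀ k : ℤ, k ≠ 0 → fourierCoeff (fun _ : Circ => (avg : ℂ)) k = 0 := by
    intro k hk
    have h1 := congrFun (fourierCoeff_fourier (T := circPeriod) 0) k
    have h2 : (fun _ : Circ => (avg : ℂ)) = fun x => (avg : ℂ) * (fourier 0 x : ℂ) := by
      ext x; simp
    rw [h2, fourierCoeff.const_mul]
    simp only [h1, Pi.single_apply, if_neg hk, mul_zero]
  have hInt : ∀ {f : Circ → ℂ}, Continuous f → Integrable f AddCircle.haarAddCircle := fun hf =>
    hf.integrable_of_hasCompactSupport (HasCompactSupport.of_compactSpace _)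
  have hcoef : ∀ k : ℤ, k ≠ 0 → fourierCoeff Wc k =
      birkhoffMult ω R k * fourierCoeff (fun x => (U x : ℂ)) k := by
    intro k hk
    have h1 : Wc + (fun _ => (avg : ℂ)) = fun x => (W x : ℂ) := by
      ext x; simp [hWcdef]
    have h2 := fourierCoeff.add (hInt hWcc) (hInt (continuous_const (y := (avg : ℂ))))
    rw [h1] at h2
    have h3 := congrFun h2 k
    rw [Pi.add_apply, hconst k hk, add_zero] at h3
    rw [← h3, hWeq, fourierCoeff_birkhoff hUc]
  have hcoef0 : fourierCoeff Wc 0 = 0 := by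
    have h1 : fourierCoeff Wc 0 = ∫ x, Wc x ∂circMeas := by
      simp [fourierCoeff]
    have h2 : ∫ x, W x ∂circMeas = avg := by
      have hcj : ∀ j : ℕ, Continuous fun x => U (x + j • ω) :=
        fun j => hU.comp (continuous_add_const _)
      rw [hW, integral_const_mul, integral_finsetSum _ fun j _ => continuous_integrable (hcj j)]
      simp only [integral_shift U, Finset.sum_const, Finset.card_range, nsmul_eq_mul]
      rw [← havg]; field_simp
    have h3 : ∫ x, Wc x ∂circMeas = ((∫ x, (W x - avg) ∂circMeas : ℝ) : ℂ) := integral_ofReal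
    rw [h1, h3, integral_sub (continuous_integrable hWc) (integrable_const _), h2]
    simp
  have hsqW : ∫ x, (W x - avg) ^ 2 ∂circMeas ≤ (q / (2 * c * R)) ^ 2 * S ^ 2 +
        G ^ 2 * (8 * (∑' j, cellWeight c j) * invSqSum / (q : ℝ) ^ 2) := by
    have h0 : ∫ x, ‖Wc x‖ ^ 2 ∂circMeas = ∫ x, (W x - avg) ^ 2 ∂circMeas := by
      refine integral_congr_ae (Eventually.of_forall fun x => ?_)
      simp only [hWcdef, Complex.norm_real, Real.norm_eq_abs, sq_abs]
    rw [← h0]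
    refine hasSum_le_of_sum_le hpars fun s => ?_
    rw [← Finset.sum_filter_add_sum_filter_not s (fun k => |k| < (q : ℤ))]
    refine add_le_add ?_ ?_
    · have h1 : ∀ k ∈ s.filter (fun k => |k| < (q : ℤ)), ‖fourierCoeff Wc k‖ ^ 2 ≤
          (q / (2 * c * R)) ^ 2 * ‖fourierCoeff (fun x => (U x : ℂ)) k‖ ^ 2 := by
        intro k hk
        rw [Finset.mem_filter] at hk
        by_cases hk0 : k = 0
        · rw [hk0, hcoef0]; simp; positivity
        rw [hcoef k hk0, norm_mul, mul_pow]
        refine mul_le_mul_of_nonneg_right (pow_le_pow_left₀ (norm_nonneg _) ?_ 2) (by positivity)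
        have h2 := (birkhoffMult_le (α := α) hR k).2
        have h3 := hα k hk0 (round (k * α))
        have hk1 : 0 < |(k : ℝ)| := abs_pos.2 (by exact_mod_cast hk0)
        have hk2 : |(k : ℝ)| ≤ q := by exact_mod_cast hk.2.le
        have h4 : ‖birkhoffMult ω R k‖ * (2 * R * (c / q)) ≤ 1 := by
          refine le_trans ?_ h2
          gcongr
          exact le_trans (by gcongr) h3
        rw [le_div_iff₀ (by positivity)]
        calc ‖birkhoffMult ω R k‖ * (2 * c * R) = ‖birkhoffMult ω R k‖ * (2 * R * (c / q)) * q := by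
              field_simp
          _ ≤ 1 * q := by gcongr
          _ = q := one_mul _
      refine (Finset.sum_le_sum h1).trans ?_
      rw [← Finset.mul_sum]
      refine mul_le_mul_of_nonneg_left ?_ (by positivity)
      refine (sum_le_hasSum _ (fun _ _ => by positivity) hparsU).trans ?_
      calc ∫ x, ‖(U x : ℂ)‖ ^ 2 ∂circMeas ≤ ∫ _, S ^ 2 ∂circMeas := by
            refine integral_mono (continuous_integrable (hUc.norm.pow 2)) (integrable_const _)
              fun x => ?_
            simp only [Complex.norm_real, Real.norm_eq_abs]
            exact pow_le_pow_left₀ (abs_nonneg _) (hS x) 2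
        _ = S ^ 2 := by simp
    · have h1 : ∀ k ∈ s.filter (fun k => ¬ |k| < (q : ℤ)), ‖fourierCoeff Wc k‖ ^ 2 ≤
          G ^ 2 * (‖birkhoffMult ω R k‖ / |(k : ℝ)|) ^ 2 := by
        intro k hk
        rw [Finset.mem_filter, not_lt] at hk
        have hk0 : k ≠ 0 := by
          rintro rfl
          have := hk.2
          simp at this; omega
        rw [hcoef k hk0, norm_mul, ← mul_pow]
        refine pow_le_pow_left₀ (by positivity) ?_ 2
        calc _ ≤ ‖birkhoffMult ω R k‖ * (G / |(k : ℝ)|) := by gcongr; exact hG k hk.2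
          _ = _ := by ring
      refine (Finset.sum_le_sum h1).trans ?_
      rw [← Finset.mul_sum]
      refine mul_le_mul_of_nonneg_left ?_ (by positivity)
      refine sum_sq_high_le hc hα hq _ (fun k hk => ?_) (fun k => ‖birkhoffMult ω R k‖)
        (fun k => norm_nonneg _) (fun k => (birkhoffMult_le hR k).1) fun k => ?_
      · rw [Finset.mem_filter, not_lt] at hk; exact hk.2
      · refine le_trans ?_ (birkhoffMult_le (α := α) hR k).2
        gcongr
  have hfin : ∀ x, (U x - avg) ^ 2 ≤ 2 * (D * R) ^ 2 + 2 * (W x - avg) ^ 2 := by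
    intro x
    have h1 := pow_le_pow_left₀ (abs_nonneg _) (hUW x) 2
    rw [sq_abs] at h1
    nlinarith [sq_nonneg ((U x - W x) - (W x - avg))]
  have hc1 : Continuous fun x => 2 * (W x - avg) ^ 2 :=
    continuous_const.mul ((hWc.sub continuous_const).pow 2)
  calc _ ≤ ∫ x, (2 * (D * R) ^ 2 + 2 * (W x - avg) ^ 2) ∂circMeas :=
        integral_mono (continuous_integrable ((hU.sub continuous_const).pow 2))
          (continuous_integrable (continuous_const.add hc1)) hfin
    _ = 2 * (D * R) ^ 2 + 2 * ∫ x, (W x - avg) ^ 2 ∂circMeas := by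
        rw [integral_add (integrable_const _) (continuous_integrable hc1)]
        simp only [integral_const, probReal_univ, one_smul, integral_const_mul]
    _ ≤ _ := by linarith

section Roots

open Polynomial

lemma mahlerMeasure_le_of_forall_norm_le {P : ℂ[X]} {B : ℝ} (hB : 0 < B)
    (h : ∀ z : ℂ, ‖z‖ = 1 → ‖P.eval z‖ ≤ B) : P.mahlerMeasure ≤ B := by
  by_cases hP : P = 0
  · simpa [hP] using hB.le
  have hB' : ((B⁻¹ : ℝ) : ℂ) ≠ 0 := by simpa using hB.ne'
  have hne : C ((B⁻¹ : ℝ) : ℂ) * P ≠ 0 := mul_ne_zero (by simpa using hB.ne') hP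
  have h1 : (C ((B⁻¹ : ℝ) : ℂ) * P).mahlerMeasure ≤ 1 := by
    rw [mahlerMeasure_def_of_ne_zero hne, Real.exp_le_one_iff]
    refine mul_nonpos_of_nonneg_of_nonpos (by positivity) ?_
    rw [intervalIntegral.integral_of_le (by positivity)]
    refine integral_nonpos fun x => ?_
    refine Real.log_nonpos (norm_nonneg _) ?_
    rw [eval_mul, eval_C, norm_mul, Complex.norm_real, Real.norm_of_nonneg (by positivity),
      inv_mul_le_one₀ hB]
    exact h _ (by simp)
  rw [mahlerMeasure_mul, mahlerMeasure_const, Complex.norm_real,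
    Real.norm_of_nonneg (by positivity), inv_mul_le_one₀ hB] at h1
  exact h1

lemma le_mahlerMeasure_of_forall_le_norm {P : ℂ[X]} {b : ℝ} (hb : 0 < b)
    (h : ∀ z : ℂ, ‖z‖ = 1 → b ≤ ‖P.eval z‖) : b ≤ P.mahlerMeasure := by
  have hP : P ≠ 0 := by
    rintro rfl
    have := h 1 (by simp)
    simp at this; linarith
  have hne : C ((b⁻¹ : ℝ) : ℂ) * P ≠ 0 := mul_ne_zero (by simpa using hb.ne') hP
  have h1 : 1 ≤ (C ((b⁻¹ : ℝ) : ℂ) * P).mahlerMeasure := by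
    rw [mahlerMeasure_def_of_ne_zero hne, Real.one_le_exp_iff]
    refine mul_nonneg (by positivity) ?_
    rw [intervalIntegral.integral_of_le (by positivity)]
    refine integral_nonneg fun x => ?_
    refine Real.log_nonneg ?_
    rw [eval_mul, eval_C, norm_mul, Complex.norm_real, Real.norm_of_nonneg (by positivity),
      one_le_inv_mul₀ hb]
    exact h _ (by simp)
  rw [mahlerMeasure_mul, mahlerMeasure_const, Complex.norm_real,
    Real.norm_of_nonneg (by positivity), one_le_inv_mul₀ hb] at h1
  exact h1

lemma mahlerMeasure_comp_C_mul_X {P : ℂ[X]} {r : ℝ} (hr : 0 < r) :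
    (P.comp (C (r : ℂ) * X)).mahlerMeasure =
      ‖P.leadingCoeff‖ * (P.roots.map fun a => max r ‖a‖).prod := by
  have h1 := (IsAlgClosed.splits P).eq_prod_roots
  conv_lhs => rw [h1]
  rw [mul_comp, C_comp, multiset_prod_comp, mahlerMeasure_mul, mahlerMeasure_const,
    prod_mahlerMeasure_eq_mahlerMeasure_prod, Multiset.map_map, Multiset.map_map]
  congr 2
  refine Multiset.map_congr rfl fun a _ => ?_
  have hr' : (r : ℂ) ≠ 0 := by exact_mod_cast hr.ne'
  have h2 : (X - C a).comp (C (r : ℂ) * X) = C (r : ℂ) * X + C (-a) := by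
    simp [sub_eq_add_neg]
  simp only [Function.comp_apply]
  rw [h2, mahlerMeasure_C_mul_X_add_C hr', Complex.norm_real, Real.norm_of_nonneg hr.le, norm_neg]

/-- The modulus of `a`, reflected into the closed unit disc. -/
def innerRadius (a : ℂ) : ℝ := min ‖a‖ ‖a‖⁻¹

lemma innerRadius_nonneg (a : ℂ) : 0 ≤ innerRadius a := le_min (norm_nonneg _) (by positivity)

lemma innerRadius_le_one (a : ℂ) : innerRadius a ≤ 1 := by
  rcases le_total ‖a‖ 1 with h | h
  · exact (min_le_left _ _).trans h
  · exact (min_le_right _ _).trans (inv_le_one_of_one_le₀ h)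

/-- Jensen-type bound: the number of roots close to the unit circle is controlled by the growth
of the polynomial on two nearby circles. -/
lemma card_roots_near_le {P : ℂ[X]} {ρ d M m : ℝ} (hρ : 0 < ρ)
    (h0 : ∀ z : ℂ, ‖z‖ = 1 → exp m ≤ ‖P.eval z‖)
    (h1 : ∀ z : ℂ, ‖z‖ = exp ρ → ‖P.eval z‖ ≤ exp (M + d))
    (h2 : ∀ z : ℂ, ‖z‖ = exp (-ρ) → ‖P.eval z‖ ≤ exp (M - d)) :
    ((P.roots.filter fun a => exp (-(ρ / 2)) ≤ innerRadius a).card : ℝ) ≤ 4 * (M - m) / ρ := by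
  have hcomp : ∀ t B : ℝ, (∀ z : ℂ, ‖z‖ = exp t → ‖P.eval z‖ ≤ exp B) →
      ‖P.leadingCoeff‖ * (P.roots.map fun a => max (exp t) ‖a‖).prod ≤ exp B := by
    intro t B h
    rw [← mahlerMeasure_comp_C_mul_X (exp_pos t)]
    refine mahlerMeasure_le_of_forall_norm_le (exp_pos _) fun z hz => ?_
    rw [eval_comp]
    refine h _ ?_
    simp [hz]
  have hP : P ≠ 0 := by
    rintro rfl
    have := h0 1 (by simp)
    simp at this; linarith [exp_pos m]
  have hl : 0 < ‖P.leadingCoeff‖ := by simpa using hP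
  have hlow : exp m ≤ ‖P.leadingCoeff‖ * (P.roots.map fun a => max 1 ‖a‖).prod := by
    have h3 := mahlerMeasure_comp_C_mul_X (P := P) one_pos
    rw [← h3]
    refine le_mahlerMeasure_of_forall_le_norm (exp_pos _) fun z hz => ?_
    simpa using h0 z hz
  have hu := hcomp ρ _ h1
  have hd := hcomp (-ρ) _ h2
  have hkey : ∀ s : Multiset ℂ, (s.map fun a => max 1 ‖a‖).prod ^ 2 *
      exp (ρ / 2 * (s.filter fun a => exp (-(ρ / 2)) ≤ innerRadius a).card) ≤
      (s.map fun a => max (exp ρ) ‖a‖).prod * (s.map fun a => max (exp (-ρ)) ‖a‖).prod := by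
    intro s
    induction s using Multiset.induction with
    | empty => simp
    | cons a s ih =>
      have hstep : (max 1 ‖a‖) ^ 2 ≤ max (exp ρ) ‖a‖ * max (exp (-ρ)) ‖a‖ := by
        rcases le_total 1 ‖a‖ with h | h
        · rw [max_eq_right h, sq]
          exact mul_le_mul (le_max_right _ _) (le_max_right _ _) (by positivity) (by positivity)
        · rw [max_eq_left h, one_pow]
          calc (1 : ℝ) = exp ρ * exp (-ρ) := by rw [← exp_add]; simp
            _ ≤ _ := mul_le_mul (le_max_left _ _) (le_max_left _ _) (by positivity) (by positivity)
      have hstep2 : exp (-(ρ / 2)) ≤ innerRadius a →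
          (max 1 ‖a‖) ^ 2 * exp (ρ / 2) ≤ max (exp ρ) ‖a‖ * max (exp (-ρ)) ‖a‖ := by
        intro h
        have ha1 : exp (-(ρ / 2)) ≤ ‖a‖ := h.trans (min_le_left _ _)
        have ha0 : 0 < ‖a‖ := (exp_pos _).trans_le ha1
        have ha2 : ‖a‖ ≤ exp (ρ / 2) := by
          have := h.trans (min_le_right _ _)
          rw [exp_neg] at this
          exact (inv_le_inv₀ (exp_pos _) ha0).1 this
        have e1 : exp (ρ / 2) * exp (ρ / 2) = exp ρ := by rw [← exp_add]; ring_nf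
        have e2 : exp ρ * exp (-(ρ / 2)) = exp (ρ / 2) := by rw [← exp_add]; ring_nf
        refine le_trans ?_ (mul_le_mul (le_max_left (exp ρ) ‖a‖) (le_max_right (exp (-ρ)) ‖a‖)
          ha0.le (by positivity))
        rcases le_total 1 ‖a‖ with h' | h'
        · rw [max_eq_right h', ← e1]
          nlinarith [mul_le_mul_of_nonneg_left ha2 (mul_nonneg ha0.le (exp_pos (ρ / 2)).le)]
        · rw [max_eq_left h', one_pow, one_mul, ← e2]
          gcongr
      simp only [Multiset.map_cons, Multiset.prod_cons, Multiset.filter_cons]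
      have hpos : 0 ≤ (s.map fun a => max 1 ‖a‖).prod ^ 2 *
        exp (ρ / 2 * (s.filter fun a => exp (-(ρ / 2)) ≤ innerRadius a).card) := by positivity
      split_ifs with h
      · rw [Multiset.singleton_add, Multiset.card_cons]
        push_cast
        calc _ = ((max 1 ‖a‖) ^ 2 * exp (ρ / 2)) * ((s.map fun a => max 1 ‖a‖).prod ^ 2 *
              exp (ρ / 2 * (s.filter fun a => exp (-(ρ / 2)) ≤ innerRadius a).card)) := by
              rw [mul_add, mul_one, exp_add]; ring
          _ ≤ (max (exp ρ) ‖a‖ * max (exp (-ρ)) ‖a‖) * _ :=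
              mul_le_mul (hstep2 h) ih hpos (by positivity)
          _ = _ := by ring
      · rw [zero_add]
        calc _ = (max 1 ‖a‖) ^ 2 * ((s.map fun a => max 1 ‖a‖).prod ^ 2 *
              exp (ρ / 2 * (s.filter fun a => exp (-(ρ / 2)) ≤ innerRadius a).card)) := by ring
          _ ≤ (max (exp ρ) ‖a‖ * max (exp (-ρ)) ‖a‖) * _ :=
              mul_le_mul hstep ih hpos (by positivity)
          _ = _ := by ring
  set c : ℝ := ((P.roots.filter fun a => exp (-(ρ / 2)) ≤ innerRadius a).card : ℝ)
  have hpp : ∀ t : ℝ, 0 ≤ (P.roots.map fun a => max (exp t) ‖a‖).prod := fun t =>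
    Multiset.prod_nonneg fun x hx => by
      obtain ⟨a, _, rfl⟩ := Multiset.mem_map.1 hx
      positivity
  have hfin : exp (2 * m + ρ / 2 * c) ≤ exp (2 * M) := by
    calc exp (2 * m + ρ / 2 * c) = exp m ^ 2 * exp (ρ / 2 * c) := by
          rw [exp_add, ← exp_nat_mul]; norm_num
      _ ≤ (‖P.leadingCoeff‖ * (P.roots.map fun a => max 1 ‖a‖).prod) ^ 2 * exp (ρ / 2 * c) := by
          gcongr
      _ = ‖P.leadingCoeff‖ ^ 2 *
          ((P.roots.map fun a => max 1 ‖a‖).prod ^ 2 * exp (ρ / 2 * c)) := by ring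
      _ ≤ ‖P.leadingCoeff‖ ^ 2 * ((P.roots.map fun a => max (exp ρ) ‖a‖).prod *
          (P.roots.map fun a => max (exp (-ρ)) ‖a‖).prod) := by
          exact mul_le_mul_of_nonneg_left (hkey _) (by positivity)
      _ = (‖P.leadingCoeff‖ * (P.roots.map fun a => max (exp ρ) ‖a‖).prod) *
          (‖P.leadingCoeff‖ * (P.roots.map fun a => max (exp (-ρ)) ‖a‖).prod) := by ring
      _ ≤ exp (M + d) * exp (M - d) :=
          mul_le_mul hu hd (mul_nonneg hl.le (hpp _)) (exp_pos _).le
      _ = exp (2 * M) := by rw [← exp_add]; ring_nf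
  rw [exp_le_exp] at hfin
  rw [le_div_iff₀ hρ]
  linarith

lemma norm_fourier_arg (n : ℤ) (x : Circ) : ‖(fourier n x : ℂ)‖ = 1 := by
  rw [fourier_apply]; exact Circle.norm_coe _

lemma fourierCoeff_const_eq_zero (a : ℂ) {k : ℤ} (hk : k ≠ 0) :
    fourierCoeff (fun _ : Circ => a) k = 0 := by
  have h1 := congrFun (fourierCoeff_fourier (T := circPeriod) 0) k
  have h2 : (fun _ : Circ => a) = fun x => a * (fourier 0 x : ℂ) := by
    ext x; simp
  rw [h2, fourierCoeff.const_mul]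
  simp only [h1, Pi.single_apply, if_neg hk, mul_zero]

lemma norm_fourierCoeff_conj (f : Circ → ℂ) (k : ℤ) :
    ‖fourierCoeff (fun x => (starRingEnd ℂ) (f x)) k‖ = ‖fourierCoeff f (-k)‖ := by
  have h1 : fourierCoeff (fun x => (starRingEnd ℂ) (f x)) k =
      (starRingEnd ℂ) (fourierCoeff f (-k)) := by
    rw [fourierCoeff, fourierCoeff, ← integral_conj]
    refine integral_congr_ae (Eventually.of_forall fun x => ?_)
    simp only [smul_eq_mul, map_mul, ← fourier_neg, neg_neg]
  rw [h1, RCLike.norm_conj]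

lemma continuous_integrable_complex {f : Circ → ℂ} (hf : Continuous f) :
    Integrable f AddCircle.haarAddCircle :=
  hf.integrable_of_hasCompactSupport (HasCompactSupport.of_compactSpace _)

lemma one_sub_mem_slitPlane_of_norm_lt {w : ℂ} (hw : ‖w‖ < 1) : 1 - w ∈ Complex.slitPlane := by
  rw [sub_eq_add_neg]
  exact Complex.mem_slitPlane_of_norm_lt_one (by simpa using hw)

lemma continuous_log_one_sub {w : ℂ} (hw : ‖w‖ < 1) :
    Continuous fun x : Circ => Complex.log (1 - w * fourier (-1) x) := by
  refine Continuous.clog (by fun_prop) fun x => one_sub_mem_slitPlane_of_norm_lt ?_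
  rwa [norm_mul, norm_fourier_arg, mul_one]

lemma fourier_natCast_mul (n : ℕ) (m : ℤ) (x : Circ) :
    (fourier (n * m) x : ℂ) = (fourier m x : ℂ) ^ n := by
  induction n with
  | zero => simp
  | succ n ih => rw [Nat.cast_succ, add_mul, one_mul, fourier_add, ih, pow_succ]

lemma norm_fourierCoeff_log_one_sub {w : ℂ} (hw : ‖w‖ < 1) {k : ℤ} (hk : k ≠ 0) :
    ‖fourierCoeff (fun x : Circ => Complex.log (1 - w * fourier (-1) x)) k‖ ≤
      ‖w‖ ^ k.natAbs / |(k : ℝ)| := by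
  set F : ℕ → Circ → ℂ := fun n x => (w ^ n / n) * fourier (-(n : ℤ)) x with hF
  have hFc : ∀ n, Continuous (F n) := fun n => by simp only [hF]; fun_prop
  have hFn : ∀ n x, ‖F n x‖ ≤ ‖w‖ ^ n := by
    intro n x
    simp only [hF, norm_mul, norm_fourier_arg, mul_one, norm_div, norm_pow]
    rcases Nat.eq_zero_or_pos n with rfl | hn
    · simp
    · refine div_le_self (by positivity) ?_
      simp only [Complex.norm_natCast]
      exact_mod_cast hn
  have hsum : ∀ x, HasSum (fun n => F n x) (-Complex.log (1 - w * fourier (-1) x)) := by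
    intro x
    have h1 : ‖w * fourier (-1) x‖ < 1 := by rwa [norm_mul, norm_fourier_arg, mul_one]
    convert Complex.hasSum_taylorSeries_neg_log h1 using 2 with n
    simp only [hF]
    rw [mul_pow, ← fourier_natCast_mul, mul_neg_one]
    ring
  have hInt := hasSum_integral_of_summable_integral_norm (μ := circMeas)
    (F := fun n x => fourier (-k) x • F n x)
    (fun n => continuous_integrable_complex (by simp only [smul_eq_mul]; fun_prop)) (by
      refine Summable.of_nonneg_of_le (fun n => integral_nonneg fun x => norm_nonneg _) (fun n => ?_)
        (summable_geometric_of_lt_one (norm_nonneg w) hw)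
      calc ∫ x, ‖(fourier (-k) x : ℂ) • F n x‖ ∂circMeas ≤ ∫ _, ‖w‖ ^ n ∂circMeas := by
            refine integral_mono (continuous_integrable (by fun_prop)) (integrable_const _)
              fun x => ?_
            simp only [norm_smul, norm_fourier_arg, one_mul]
            exact hFn n x
        _ = _ := by simp)
  have hcoef : ∀ n : ℕ, ∫ x, (fourier (-k) x : ℂ) • F n x ∂circMeas =
      if n = k.natAbs then (if k < 0 then w ^ n / n else 0) else 0 := by
    intro n
    have h1 : ∫ x, (fourier (-k) x : ℂ) • F n x ∂circMeas = fourierCoeff (F n) k := rfl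
    have h2 := congrFun (fourierCoeff_fourier (T := circPeriod) (-(n : ℤ))) k
    rw [h1, hF, fourierCoeff.const_mul, h2, Pi.single_apply]
    split_ifs with h3 h4 h5 h4 h5
    · simp
    · omega
    · omega
    · omega
    · simp
    · simp
  have hval : fourierCoeff (fun x : Circ => Complex.log (1 - w * fourier (-1) x)) k =
      -(if k < 0 then w ^ k.natAbs / (k.natAbs : ℂ) else 0) := by
    have h2 : (∫ x, ∑' n, (fourier (-k) x : ℂ) • F n x ∂circMeas) =
        -fourierCoeff (fun x : Circ => Complex.log (1 - w * fourier (-1) x)) k := by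
      rw [fourierCoeff, ← integral_neg]
      refine integral_congr_ae (Eventually.of_forall fun x => ?_)
      have h3 := ((hsum x).const_smul (fourier (-k) x : ℂ)).tsum_eq
      simp only [smul_eq_mul, mul_neg] at h3 ⊢
      exact h3
    have h4 : HasSum (fun n : ℕ => ∫ x, (fourier (-k) x : ℂ) • F n x ∂circMeas)
        (if k < 0 then w ^ k.natAbs / (k.natAbs : ℂ) else 0) := by
      have h5 := hasSum_single (f := fun n : ℕ => ∫ x, (fourier (-k) x : ℂ) • F n x ∂circMeas)
        k.natAbs (fun n hn => by simp only [hcoef n, if_neg hn])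
      simp only [hcoef k.natAbs, if_true] at h5
      exact h5
    rw [← neg_eq_iff_eq_neg, ← h2]
    exact hInt.unique h4
  rw [hval, norm_neg]
  split_ifs
  · rw [norm_div, norm_pow, Complex.norm_natCast, Nat.cast_natAbs, Int.cast_abs]
  · simp; positivity

lemma exists_log_norm_sub_eq {a : ℂ} (ha : ‖a‖ ≠ 1) : ∃ (c : ℝ) (w : ℂ), ‖w‖ < 1 ∧
    ‖w‖ = innerRadius a ∧ ∀ x : Circ, Real.log ‖(fourier 1 x : ℂ) - a‖ =
      c + (Complex.log (1 - w * fourier (-1) x)).re := by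
  have hmul : ∀ x : Circ, (fourier 1 x : ℂ) * fourier (-1) x = 1 := fun x => by
    rw [← fourier_add]; simp
  rcases lt_or_gt_of_ne ha with h | h
  · refine ⟨0, a, h, ?_, fun x => ?_⟩
    · rw [innerRadius, eq_comm, min_eq_left_iff]
      rcases (norm_nonneg a).eq_or_lt with h0 | h0
      · rw [← h0]; simp
      · exact h.le.trans (one_le_inv₀ h0 |>.2 h.le)
    · rw [Complex.log_re, zero_add]
      congr 1
      calc _ = ‖(fourier 1 x : ℂ) * (1 - a * fourier (-1) x)‖ := by
            congr 1
            linear_combination a * hmul x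
        _ = _ := by rw [norm_mul, norm_fourier_arg, one_mul]
  · have h0 : 0 < ‖a‖ := one_pos.trans h
    have ha0 : a ≠ 0 := norm_pos_iff.1 h0
    refine ⟨Real.log ‖a‖, (starRingEnd ℂ) a⁻¹, ?_, ?_, fun x => ?_⟩
    · rw [RCLike.norm_conj, norm_inv]; exact inv_lt_one_of_one_lt₀ h
    · rw [RCLike.norm_conj, norm_inv, innerRadius, eq_comm, min_eq_right_iff]
      exact (inv_lt_one_of_one_lt₀ h).le.trans h.le
    · have h1 : 1 - (starRingEnd ℂ) a⁻¹ * (fourier (-1) x : ℂ) =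
          (starRingEnd ℂ) (1 - a⁻¹ * fourier 1 x) := by
        rw [fourier_neg]; simp
      have h2 : (1 - a⁻¹ * fourier 1 x : ℂ) ≠ 0 := by
        refine Complex.slitPlane_ne_zero (one_sub_mem_slitPlane_of_norm_lt ?_)
        rw [norm_mul, norm_fourier_arg, mul_one, norm_inv]
        exact inv_lt_one_of_one_lt₀ h
      rw [Complex.log_re, h1, RCLike.norm_conj, ← Real.log_mul h0.ne' (by simpa using h2),
        ← norm_mul, mul_sub, mul_inv_cancel_left₀ ha0, mul_one, norm_sub_rev]

lemma continuous_log_norm_sub {a : ℂ} (ha : ‖a‖ ≠ 1) :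
    Continuous fun x : Circ => Real.log ‖(fourier 1 x : ℂ) - a‖ := by
  refine Continuous.log (by fun_prop) fun x => ?_
  rw [norm_ne_zero_iff, sub_ne_zero]
  rintro rfl
  exact ha (norm_fourier_arg 1 x)

lemma norm_fourierCoeff_log_norm_sub {a : ℂ} (ha : ‖a‖ ≠ 1) {k : ℤ} (hk : k ≠ 0) :
    ‖fourierCoeff (fun x : Circ => ((Real.log ‖(fourier 1 x : ℂ) - a‖ : ℝ) : ℂ)) k‖ ≤
      innerRadius a ^ k.natAbs / |(k : ℝ)| := by
  obtain ⟨c, w, hw, hwr, h⟩ := exists_log_norm_sub_eq ha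
  set f : Circ → ℂ := fun x => Complex.log (1 - w * fourier (-1) x) with hf
  have hfc : Continuous f := continuous_log_one_sub hw
  have hfc' : Continuous fun x => (starRingEnd ℂ) (f x) := Complex.continuous_conj.comp hfc
  have h1 : (fun x : Circ => ((Real.log ‖(fourier 1 x : ℂ) - a‖ : ℝ) : ℂ)) =
      (fun _ => (c : ℂ)) + fun x => (1 / 2 : ℂ) * (f + fun x => (starRingEnd ℂ) (f x)) x := by
    ext x
    simp only [Pi.add_apply, h x, Complex.add_conj]
    push_cast; ring
  have h2 := congrFun (fourierCoeff.add (T := circPeriod)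
    (continuous_integrable_complex (continuous_const (y := (c : ℂ))))
    (continuous_integrable_complex ((hfc.add hfc').const_mul (1 / 2 : ℂ)))) k
  have h3 := congrFun (fourierCoeff.add (continuous_integrable_complex hfc)
    (continuous_integrable_complex hfc')) k
  rw [h1]
  refine (congrArg norm h2).le.trans ?_
  rw [Pi.add_apply, fourierCoeff_const_eq_zero _ hk, zero_add]
  have h4 := fourierCoeff.const_mul (T := circPeriod) (f + fun x => (starRingEnd ℂ) (f x))
    (1 / 2 : ℂ) k
  refine (congrArg norm h4).le.trans ?_
  rw [h3, Pi.add_apply, norm_mul]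
  have h5 := norm_fourierCoeff_log_one_sub hw hk
  have h6 := norm_fourierCoeff_log_one_sub hw (neg_ne_zero.2 hk)
  rw [Int.natAbs_neg, Int.cast_neg, abs_neg] at h6
  have h7 := norm_add_le (fourierCoeff f k) (fourierCoeff (fun x => (starRingEnd ℂ) (f x)) k)
  rw [norm_fourierCoeff_conj] at h7
  rw [← hwr]
  norm_num
  linarith

lemma fourierCoeff_sum_log_norm_sub {k : ℤ} (hk : k ≠ 0) (s : Multiset ℂ)
    (hs : ∀ a ∈ s, ‖a‖ ≠ 1) :
    (Continuous fun x : Circ => (s.map fun a => Real.log ‖(fourier 1 x : ℂ) - a‖).sum) ∧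
    ‖fourierCoeff (fun x : Circ =>
      (((s.map fun a => Real.log ‖(fourier 1 x : ℂ) - a‖).sum : ℝ) : ℂ)) k‖ ≤
      (s.map fun a => innerRadius a ^ k.natAbs).sum / |(k : ℝ)| := by
  induction s using Multiset.induction with
  | empty =>
    refine ⟨by simp [continuous_const], ?_⟩
    simpa using (fourierCoeff_const_eq_zero 0 hk)
  | cons a s ih =>
    obtain ⟨ih1, ih2⟩ := ih fun b hb => hs b (Multiset.mem_cons_of_mem hb)
    have ha := hs a (Multiset.mem_cons_self a s)
    have hac := continuous_log_norm_sub ha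
    refine ⟨by simp only [Multiset.map_cons, Multiset.sum_cons]; exact hac.add ih1, ?_⟩
    have h1 := congrFun (fourierCoeff.add
      (continuous_integrable_complex (Complex.continuous_ofReal.comp hac))
      (continuous_integrable_complex (Complex.continuous_ofReal.comp ih1))) k
    have h2 : (fun x : Circ =>
        ((((a ::ₘ s).map fun a => Real.log ‖(fourier 1 x : ℂ) - a‖).sum : ℝ) : ℂ)) =
        (Complex.ofReal ∘ fun x : Circ => Real.log ‖(fourier 1 x : ℂ) - a‖) +
        (Complex.ofReal ∘ fun x : Circ =>
          (s.map fun a => Real.log ‖(fourier 1 x : ℂ) - a‖).sum) := by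
      ext x; simp
    rw [h2, h1, Pi.add_apply]
    refine (norm_add_le _ _).trans ?_
    rw [Multiset.map_cons, Multiset.sum_cons, add_div]
    exact add_le_add (norm_fourierCoeff_log_norm_sub ha hk) ih2

/-- Fourier decay of `log |P|` on the unit circle for a polynomial `P` without zeros there. -/
lemma fourierCoeff_log_norm_eval_le {P : ℂ[X]} {ρ d M m : ℝ} (hρ : 0 < ρ)
    (h0 : ∀ z : ℂ, ‖z‖ = 1 → exp m ≤ ‖P.eval z‖)
    (h1 : ∀ z : ℂ, ‖z‖ = exp ρ → ‖P.eval z‖ ≤ exp (M + d))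
    (h2 : ∀ z : ℂ, ‖z‖ = exp (-ρ) → ‖P.eval z‖ ≤ exp (M - d)) {k : ℤ} (hk : k ≠ 0) :
    ‖fourierCoeff (fun x : Circ => ((Real.log ‖P.eval (fourier 1 x : ℂ)‖ : ℝ) : ℂ)) k‖ ≤
      (4 * (M - m) / ρ + P.natDegree * exp (-(ρ / 2) * |(k : ℝ)|)) / |(k : ℝ)| := by
  have hP : P ≠ 0 := by
    rintro rfl
    have := h0 1 (by simp)
    simp at this; linarith [exp_pos m]
  have hroot : ∀ a ∈ P.roots, ‖a‖ ≠ 1 := by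
    intro a ha ha1
    have h3 := h0 a ha1
    rw [(mem_roots hP).1 ha, norm_zero] at h3
    linarith [exp_pos m]
  have hl : P.leadingCoeff ≠ 0 := by simpa using hP
  obtain ⟨hc, hb⟩ := fourierCoeff_sum_log_norm_sub hk P.roots hroot
  have heq : (fun x : Circ => ((Real.log ‖P.eval (fourier 1 x : ℂ)‖ : ℝ) : ℂ)) =
      (fun _ => ((Real.log ‖P.leadingCoeff‖ : ℝ) : ℂ)) + fun x =>
        (((P.roots.map fun a => Real.log ‖(fourier 1 x : ℂ) - a‖).sum : ℝ) : ℂ) := by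
    ext x
    rw [Pi.add_apply, ← Complex.ofReal_add]
    congr 1
    have h3 : P.eval (fourier 1 x : ℂ) =
        P.leadingCoeff * (P.roots.map fun a => (fourier 1 x : ℂ) - a).prod := by
      conv_lhs => rw [(IsAlgClosed.splits P).eq_prod_roots]
      rw [eval_mul, eval_C, eval_multiset_prod, Multiset.map_map]
      simp
    have h4 : ∀ s : Multiset ℂ, (∀ a ∈ s, ‖a‖ ≠ 1) →
        (s.map fun a => (fourier 1 x : ℂ) - a).prod ≠ 0 ∧
        Real.log ‖(s.map fun a => (fourier 1 x : ℂ) - a).prod‖ =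
        (s.map fun a => Real.log ‖(fourier 1 x : ℂ) - a‖).sum := by
      intro s
      induction s using Multiset.induction with
      | empty => simp
      | cons a s ih =>
        intro hs
        obtain ⟨i1, i2⟩ := ih fun b hb => hs b (Multiset.mem_cons_of_mem hb)
        have i3 : (fourier 1 x : ℂ) - a ≠ 0 := by
          rw [sub_ne_zero]
          rintro rfl
          exact hs _ (Multiset.mem_cons_self _ s) (norm_fourier_arg 1 x)
        simp only [Multiset.map_cons, Multiset.prod_cons, Multiset.sum_cons]
        refine ⟨mul_ne_zero i3 i1, ?_⟩
        rw [norm_mul, Real.log_mul (by simpa using i3) (by simpa using i1), i2]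
    obtain ⟨i1, i2⟩ := h4 _ hroot
    rw [h3, norm_mul, Real.log_mul (by simpa using hl) (by simpa using i1), i2]
  have hadd := congrFun (fourierCoeff.add (T := circPeriod)
    (continuous_integrable_complex (continuous_const (y := ((Real.log ‖P.leadingCoeff‖ : ℝ) : ℂ))))
    (continuous_integrable_complex (Complex.continuous_ofReal.comp hc))) k
  rw [heq]
  refine (congrArg norm hadd).le.trans ?_
  rw [Pi.add_apply, fourierCoeff_const_eq_zero _ hk, zero_add]
  refine hb.trans ?_
  gcongr
  have hcard := card_roots_near_le hρ h0 h1 h2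
  have hsplit : ∀ s : Multiset ℂ, (s.map fun a => innerRadius a ^ k.natAbs).sum ≤
      (s.filter fun a => exp (-(ρ / 2)) ≤ innerRadius a).card +
        s.card * exp (-(ρ / 2) * |(k : ℝ)|) := by
    intro s
    induction s using Multiset.induction with
    | empty => simp
    | cons a s ih =>
      simp only [Multiset.map_cons, Multiset.sum_cons, Multiset.filter_cons, Multiset.card_cons]
      have hE := exp_pos (-(ρ / 2) * |(k : ℝ)|)
      split_ifs with h
      · rw [Multiset.singleton_add, Multiset.card_cons]
        have := pow_le_one₀ (n := k.natAbs) (innerRadius_nonneg a) (innerRadius_le_one a)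
        push_cast
        linarith
      · rw [zero_add]
        have h5 : innerRadius a ^ k.natAbs ≤ exp (-(ρ / 2) * |(k : ℝ)|) := by
          refine (pow_le_pow_left₀ (innerRadius_nonneg a) (not_le.1 h).le _).trans_eq ?_
          rw [← exp_nat_mul, Nat.cast_natAbs, Int.cast_abs, mul_comm]
        push_cast
        linarith
  refine (hsplit _).trans ?_
  gcongr
  exact card_roots' P

end Roots

/-- The transfer matrix with diagonal entry `w`. -/
def transfer (w : ℂ) : Mat2 := !![w, -1; 1, 0]

lemma transfer_det (w : ℂ) : (transfer w).det = 1 := by simp [transfer, Matrix.det_fin_two]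

lemma transfer_sub_norm (w z : ℂ) : ‖transfer w - transfer z‖ = ‖w - z‖ := by
  rw [← sq_eq_sq₀ (norm_nonneg _) (norm_nonneg _), Mat2.norm_sq]
  simp [transfer]

lemma transfer_norm_le (w : ℂ) : ‖transfer w‖ ≤ ‖w‖ + 2 := by
  refine abs_le_of_sq_le_sq' ?_ (by positivity) |>.2
  rw [Mat2.norm_sq]
  simp [transfer]
  nlinarith [norm_nonneg w]

lemma transfer_continuous : Continuous transfer := by
  refine continuous_matrix fun i j => ?_
  fin_cases i <;> fin_cases j <;> simp [transfer] <;> fun_prop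

/-- The Schrödinger cocycle over the circle, with possibly complex potential. -/
def schro (E : ℝ) (v : Circ → ℂ) (x : Circ) : Mat2 := transfer (E - v x)

lemma schro_det (E : ℝ) (v : Circ → ℂ) (x : Circ) : (schro E v x).det = 1 := transfer_det _

lemma schro_continuous (E : ℝ) {v : Circ → ℂ} (hv : Continuous v) : Continuous (schro E v) :=
  transfer_continuous.comp (by fun_prop)

lemma schro_norm_le {E Λ C : ℝ} {v : Circ → ℂ} (hΛ : |E| + C + 2 ≤ exp Λ) {x : Circ}
    (hv : ‖v x‖ ≤ C) : ‖schro E v x‖ ≤ exp Λ := by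
  refine (transfer_norm_le _).trans (le_trans ?_ hΛ)
  have := norm_sub_le (E : ℂ) (v x)
  rw [Complex.norm_real, Real.norm_eq_abs] at this
  linarith

lemma norm_one_mat2_le : ‖(1 : Mat2)‖ ≤ 2 := by
  refine abs_le_of_sq_le_sq' ?_ (by positivity) |>.2
  rw [Mat2.norm_sq]
  norm_num

lemma cyc_norm_le {ω : Circ} {A : Circ → Mat2} {Λ : ℝ} (hA : ∀ x, ‖A x‖ ≤ exp Λ) (n : ℕ)
    (x : Circ) : ‖cyc ω A n x‖ ≤ 2 * exp (Λ * n) := by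
  induction n with
  | zero => simpa [cyc] using norm_one_mat2_le
  | succ n ih =>
    rw [cyc]
    refine (norm_mul_le _ _).trans ?_
    calc _ ≤ exp Λ * (2 * exp (Λ * n)) := by gcongr; exact hA _
      _ = _ := by push_cast; rw [mul_add, mul_one, exp_add]; ring

lemma cyc_sub_norm_le {ω : Circ} {A B : Circ → Mat2} {Λ ε : ℝ} (hA : ∀ x, ‖A x‖ ≤ exp Λ)
    (hΛ : 0 ≤ Λ) (hB : ∀ x, ‖B x‖ ≤ exp Λ) (hAB : ∀ x, ‖B x - A x‖ ≤ ε) (n : ℕ) (x : Circ) :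
    ‖cyc ω B n x - cyc ω A n x‖ ≤ 2 * n * ε * exp (Λ * n) := by
  have hε : 0 ≤ ε := (norm_nonneg _).trans (hAB x)
  induction n with
  | zero => simp [cyc]
  | succ n ih =>
    rw [cyc, cyc]
    have h1 : B (x + n • ω) * cyc ω B n x - A (x + n • ω) * cyc ω A n x =
        (B (x + n • ω) - A (x + n • ω)) * cyc ω B n x +
          A (x + n • ω) * (cyc ω B n x - cyc ω A n x) := by
      rw [Matrix.sub_mul, Matrix.mul_sub]; abel
    rw [h1]
    have h2 : exp (Λ * (n + 1 : ℕ)) = exp Λ * exp (Λ * n) := by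
      push_cast; rw [mul_add, mul_one, exp_add]; ring
    have h3 : 1 ≤ exp Λ := one_le_exp hΛ
    calc _ ≤ ‖B (x + n • ω) - A (x + n • ω)‖ * ‖cyc ω B n x‖ +
          ‖A (x + n • ω)‖ * ‖cyc ω B n x - cyc ω A n x‖ :=
        (norm_add_le _ _).trans (add_le_add (norm_mul_le _ _) (norm_mul_le _ _))
      _ ≤ ε * (2 * exp (Λ * n)) + exp Λ * (2 * n * ε * exp (Λ * n)) := by
        gcongr
        · exact hAB _
        · exact cyc_norm_le hB n x
        · exact hA _
      _ ≤ ε * (2 * (exp Λ * exp (Λ * n))) + exp Λ * (2 * n * ε * exp (Λ * n)) := by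
        have : exp (Λ * n) ≤ exp Λ * exp (Λ * n) := le_mul_of_one_le_left (exp_pos _).le h3
        gcongr
      _ = _ := by rw [h2]; push_cast; ring

/-- The sum of the squared entries. -/
def sqSum (A : Mat2) : ℂ := A 0 0 ^ 2 + A 0 1 ^ 2 + A 1 0 ^ 2 + A 1 1 ^ 2

lemma norm_sqSum_le (A : Mat2) : ‖sqSum A‖ ≤ ‖A‖ ^ 2 := by
  rw [Mat2.norm_sq, sqSum]
  refine (norm_add_le _ _).trans ?_
  refine (add_le_add_left (norm_add_le _ _) _).trans ?_
  refine (add_le_add_left (add_le_add_left (norm_add_le _ _) _) _).trans ?_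
  simp only [norm_pow]; exact le_rfl

lemma norm_sqSum_sub_le (A B : Mat2) :
    ‖sqSum B - sqSum A‖ ≤ ‖B - A‖ * (‖B - A‖ + 2 * ‖A‖) := by
  have h2 : ‖(B - A) 0 0 * A 0 0 + (B - A) 0 1 * A 0 1 + (B - A) 1 0 * A 1 0 +
      (B - A) 1 1 * A 1 1‖ ≤ ‖B - A‖ * ‖A‖ := by
    refine (norm_add_le _ _).trans ?_
    refine (add_le_add_left (norm_add_le _ _) _).trans ?_
    refine (add_le_add_left (add_le_add_left (norm_add_le _ _) _) _).trans ?_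
    simp only [norm_mul]
    refine abs_le_of_sq_le_sq' ?_ (by positivity) |>.2
    rw [mul_pow, Mat2.norm_sq, Mat2.norm_sq]
    generalize ‖(B - A) 0 0‖ = a
    generalize ‖(B - A) 0 1‖ = b
    generalize ‖(B - A) 1 0‖ = c
    generalize ‖(B - A) 1 1‖ = d
    nlinarith [sq_nonneg (a * ‖A 0 1‖ - b * ‖A 0 0‖), sq_nonneg (a * ‖A 1 0‖ - c * ‖A 0 0‖),
      sq_nonneg (a * ‖A 1 1‖ - d * ‖A 0 0‖), sq_nonneg (b * ‖A 1 0‖ - c * ‖A 0 1‖),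
      sq_nonneg (b * ‖A 1 1‖ - d * ‖A 0 1‖), sq_nonneg (c * ‖A 1 1‖ - d * ‖A 1 0‖)]
  have h1 : sqSum B - sqSum A = sqSum (B - A) + 2 * ((B - A) 0 0 * A 0 0 + (B - A) 0 1 * A 0 1 +
      (B - A) 1 0 * A 1 0 + (B - A) 1 1 * A 1 1) := by
    simp only [sqSum, Matrix.sub_apply]; ring
  rw [h1]
  refine (norm_add_le _ _).trans ?_
  rw [norm_mul, Complex.norm_two]
  nlinarith [norm_sqSum_le (B - A)]

/-- A matrix all of whose entries are real. -/
def RealEntries (A : Mat2) : Prop := ∀ i j, (A i j).im = 0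

lemma RealEntries.mul {A B : Mat2} (hA : RealEntries A) (hB : RealEntries B) :
    RealEntries (A * B) := fun i j => by
  simp [Matrix.mul_apply, Fin.sum_univ_two, Complex.mul_im, hA i, hB _ j]

lemma cyc_realEntries {ω : Circ} {A : Circ → Mat2} (hA : ∀ x, RealEntries (A x)) (n : ℕ)
    (x : Circ) : RealEntries (cyc ω A n x) := by
  induction n with
  | zero => intro i j; fin_cases i <;> fin_cases j <;> simp [cyc]
  | succ n ih => exact (hA _).mul ih

lemma schro_realEntries (E : ℝ) (v : Circ → ℝ) (x : Circ) :
    RealEntries (schro E (fun x => v x) x) := fun i j => by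
  fin_cases i <;> fin_cases j <;> simp [schro, transfer]

lemma RealEntries.sqSum_eq {A : Mat2} (hA : RealEntries A) : sqSum A = ((‖A‖ ^ 2 : ℝ) : ℂ) := by
  have h : ∀ i j, A i j ^ 2 = ((‖A i j‖ ^ 2 : ℝ) : ℂ) := fun i j => by
    have h1 : A i j = ((A i j).re : ℂ) := Complex.ext (by simp) (by simp [hA i j])
    rw [h1, Complex.norm_real, Real.norm_eq_abs, sq_abs]; push_cast; rfl
  rw [Mat2.norm_sq, sqSum, h, h, h, h]; push_cast; rfl

lemma abs_log_norm_sqSum_sub_le {A B : Mat2} (hA : RealEntries A) (hA1 : 1 ≤ ‖A‖)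
    (hAB : ‖B - A‖ ≤ 1 / 10) :
    |Real.log ‖sqSum B‖ - 2 * Real.log ‖A‖| ≤ 1 ∧ exp (-1) ≤ ‖sqSum B‖ := by
  have h1 := norm_sqSum_sub_le A B
  have h2 : ‖sqSum B - sqSum A‖ ≤ 3 / 10 * ‖A‖ ^ 2 := by
    nlinarith [norm_nonneg (B - A)]
  have h3 : ‖sqSum A‖ = ‖A‖ ^ 2 := by
    rw [hA.sqSum_eq, Complex.norm_real, Real.norm_of_nonneg (by positivity)]
  have h4 := norm_sub_norm_le (sqSum A) (sqSum B)
  have h5 := norm_sub_norm_le (sqSum B) (sqSum A)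
  rw [norm_sub_rev, h3] at h4
  rw [h3] at h5
  have h6 : exp (-1) ≤ 7 / 10 := by
    rw [exp_neg]
    have := Real.exp_one_gt_d9
    rw [inv_le_comm₀ (exp_pos _) (by norm_num)]
    linarith
  have h7 : 13 / 10 ≤ exp 1 := by have := Real.exp_one_gt_d9; linarith
  have hpos : 0 < ‖A‖ ^ 2 := by positivity
  have hB : exp (-1) * ‖A‖ ^ 2 ≤ ‖sqSum B‖ := by nlinarith
  have hB' : ‖sqSum B‖ ≤ exp 1 * ‖A‖ ^ 2 := by nlinarith
  have hB0 : 0 < ‖sqSum B‖ := lt_of_lt_of_le (by positivity) hB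
  have h8 : 2 * Real.log ‖A‖ = Real.log (‖A‖ ^ 2) := by rw [Real.log_pow]; norm_num
  refine ⟨?_, le_trans ?_ hB⟩
  · have i1 := Real.log_le_log (by positivity) hB
    have i2 := Real.log_le_log hB0 hB'
    rw [Real.log_mul (exp_pos _).ne' hpos.ne', Real.log_exp] at i1 i2
    rw [h8, abs_le]
    constructor <;> linarith
  · exact le_mul_of_one_le_right (exp_pos _).le (one_le_pow₀ hA1)

section PolynomialApproximation

open Polynomial

/-- The Laurent polynomial `∑_{|k| ≤ N} a_k z^k`. -/
def laurentSum (a : ℤ → ℂ) (N : ℕ) (z : ℂ) : ℂ := ∑ k ∈ Finset.Icc (-N : ℤ) N, a k * z ^ k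

/-- `X ^ N` times the Laurent polynomial `∑_{|k| ≤ N} a_k X^k`. -/
def truncPoly (a : ℤ → ℂ) (N : ℕ) : ℂ[X] :=
  ∑ k ∈ Finset.Icc (-N : ℤ) N, C (a k) * X ^ (k + N).toNat

lemma eval_truncPoly (a : ℤ → ℂ) (N : ℕ) {z : ℂ} (hz : z ≠ 0) :
    (truncPoly a N).eval z = z ^ N * laurentSum a N z := by
  rw [truncPoly, laurentSum, eval_finsetSum, Finset.mul_sum]
  refine Finset.sum_congr rfl fun k hk => ?_
  rw [Finset.mem_Icc] at hk
  rw [eval_mul, eval_C, eval_pow, eval_X, mul_left_comm, ← zpow_natCast, Int.toNat_of_nonneg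
    (by omega), zpow_add₀ hz, zpow_natCast, mul_comm (z ^ k)]

lemma natDegree_truncPoly_le (a : ℤ → ℂ) (N : ℕ) : (truncPoly a N).natDegree ≤ 2 * N := by
  refine natDegree_sum_le_of_forall_le _ _ fun k hk => ?_
  rw [Finset.mem_Icc] at hk
  exact (natDegree_C_mul_X_pow_le _ _).trans (by omega)

/-- The transfer matrix with polynomial entries, at the rotated variable `u * X`. -/
def transferPoly (E : ℝ) (a : ℤ → ℂ) (N : ℕ) (u : ℂ) : Matrix (Fin 2) (Fin 2) ℂ[X] :=
  !![(C (E : ℂ) * X ^ N - truncPoly a N).comp (C u * X), (-X ^ N : ℂ[X]).comp (C u * X);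
    (X ^ N : ℂ[X]).comp (C u * X), 0]

/-- Products of polynomial transfer matrices. -/
def polyCyc (E : ℝ) (a : ℤ → ℂ) (N : ℕ) (u : ℂ) : ℕ → Matrix (Fin 2) (Fin 2) ℂ[X]
  | 0 => 1
  | n + 1 => transferPoly E a N (u ^ n) * polyCyc E a N u n

/-- The sum of the squared entries of `polyCyc`. -/
def traceSqPoly (E : ℝ) (a : ℤ → ℂ) (N : ℕ) (u : ℂ) (n : ℕ) : ℂ[X] :=
  polyCyc E a N u n 0 0 ^ 2 + polyCyc E a N u n 0 1 ^ 2 + polyCyc E a N u n 1 0 ^ 2 +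
    polyCyc E a N u n 1 1 ^ 2

lemma natDegree_transferPoly_le (E : ℝ) (a : ℤ → ℂ) (N : ℕ) (u : ℂ) (i j : Fin 2) :
    (transferPoly E a N u i j).natDegree ≤ 2 * N := by
  have h : ∀ P : ℂ[X], P.natDegree ≤ 2 * N → (P.comp (C u * X)).natDegree ≤ 2 * N := fun P hP => by
    refine natDegree_comp_le.trans ?_
    calc _ ≤ P.natDegree * 1 := Nat.mul_le_mul_left _ ((natDegree_C_mul_le u X).trans natDegree_X_le)
      _ ≤ _ := by omega
  have hX : (X ^ N : ℂ[X]).natDegree ≤ 2 * N := by rw [natDegree_X_pow]; omega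
  fin_cases i <;> fin_cases j
  · refine h _ ((natDegree_sub_le _ _).trans (max_le ?_ (natDegree_truncPoly_le a N)))
    exact (natDegree_C_mul_X_pow_le _ _).trans (by omega)
  · exact h _ (by rwa [natDegree_neg])
  · exact h _ hX
  · simp [transferPoly]

lemma natDegree_polyCyc_le (E : ℝ) (a : ℤ → ℂ) (N : ℕ) (u : ℂ) (n : ℕ) (i j : Fin 2) :
    (polyCyc E a N u n i j).natDegree ≤ 2 * N * n := by
  induction n generalizing i j with
  | zero => fin_cases i <;> fin_cases j <;> simp [polyCyc]
  | succ n ih =>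
    rw [polyCyc, Matrix.mul_apply]
    refine natDegree_sum_le_of_forall_le _ _ fun l _ => ?_
    refine natDegree_mul_le.trans ?_
    have := natDegree_transferPoly_le E a N (u ^ n) i l
    have := ih l j
    rw [mul_add]; omega

lemma natDegree_traceSqPoly_le (E : ℝ) (a : ℤ → ℂ) (N : ℕ) (u : ℂ) (n : ℕ) :
    (traceSqPoly E a N u n).natDegree ≤ 4 * N * n := by
  have h : ∀ i j, (polyCyc E a N u n i j ^ 2).natDegree ≤ 4 * N * n := fun i j => by
    refine natDegree_pow_le.trans ?_
    have := natDegree_polyCyc_le E a N u n i j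
    calc _ ≤ 2 * (2 * N * n) := by omega
      _ = _ := by ring
  exact (natDegree_add_le_of_degree_le (natDegree_add_le_of_degree_le
    (natDegree_add_le_of_degree_le (h 0 0) (h 0 1)) (h 1 0)) (h 1 1))

lemma eval_traceSqPoly (E : ℝ) (a : ℤ → ℂ) (N : ℕ) (u : ℂ) (n : ℕ) (z : ℂ) :
    (traceSqPoly E a N u n).eval z = sqSum ((evalRingHom z).mapMatrix (polyCyc E a N u n)) := by
  simp [traceSqPoly, sqSum]

lemma eval_transferPoly (E : ℝ) (a : ℤ → ℂ) (N : ℕ) {u z : ℂ} (hu : u * z ≠ 0) :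
    (evalRingHom z).mapMatrix (transferPoly E a N u) =
      (u * z) ^ N • transfer (E - laurentSum a N (u * z)) := by
  ext i j
  fin_cases i <;> fin_cases j <;>
    simp [transferPoly, transfer, eval_comp, eval_truncPoly a N hu]
  ring

lemma laurentSum_norm_le {a : ℤ → ℂ} {N : ℕ} {ρ t : ℝ} (ht : |t| ≤ ρ) {z : ℂ} (hz : ‖z‖ = exp t) :
    ‖laurentSum a N z‖ ≤ ∑ k ∈ Finset.Icc (-N : ℤ) N, ‖a k‖ * exp (ρ * |(k : ℝ)|) := by
  refine (norm_sum_le _ _).trans (Finset.sum_le_sum fun k _ => ?_)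
  rw [norm_mul, norm_zpow, hz, ← Real.rpow_intCast, ← Real.exp_mul]
  refine mul_le_mul_of_nonneg_left (exp_le_exp.2 ?_) (norm_nonneg _)
  calc t * k ≤ |t * k| := le_abs_self _
    _ = |t| * |(k : ℝ)| := abs_mul _ _
    _ ≤ _ := by gcongr

lemma traceSqPoly_norm_le {E Λ C₂ ρ t : ℝ} {a : ℤ → ℂ} {N : ℕ} {u z : ℂ} (hu : ‖u‖ = 1)
    (hΛ : |E| + C₂ + 2 ≤ exp Λ) (ht : |t| ≤ ρ) (hz : ‖z‖ = exp t)
    (hsum : ∑ k ∈ Finset.Icc (-N : ℤ) N, ‖a k‖ * exp (ρ * |(k : ℝ)|) ≤ C₂) (n : ℕ) :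
    ‖(traceSqPoly E a N u n).eval z‖ ≤ exp (2 * Λ * n + 2 + 2 * N * n * t) := by
  have h1 : ∀ n : ℕ, ‖(evalRingHom z).mapMatrix (polyCyc E a N u n)‖ ≤
      2 * exp (Λ * n + N * n * t) := by
    intro n
    induction n with
    | zero => simpa [polyCyc] using norm_one_mat2_le
    | succ n ih =>
      rw [polyCyc, map_mul]
      refine (norm_mul_le _ _).trans ?_
      have huz : ‖u ^ n * z‖ = exp t := by rw [norm_mul, norm_pow, hu, one_pow, one_mul, hz]
      have huz0 : u ^ n * z ≠ 0 := norm_pos_iff.1 (huz ▸ exp_pos t)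
      have h2 : ‖(evalRingHom z).mapMatrix (transferPoly E a N (u ^ n))‖ ≤ exp (Λ + N * t) := by
        rw [eval_transferPoly E a N huz0, norm_smul, norm_pow, huz, ← exp_nat_mul, exp_add,
          mul_comm (exp Λ)]
        gcongr
        exact schro_norm_le (v := fun _ => laurentSum a N (u ^ n * z)) (x := (0 : Circ)) hΛ
          ((laurentSum_norm_le ht huz).trans hsum)
      calc _ ≤ exp (Λ + N * t) * (2 * exp (Λ * n + N * n * t)) := by gcongr
        _ = 2 * (exp (Λ + N * t) * exp (Λ * n + N * n * t)) := by ring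
        _ = _ := by rw [← exp_add]; push_cast; ring_nf
  rw [eval_traceSqPoly]
  refine (norm_sqSum_le _).trans ?_
  calc _ ≤ (2 * exp (Λ * n + N * n * t)) ^ 2 := by gcongr; exact h1 n
    _ = 4 * exp (2 * Λ * n + 2 * N * n * t) := by
      rw [mul_pow, ← exp_nat_mul]; norm_num; ring_nf
    _ ≤ exp 2 * exp (2 * Λ * n + 2 * N * n * t) := by
      gcongr
      have h3 := Real.exp_one_gt_d9
      have h4 : exp 2 = exp 1 * exp 1 := by rw [← exp_add]; norm_num
      nlinarith
    _ = _ := by rw [← exp_add]; ring_nf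

lemma fourier_one_zpow (k : ℤ) (x : Circ) : (fourier 1 x : ℂ) ^ k = fourier k x := by
  rw [fourier_apply, fourier_apply, one_zsmul, AddCircle.toCircle_zsmul, Circle.coe_zpow]

lemma norm_eval_traceSqPoly (E : ℝ) (a : ℤ → ℂ) (N : ℕ) (ω : Circ) (n : ℕ) (x : Circ) :
    ‖(traceSqPoly E a N (fourier 1 ω) n).eval (fourier 1 x : ℂ)‖ =
      ‖sqSum (cyc ω (schro E fun x => laurentSum a N (fourier 1 x)) n x)‖ := by
  have h1 : ∃ c : ℂ, ‖c‖ = 1 ∧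
      (evalRingHom (fourier 1 x : ℂ)).mapMatrix (polyCyc E a N (fourier 1 ω) n) =
      c • cyc ω (schro E fun x => laurentSum a N (fourier 1 x)) n x := by
    induction n with
    | zero => exact ⟨1, norm_one, by simp [polyCyc, cyc]⟩
    | succ n ih =>
      obtain ⟨c, hc, h⟩ := ih
      have h2 : (fourier 1 ω : ℂ) ^ n * fourier 1 x = fourier 1 (x + n • ω) := by
        rw [fourier_arg_add, fourier_arg_nsmul, mul_comm]
      have h3 : (fourier 1 (x + n • ω) : ℂ) ≠ 0 := by
        rw [← norm_pos_iff, norm_fourier_arg]; exact one_pos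
      refine ⟨(fourier 1 (x + n • ω) : ℂ) ^ N * c, ?_, ?_⟩
      · rw [norm_mul, norm_pow, norm_fourier_arg, one_pow, hc, one_mul]
      · rw [polyCyc, map_mul, h, eval_transferPoly E a N (by rwa [h2]), h2, cyc, schro,
          smul_mul_smul_comm]
  obtain ⟨c, hc, h⟩ := h1
  have h4 : ∀ A : Mat2, sqSum (c • A) = c ^ 2 * sqSum A := fun A => by
    simp only [sqSum, Matrix.smul_apply, smul_eq_mul]; ring
  rw [eval_traceSqPoly, h, h4, norm_mul, norm_pow, hc, one_pow, one_mul]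

lemma exists_fourier_one_eq {z : ℂ} (hz : ‖z‖ = 1) : ∃ x : Circ, (fourier 1 x : ℂ) = z := by
  refine ⟨((z.arg : ℝ) : Circ), ?_⟩
  rw [fourier_coe_apply]
  conv_rhs => rw [← Complex.norm_mul_exp_arg_mul_I z, hz]
  rw [Complex.ofReal_one, one_mul]
  congr 1
  have : (π : ℂ) ≠ 0 := by exact_mod_cast pi_ne_zero
  rw [circPeriod]
  push_cast
  field_simp

/-- Polynomial approximation of a Schrödinger cocycle with well approximated potential, together
with the resulting Fourier decay. -/
lemma exists_log_approx {E Λ C₂ ε ρ : ℝ} {v : Circ → ℝ} {a : ℤ → ℂ} {N n : ℕ} (ω : Circ)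
    (hΛ : |E| + C₂ + 2 ≤ exp Λ) (hΛ0 : 0 ≤ Λ) (hρ : 0 < ρ)
    (htail : ∀ x, ‖(v x : ℂ) - laurentSum a N (fourier 1 x)‖ ≤ ε) (hv : ∀ x, |v x| ≤ C₂)
    (hsum : ∑ k ∈ Finset.Icc (-N : ℤ) N, ‖a k‖ * exp (ρ * |(k : ℝ)|) ≤ C₂)
    (hε : 2 * n * ε * exp (Λ * n) ≤ 1 / 10) :
    ∃ U : Circ → ℝ, Continuous U ∧
      (∀ x, |U x - 2 * logNorm ω (schro E fun x => (v x : ℂ)) n x| ≤ 1) ∧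
      ∀ k : ℤ, k ≠ 0 → ‖fourierCoeff (fun x => (U x : ℂ)) k‖ ≤
        (4 * (2 * Λ * n + 3) / ρ + 4 * N * n * exp (-(ρ / 2) * |(k : ℝ)|)) / |(k : ℝ)| := by
  set P := traceSqPoly E a N (fourier 1 ω) n with hP
  set V : Circ → ℂ := fun x => laurentSum a N (fourier 1 x) with hV
  have hA : ∀ x, ‖schro E (fun x => (v x : ℂ)) x‖ ≤ exp Λ := fun x =>
    schro_norm_le hΛ (by rw [Complex.norm_real]; exact hv x)
  have hB : ∀ x, ‖schro E V x‖ ≤ exp Λ := fun x =>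
    schro_norm_le hΛ ((laurentSum_norm_le (t := 0) (by simpa using hρ.le)
      (by rw [norm_fourier_arg, exp_zero])).trans hsum)
  have hAB : ∀ x, ‖schro E V x - schro E (fun x => (v x : ℂ)) x‖ ≤ ε := fun x => by
    rw [schro, schro, transfer_sub_norm]
    refine le_trans (le_of_eq ?_) (htail x)
    congr 1; ring
  have hkey : ∀ x, |Real.log ‖P.eval (fourier 1 x : ℂ)‖ -
      2 * logNorm ω (schro E fun x => (v x : ℂ)) n x| ≤ 1 ∧
      exp (-1) ≤ ‖P.eval (fourier 1 x : ℂ)‖ := by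
    intro x
    rw [hP, norm_eval_traceSqPoly]
    exact abs_log_norm_sqSum_sub_le (cyc_realEntries (schro_realEntries E v) n x)
      (Mat2.one_le_norm (cyc_det (schro_det E _) n x))
      ((cyc_sub_norm_le hA hΛ0 hB hAB n x).trans hε)
  refine ⟨fun x => Real.log ‖P.eval (fourier 1 x : ℂ)‖, ?_, fun x => (hkey x).1, fun k hk => ?_⟩
  · refine Continuous.log (by fun_prop) fun x => ?_
    exact (lt_of_lt_of_le (exp_pos _) (hkey x).2).ne'
  · have h1 := fourierCoeff_log_norm_eval_le (P := P) (d := 2 * N * n * ρ) (M := 2 * Λ * n + 2)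
      (m := -1) hρ (fun z hz => by
        obtain ⟨x, rfl⟩ := exists_fourier_one_eq hz
        exact (hkey x).2)
      (fun z hz => traceSqPoly_norm_le (norm_fourier_arg 1 ω) hΛ (abs_of_pos hρ).le hz hsum n)
      (fun z hz => by
        have := traceSqPoly_norm_le (E := E) (norm_fourier_arg 1 ω) hΛ
          (by rw [abs_neg, abs_of_pos hρ]) hz hsum n
        rw [mul_neg, ← sub_eq_add_neg] at this
        exact this) hk
    refine h1.trans ?_
    have h2 : (P.natDegree : ℝ) ≤ 4 * N * n := by
      exact_mod_cast natDegree_traceSqPoly_le E a N (fourier 1 ω) n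
    have h3 : 2 * Λ * n + 2 - -1 = 2 * Λ * n + 3 := by ring
    rw [h3]
    gcongr

end PolynomialApproximation

lemma tendsto_rpow_mul_exp_neg_rpow (r : ℝ) {b p : ℝ} (hb : 0 < b) (hp : 0 < p) :
    Tendsto (fun n : ℕ => (n : ℝ) ^ r * exp (-b * (n : ℝ) ^ p)) atTop (nhds 0) := by
  have h1 := (tendsto_rpow_mul_exp_neg_mul_atTop_nhds_zero (r / p) b hb).comp
    ((tendsto_rpow_atTop hp).comp tendsto_natCast_atTop_atTop)
  refine h1.congr fun n => ?_
  simp only [Function.comp_apply]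
  rw [← rpow_mul (Nat.cast_nonneg n), mul_div_cancel₀ _ hp.ne']

lemma summable_exp_neg_rpow {b p : ℝ} (hb : 0 < b) (hp : 0 < p) :
    Summable fun k : ℤ => exp (-b * |(k : ℝ)| ^ p) := by
  have h : Summable fun n : ℕ => exp (-b * (n : ℝ) ^ p) := by
    have h1 := (tendsto_rpow_mul_exp_neg_rpow 2 hb hp).eventually (Iic_mem_nhds one_pos)
    refine summable_of_isBigO_nat (Real.summable_one_div_nat_pow.2 one_lt_two)
      (Asymptotics.IsBigO.of_bound 1 ?_)
    filter_upwards [h1, eventually_gt_atTop 0] with n hn hn0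
    have hn0' : (0 : ℝ) < n := by exact_mod_cast hn0
    rw [Real.rpow_two] at hn
    rw [Real.norm_of_nonneg (exp_pos _).le, Real.norm_of_nonneg (by positivity), one_mul,
      le_div_iff₀ (by positivity), mul_comm]
    exact hn
  refine Summable.of_nat_of_neg ?_ ?_ <;> simpa using h

/-- The weighted Fourier majorant of potentials with stretched exponential Fourier decay. -/
def fourierMajorant (C₁ c p : ℝ) : ℝ := ∑' k : ℤ, C₁ * exp (-(c / 2) * |(k : ℝ)| ^ p)

section StretchedDecay

variable {C₁ c p : ℝ} {v : Circ → ℝ}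

lemma hasSum_fourierMajorant (C₁ : ℝ) (hc : 0 < c) (hp : 0 < p) :
    HasSum (fun k : ℤ => C₁ * exp (-(c / 2) * |(k : ℝ)| ^ p)) (fourierMajorant C₁ c p) :=
  ((summable_exp_neg_rpow (half_pos hc) hp).mul_left C₁).hasSum

lemma fourierMajorant_nonneg (hC : 0 ≤ C₁) : 0 ≤ fourierMajorant C₁ c p :=
  tsum_nonneg fun _ => by positivity

lemma hasSum_fourier_of_decay (hc : 0 < c) (hp : 0 < p) (hv : Continuous v)
    (hdec : ∀ k : ℤ, ‖fourierCoeff (fun x => (v x : ℂ)) k‖ ≤ C₁ * exp (-c * |(k : ℝ)| ^ p))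
    (x : Circ) :
    HasSum (fun k : ℤ => fourierCoeff (fun x => (v x : ℂ)) k * fourier k x) (v x) := by
  have hs : Summable (fourierCoeff fun x : Circ => (v x : ℂ)) :=
    Summable.of_norm_bounded ((summable_exp_neg_rpow hc hp).mul_left C₁) hdec
  have h := has_pointwise_sum_fourier_series_of_summable
    (f := (⟨fun x => (v x : ℂ), Complex.continuous_ofReal.comp hv⟩ : C(Circ, ℂ))) hs x
  simp only [smul_eq_mul] at h
  exact h

lemma abs_le_fourierMajorant (hC : 0 ≤ C₁) (hc : 0 < c) (hp : 0 < p) (hv : Continuous v)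
    (hdec : ∀ k : ℤ, ‖fourierCoeff (fun x => (v x : ℂ)) k‖ ≤ C₁ * exp (-c * |(k : ℝ)| ^ p))
    (x : Circ) : |v x| ≤ fourierMajorant C₁ c p := by
  have h := (hasSum_fourier_of_decay hc hp hv hdec x).norm_le_of_bounded
    (hasSum_fourierMajorant C₁ hc hp) fun k => by
      rw [norm_mul, norm_fourier_arg, mul_one]
      refine (hdec k).trans ?_
      gcongr
      linarith
  rwa [Complex.norm_real] at h

lemma norm_sub_laurentSum_le (hC : 0 ≤ C₁) (hc : 0 < c) (hp : 0 < p) (hv : Continuous v)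
    (hdec : ∀ k : ℤ, ‖fourierCoeff (fun x => (v x : ℂ)) k‖ ≤ C₁ * exp (-c * |(k : ℝ)| ^ p))
    (N : ℕ) (x : Circ) :
    ‖(v x : ℂ) - laurentSum (fourierCoeff fun x => (v x : ℂ)) N (fourier 1 x)‖ ≤
      exp (-(c / 2) * (N : ℝ) ^ p) * fourierMajorant C₁ c p := by
  have h1 := hasSum_fourier_of_decay hc hp hv hdec x
  have h2 := hasSum_sum_of_ne_finset_zero
    (L := SummationFilter.unconditional ℤ) (s := Finset.Icc (-N : ℤ) N) (f := fun k : ℤ =>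
    if k ∈ Finset.Icc (-N : ℤ) N then
      fourierCoeff (fun x => (v x : ℂ)) k * (fourier k x : ℂ) else 0) fun k hk => if_neg hk
  have h3 : ∑ k ∈ Finset.Icc (-N : ℤ) N, (if k ∈ Finset.Icc (-N : ℤ) N then
      fourierCoeff (fun x => (v x : ℂ)) k * (fourier k x : ℂ) else 0) =
      laurentSum (fourierCoeff fun x => (v x : ℂ)) N (fourier 1 x) := by
    refine Finset.sum_congr rfl fun k hk => ?_
    rw [if_pos hk, fourier_one_zpow]
  rw [h3] at h2
  refine (h1.sub h2).norm_le_of_bounded ((hasSum_fourierMajorant C₁ hc hp).mul_left _) fun k => ?_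
  split_ifs with hk
  · rw [sub_self, norm_zero]; positivity
  · rw [sub_zero, norm_mul, norm_fourier_arg, mul_one]
    refine (hdec k).trans ?_
    have hNk : (N : ℝ) ≤ |(k : ℝ)| := by
      rw [Finset.mem_Icc, ← abs_le, not_le] at hk
      exact_mod_cast hk.le
    rw [mul_left_comm, ← exp_add]
    gcongr
    have := rpow_le_rpow (Nat.cast_nonneg N) hNk hp.le
    nlinarith

lemma sum_fourierCoeff_mul_exp_le (hC : 0 ≤ C₁) (hc : 0 < c) (hp : 0 < p)
    (hdec : ∀ k : ℤ, ‖fourierCoeff (fun x => (v x : ℂ)) k‖ ≤ C₁ * exp (-c * |(k : ℝ)| ^ p))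
    {N : ℕ} {ρ : ℝ} (hρ : ∀ k ∈ Finset.Icc (-N : ℤ) N, ρ * |(k : ℝ)| ≤ c / 2 * |(k : ℝ)| ^ p) :
    ∑ k ∈ Finset.Icc (-N : ℤ) N,
      ‖fourierCoeff (fun x => (v x : ℂ)) k‖ * exp (ρ * |(k : ℝ)|) ≤ fourierMajorant C₁ c p := by
  refine le_trans (Finset.sum_le_sum fun k hk => ?_)
    (sum_le_hasSum _ (fun k _ => by positivity) (hasSum_fourierMajorant C₁ hc hp))
  calc _ ≤ C₁ * exp (-c * |(k : ℝ)| ^ p) * exp (c / 2 * |(k : ℝ)| ^ p) := 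
        mul_le_mul (hdec k) (exp_le_exp.2 (hρ k hk)) (exp_pos _).le (by positivity)
    _ = _ := by rw [mul_assoc, ← exp_add]; ring_nf

end StretchedDecay

lemma Mat2.norm_adjugate (A : Mat2) : ‖A.adjugate‖ = ‖A‖ := by
  have h : ‖A.adjugate‖ ^ 2 = ‖A‖ ^ 2 := by
    rw [Mat2.norm_sq, Mat2.norm_sq, Matrix.adjugate_fin_two]
    simp
    ring
  exact (sq_eq_sq₀ (norm_nonneg _) (norm_nonneg _)).1 h

lemma cyc_shift_mul (ω : Circ) (A : Circ → Mat2) (n : ℕ) (x : Circ) :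
    cyc ω A n (x + ω) * A x = A (x + n • ω) * cyc ω A n x := by
  have h := cyc_add ω A n 1 x
  have h1 : cyc ω A 1 x = A x := by simp [cyc]
  rw [one_nsmul, h1] at h
  rw [← h]
  rfl

lemma abs_logNorm_shift_sub_le {ω : Circ} {A : Circ → Mat2} {Λ : ℝ} (hd : ∀ x, (A x).det = 1)
    (hΛ : ∀ x, ‖A x‖ ≤ exp Λ) (n : ℕ) (x : Circ) :
    |logNorm ω A n (x + ω) - logNorm ω A n x| ≤ 2 * Λ := by
  have key : ∀ {X Y B C : Mat2}, B.det = 1 → ‖B‖ ≤ exp Λ → ‖C‖ ≤ exp Λ → 0 < ‖X‖ → 0 < ‖Y‖ →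
      (X * B = C * Y ∨ B * X = Y * C) → Real.log ‖X‖ - Real.log ‖Y‖ ≤ 2 * Λ := by
    intro X Y B C hB hBn hCn hX hY h
    have h1 : ‖X‖ ≤ exp Λ * exp Λ * ‖Y‖ := by
      rcases h with h | h
      · have h2 : X = C * Y * B.adjugate := by
          rw [← h, mul_assoc, Matrix.mul_adjugate, hB, one_smul, mul_one]
        calc ‖X‖ ≤ ‖C‖ * ‖Y‖ * ‖B.adjugate‖ := by
              rw [h2]
              exact (norm_mul_le _ _).trans (by gcongr; exact norm_mul_le _ _)
          _ ≤ exp Λ * ‖Y‖ * exp Λ := by rw [Mat2.norm_adjugate]; gcongr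
          _ = _ := by ring
      · have h2 : X = B.adjugate * (Y * C) := by
          rw [← h, ← mul_assoc, Matrix.adjugate_mul, hB, one_smul, one_mul]
        calc ‖X‖ ≤ ‖B.adjugate‖ * (‖Y‖ * ‖C‖) := by
              rw [h2]
              exact (norm_mul_le _ _).trans (by gcongr; exact norm_mul_le _ _)
          _ ≤ exp Λ * (‖Y‖ * exp Λ) := by rw [Mat2.norm_adjugate]; gcongr
          _ = _ := by ring
    have h3 := Real.log_le_log hX h1
    rw [Real.log_mul (by positivity) hY.ne', Real.log_mul (exp_ne_zero _) (exp_ne_zero _),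
      Real.log_exp] at h3
    linarith
  have hs := cyc_shift_mul ω A n x
  rw [abs_sub_le_iff]
  exact ⟨key (hd x) (hΛ x) (hΛ _) (cyc_norm_pos hd n _) (cyc_norm_pos hd n _) (Or.inl hs),
    key (hd (x + n • ω)) (hΛ _) (hΛ x) (cyc_norm_pos hd n _) (cyc_norm_pos hd n _)
      (Or.inr hs.symm)⟩

lemma finVar_eq {ω : Circ} {A : Circ → Mat2} {n : ℕ} :
    finVar ω A n =
      (∫ x, (logNorm ω A n x - ∫ y, logNorm ω A n y ∂circMeas) ^ 2 ∂circMeas) / (n : ℝ) ^ 2 := by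
  rw [finVar, ← integral_div]
  refine integral_congr_ae (ae_of_all _ fun x => ?_)
  simp only [finLyap, ← sub_div, div_pow]

lemma integral_sq_dev_le_of_abs_sub_le {U W : Circ → ℝ} (hU : Continuous U) (hW : Continuous W)
    (h : ∀ x, |U x - 2 * W x| ≤ 1) :
    ∫ x, (W x - ∫ y, W y ∂circMeas) ^ 2 ∂circMeas ≤
      (∫ x, (U x - ∫ y, U y ∂circMeas) ^ 2 ∂circMeas) / 2 + 2 := by
  have h1 : |(∫ y, U y ∂circMeas) - 2 * ∫ y, W y ∂circMeas| ≤ 1 := by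
    rw [← integral_const_mul, ← integral_sub (continuous_integrable hU)
      (continuous_integrable (hW.const_mul 2))]
    have := norm_integral_le_of_norm_le_const (μ := circMeas) (C := 1)
      (f := fun y => U y - 2 * W y) (ae_of_all _ h)
    simpa using this
  set a := ∫ y, U y ∂circMeas
  set b := ∫ y, W y ∂circMeas
  have h2 : ∫ x, ((U x - a) ^ 2 / 2 + 2) ∂circMeas = (∫ x, (U x - a) ^ 2 ∂circMeas) / 2 + 2 := by
    rw [integral_add (continuous_integrable (by fun_prop)) (continuous_integrable (by fun_prop)),
      integral_div]
    simp
  rw [← h2]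
  refine integral_mono (continuous_integrable (by fun_prop)) (continuous_integrable (by fun_prop))
    fun x => ?_
  have hx := abs_le.1 (h x)
  have h1' := abs_le.1 h1
  have h3 : |(2 * (W x - b)) - (U x - a)| ≤ 2 := by rw [abs_le]; constructor <;> linarith
  have h4 := sq_abs (2 * (W x - b) - (U x - a))
  have h5 : |(2 * (W x - b)) - (U x - a)| ^ 2 ≤ 4 := by
    have := abs_nonneg (2 * (W x - b) - (U x - a))
    nlinarith
  dsimp only
  nlinarith [sq_nonneg (2 * (W x - b) - 2 * (U x - a))]

/-- A variance bound for the Schrödinger cocycle in terms of a Laurent approximation of the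
potential and of the smoothing scales `q ≤ R`. -/
lemma finVar_schro_le {cα α E Λ C₂ ε ρ : ℝ} {v : Circ → ℝ} {a : ℤ → ℂ} {N n q R : ℕ}
    (hcα : 0 < cα) (hα : BadlyApprox cα α) (hvc : Continuous v)
    (hΛ : |E| + C₂ + 2 ≤ exp Λ) (hΛ0 : 0 ≤ Λ) (hρ : 0 < ρ)
    (htail : ∀ x, ‖(v x : ℂ) - laurentSum a N (fourier 1 x)‖ ≤ ε) (hv : ∀ x, |v x| ≤ C₂)
    (hsum : ∑ k ∈ Finset.Icc (-N : ℤ) N, ‖a k‖ * exp (ρ * |(k : ℝ)|) ≤ C₂)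
    (hε : 2 * n * ε * exp (Λ * n) ≤ 1 / 10) (hn : 1 ≤ n) (hq : 1 ≤ q) (hqR : q ≤ R) :
    finVar ((2 * π * α : ℝ) : Circ) (schro E fun x => (v x : ℂ)) n ≤
      (((4 * Λ + 2) * R) ^ 2 + (q / (2 * cα * R)) ^ 2 * (2 * Λ * n + 1) ^ 2 +
        (4 * (2 * Λ * n + 3) / ρ + 4 * N * n * exp (-(ρ / 2) * q)) ^ 2 *
          (8 * (∑' j, cellWeight cα j) * invSqSum / (q : ℝ) ^ 2) + 2) / (n : ℝ) ^ 2 := by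
  set ω : Circ := ((2 * π * α : ℝ) : Circ)
  set A := schro E fun x => (v x : ℂ)
  obtain ⟨U, hUc, hUl, hUf⟩ := exists_log_approx ω hΛ hΛ0 hρ htail hv hsum hε
  have hd : ∀ x, (A x).det = 1 := schro_det E _
  have hA : Continuous A := schro_continuous E (Complex.continuous_ofReal.comp hvc)
  have hAn : ∀ x, ‖A x‖ ≤ exp Λ := fun x =>
    schro_norm_le hΛ (by rw [Complex.norm_real]; exact hv x)
  have hL0 := logNorm_nonneg (ω := ω) hd n
  have hL1 := logNorm_le (ω := ω) hd hAn n hn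
  have hD : ∀ x, |U (x + ω) - U x| ≤ 2 * (2 * Λ + 1) := fun x => by
    have h1 := abs_le.1 (hUl x)
    have h2 := abs_le.1 (hUl (x + ω))
    have h3 := abs_le.1 (abs_logNorm_shift_sub_le (ω := ω) hd hAn n x)
    rw [abs_le]; constructor <;> linarith
  have hS : ∀ x, |U x| ≤ 2 * Λ * n + 1 := fun x => by
    have h1 := abs_le.1 (hUl x)
    rw [abs_le]; constructor <;> linarith [hL0 x, hL1 x]
  have hmain := integral_sq_dev_le hcα hα hUc hD hS hq hqR
    (G := 4 * (2 * Λ * n + 3) / ρ + 4 * N * n * exp (-(ρ / 2) * q)) fun k hk => by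
      have hk0 : k ≠ 0 := by rintro rfl; simp at hk; omega
      refine (hUf k hk0).trans ?_
      have hk' : (q : ℝ) ≤ |(k : ℝ)| := by exact_mod_cast hk
      gcongr ?_ / _
      gcongr 4 * (2 * Λ * n + 3) / ρ + 4 * N * n * exp ?_
      nlinarith
  rw [finVar_eq]
  gcongr
  refine (integral_sq_dev_le_of_abs_sub_le hUc (logNorm_continuous hA hd n) hUl).trans ?_
  have : (4 * Λ + 2) = 2 * (2 * Λ + 1) := by ring
  rw [this]
  linarith

lemma mul_exp_neg_le_one (x : ℝ) : x * exp (-x) ≤ 1 := by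
  have h1 := add_one_le_exp x
  have h2 : exp x * exp (-x) = 1 := by rw [← exp_add]; simp
  nlinarith [exp_pos (-x)]

/-- The truncation length and strip width used at scale `n` in the Gevrey class `s`. -/
lemma exists_truncation {c s Λ C₂ : ℝ} (hc : 0 < c) (hs : 1 ≤ s) (hΛ : 0 ≤ Λ) (hC : 0 ≤ C₂) :
    ∃ B r : ℝ, 0 ≤ B ∧ 0 < r ∧ ∀ n : ℕ, 1 ≤ n → ∃ N : ℕ,
      (N : ℝ) ≤ B * (n : ℝ) ^ s ∧
      2 * n * (exp (-(c / 2) * (N : ℝ) ^ (1 / s)) * C₂) * exp (Λ * n) ≤ 1 / 10 ∧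
      ∀ k ∈ Finset.Icc (-N : ℤ) N,
        r * (n : ℝ) ^ (1 - s) * |(k : ℝ)| ≤ c / 2 * |(k : ℝ)| ^ (1 / s) := by
  have hs0 : 0 < s := by linarith
  set β := 2 / c * (Λ + 1 + 20 * C₂) with hβ
  have hβ0 : 0 < β := by positivity
  refine ⟨(β + 1) ^ s, c / 2 * (β + 1) ^ (1 - s), by positivity, by positivity, fun n hn => ?_⟩
  have hn1 : (1 : ℝ) ≤ n := by exact_mod_cast hn
  have hn0 : (0 : ℝ) < n := by linarith
  set N := ⌈(β * n) ^ s⌉₊ with hN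
  have hNle : (N : ℝ) ≤ ((β + 1) * n) ^ s := by
    have h1 := (Nat.ceil_lt_add_one (a := (β * n) ^ s) (by positivity)).le
    have h2 := add_rpow_le_rpow_add (a := β * n) (b := n) (by positivity) hn0.le hs
    have h3 : (1 : ℝ) ≤ (n : ℝ) ^ s := one_le_rpow hn1 hs0.le
    rw [add_mul, one_mul]
    linarith
  have hNge : β * n ≤ (N : ℝ) ^ (1 / s) := by
    have h1 := rpow_le_rpow (by positivity) (Nat.le_ceil ((β * n) ^ s)) (z := 1 / s)
      (by positivity)
    rwa [← rpow_mul (by positivity), mul_one_div_cancel hs0.ne', rpow_one] at h1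
  refine ⟨N, by rwa [mul_rpow (by positivity) hn0.le] at hNle, ?_, fun k hk => ?_⟩
  · have h1 : exp (-(c / 2) * (N : ℝ) ^ (1 / s)) ≤
        exp (-n) * exp (-(20 * C₂)) * exp (-(Λ * n)) := by
      rw [← exp_add, ← exp_add]
      refine exp_le_exp.2 ?_
      have h2 : c / 2 * (β * n) = (Λ + 1 + 20 * C₂) * n := by rw [hβ]; field_simp
      have h3 := mul_le_mul_of_nonneg_left hNge (half_pos hc).le
      nlinarith
    have h4 : exp (-(Λ * n)) * exp (Λ * n) = 1 := by rw [← exp_add]; simp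
    have h5 := mul_exp_neg_le_one (n : ℝ)
    have h6 := mul_exp_neg_le_one (20 * C₂)
    calc 2 * n * (exp (-(c / 2) * (N : ℝ) ^ (1 / s)) * C₂) * exp (Λ * n)
        ≤ 2 * n * (exp (-n) * exp (-(20 * C₂)) * exp (-(Λ * n)) * C₂) * exp (Λ * n) := by gcongr
      _ = 2 * (n * exp (-n)) * (C₂ * exp (-(20 * C₂))) * (exp (-(Λ * n)) * exp (Λ * n)) := by ring
      _ = 2 * (n * exp (-n)) * (C₂ * exp (-(20 * C₂))) := by rw [h4, mul_one]
      _ ≤ 2 * 1 * (C₂ * exp (-(20 * C₂))) := by gcongr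
      _ ≤ 1 / 10 := by linarith
  · rcases eq_or_ne k 0 with rfl | hk0
    · simp [hs0.ne']
    have hkN : |(k : ℝ)| ≤ ((β + 1) * n) ^ s := by
      rw [Finset.mem_Icc, ← abs_le] at hk
      exact le_trans (by exact_mod_cast hk) hNle
    have hkpos : 0 < |(k : ℝ)| := by positivity
    have hp : 0 ≤ 1 - 1 / s := by rw [sub_nonneg, div_le_one hs0]; exact hs
    have h1 : |(k : ℝ)| ^ (1 - 1 / s) ≤ ((β + 1) * n) ^ (s - 1) := by
      refine (rpow_le_rpow hkpos.le hkN hp).trans_eq ?_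
      rw [← rpow_mul (by positivity)]
      congr 1
      field_simp
    have h2 : ((β + 1) * n) ^ (1 - s) * ((β + 1) * n) ^ (s - 1) = 1 := by
      rw [← rpow_add (by positivity)]; simp
    have h3 : |(k : ℝ)| = |(k : ℝ)| ^ (1 - 1 / s) * |(k : ℝ)| ^ (1 / s) := by
      rw [← rpow_add hkpos]; simp
    calc c / 2 * (β + 1) ^ (1 - s) * (n : ℝ) ^ (1 - s) * |(k : ℝ)|
        = c / 2 * ((β + 1) * n) ^ (1 - s) * (|(k : ℝ)| ^ (1 - 1 / s) * |(k : ℝ)| ^ (1 / s)) := by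
          rw [← h3, mul_rpow (by positivity) hn0.le]; ring
      _ ≤ c / 2 * ((β + 1) * n) ^ (1 - s) *
            (((β + 1) * n) ^ (s - 1) * |(k : ℝ)| ^ (1 / s)) := by gcongr
      _ = c / 2 * (((β + 1) * n) ^ (1 - s) * ((β + 1) * n) ^ (s - 1)) *
            |(k : ℝ)| ^ (1 / s) := by ring
      _ = _ := by rw [h2, mul_one]

/-- The algebraic estimate behind the choice of scales `q ≈ a`, `R ≈ b`. -/
lemma variance_terms_le {n a b q R Λ r B N cα κ X : ℝ} (hn : 1 ≤ n) (ha : 1 ≤ a) (han : a ≤ n)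
    (hb : 1 ≤ b) (hab : b ^ 2 = n * a) (hq : a ≤ q) (hq' : q ≤ 2 * a) (hR : b ≤ R)
    (hR' : R ≤ 2 * b) (hΛ : 0 ≤ Λ) (hr : 0 < r) (hcα : 0 < cα) (hκ : 0 ≤ κ) (hN0 : 0 ≤ N)
    (hX0 : 0 ≤ X) (hN : N ≤ B * a ^ 2) (hX : 4 * (B * a ^ 2) * n * X ≤ 1) :
    (((4 * Λ + 2) * R) ^ 2 + (q / (2 * cα * R)) ^ 2 * (2 * Λ * n + 1) ^ 2 +
        (4 * (2 * Λ * n + 3) / (r * (n / a ^ 2)) + 4 * N * n * X) ^ 2 * (κ / q ^ 2) + 2) / n ^ 2 ≤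
      (4 * (4 * Λ + 2) ^ 2 + ((2 * Λ + 1) / cα) ^ 2 + (4 * (2 * Λ + 3) / r + 1) ^ 2 * κ + 2) *
        (a / n) := by
  have hn0 : 0 < n := by linarith
  have ha0 : 0 < a := by linarith
  have hb0 : 0 < b := by linarith
  have hq0 : 0 < q := by linarith
  have hR0 : 0 < R := by linarith
  have t1 : ((4 * Λ + 2) * R) ^ 2 ≤ 4 * (4 * Λ + 2) ^ 2 * (n * a) := by
    calc ((4 * Λ + 2) * R) ^ 2 ≤ ((4 * Λ + 2) * (2 * b)) ^ 2 := by gcongr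
      _ = 4 * (4 * Λ + 2) ^ 2 * b ^ 2 := by ring
      _ = _ := by rw [hab]
  have t2 : (q / (2 * cα * R)) ^ 2 * (2 * Λ * n + 1) ^ 2 ≤ ((2 * Λ + 1) / cα) ^ 2 * (n * a) := by
    calc (q / (2 * cα * R)) ^ 2 * (2 * Λ * n + 1) ^ 2
        ≤ (2 * a / (2 * cα * b)) ^ 2 * ((2 * Λ + 1) * n) ^ 2 := by
          gcongr
          linarith
      _ = ((2 * Λ + 1) / cα) ^ 2 * (a ^ 2 * n ^ 2 / b ^ 2) := by field_simp
      _ = _ := by rw [hab]; field_simp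
  have t3 : 4 * (2 * Λ * n + 3) / (r * (n / a ^ 2)) + 4 * N * n * X ≤
      (4 * (2 * Λ + 3) / r + 1) * a ^ 2 := by
    have h1 : 4 * (2 * Λ * n + 3) / (r * (n / a ^ 2)) ≤ 4 * (2 * Λ + 3) / r * a ^ 2 := by
      calc _ ≤ 4 * ((2 * Λ + 3) * n) / (r * (n / a ^ 2)) := by gcongr; linarith
        _ = _ := by field_simp
    have h2 : 4 * N * n * X ≤ 1 := by
      refine le_trans ?_ hX
      gcongr
    nlinarith
  have t4 : (4 * (2 * Λ * n + 3) / (r * (n / a ^ 2)) + 4 * N * n * X) ^ 2 * (κ / q ^ 2) ≤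
      (4 * (2 * Λ + 3) / r + 1) ^ 2 * κ * (n * a) := by
    calc _ ≤ ((4 * (2 * Λ + 3) / r + 1) * a ^ 2) ^ 2 * (κ / a ^ 2) := by gcongr
      _ = (4 * (2 * Λ + 3) / r + 1) ^ 2 * κ * (a * a) := by field_simp
      _ ≤ _ := by gcongr
  have t5 : (2 : ℝ) ≤ 2 * (n * a) := by nlinarith
  rw [div_le_iff₀ (by positivity)]
  have : a / n * n ^ 2 = n * a := by field_simp
  rw [mul_assoc _ (a / n), this]
  linarith

/-- Uniform power-law bound for the variance of the finite-scale Lyapunov exponents. -/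
theorem exists_finVar_le {cα α s C₁ c : ℝ} (hcα : 0 < cα) (hα : BadlyApprox cα α) (hs1 : 1 ≤ s)
    (hs2 : s < 2) (hC₁ : 0 ≤ C₁) (hc : 0 < c) (E : ℝ) :
    ∃ C₀ : ℝ, 0 ≤ C₀ ∧ ∃ n₁ : ℕ, ∀ v : Circ → ℝ, Continuous v →
      (∀ k : ℤ, ‖fourierCoeff (fun x => (v x : ℂ)) k‖ ≤ C₁ * exp (-c * |(k : ℝ)| ^ (1 / s))) →
      ∀ n ≥ n₁, finVar ((2 * π * α : ℝ) : Circ) (schro E fun x => (v x : ℂ)) n ≤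
        C₀ * (n : ℝ) ^ (-((2 - s) / 2)) := by
  have hs0 : 0 < s := by linarith
  have hp : 0 < 1 / s := by positivity
  set C₂ := fourierMajorant C₁ c (1 / s) with hC₂
  have hC₂0 : 0 ≤ C₂ := fourierMajorant_nonneg hC₁
  set Λ := Real.log (|E| + C₂ + 2) with hΛdef
  have hpos : (1 : ℝ) ≤ |E| + C₂ + 2 := by linarith [abs_nonneg E]
  have hΛ0 : 0 ≤ Λ := Real.log_nonneg hpos
  have hΛ : |E| + C₂ + 2 ≤ exp Λ := (Real.exp_log (by linarith)).ge
  obtain ⟨B, r, hB, hr, htrunc⟩ := exists_truncation hc hs1 hΛ0 hC₂0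
  set κ := 8 * (∑' j, cellWeight cα j) * invSqSum with hκdef
  have htend := (tendsto_rpow_mul_exp_neg_rpow (s + 1) (half_pos hr)
    (show 0 < 1 - s / 2 by linarith)).const_mul (4 * B)
  rw [mul_zero] at htend
  obtain ⟨n₂, hn₂⟩ := eventually_atTop.1 (htend.eventually (Iic_mem_nhds one_pos))
  refine ⟨4 * (4 * Λ + 2) ^ 2 + ((2 * Λ + 1) / cα) ^ 2 + (4 * (2 * Λ + 3) / r + 1) ^ 2 * |κ| + 2,
    by positivity, max n₂ 1, fun v hv hdec n hn => ?_⟩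
  have hn1 : 1 ≤ n := le_of_max_le_right hn
  have hn1' : (1 : ℝ) ≤ n := by exact_mod_cast hn1
  have hn0 : (0 : ℝ) < n := by linarith
  obtain ⟨N, hN, hε, hρ⟩ := htrunc n hn1
  set a := (n : ℝ) ^ (s / 2) with ha
  set b := (n : ℝ) ^ (1 / 2 + s / 4) with hb
  have ha1 : 1 ≤ a := one_le_rpow hn1' (by positivity)
  have hb1 : 1 ≤ b := one_le_rpow hn1' (by positivity)
  have han : a ≤ n := by
    calc a ≤ (n : ℝ) ^ (1 : ℝ) := rpow_le_rpow_of_exponent_le hn1' (by linarith)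
      _ = n := rpow_one _
  have haleb : a ≤ b := rpow_le_rpow_of_exponent_le hn1' (by linarith)
  have hab : b ^ 2 = n * a := by
    rw [ha, hb, ← rpow_natCast, ← rpow_mul hn0.le, ← rpow_one_add' hn0.le (by positivity)]
    congr 1
    push_cast
    ring
  have hasq : (n : ℝ) ^ s = a ^ 2 := by
    rw [ha, ← rpow_natCast, ← rpow_mul hn0.le]
    congr 1
    push_cast
    ring
  have hρeq : r * (n : ℝ) ^ (1 - s) = r * (n / a ^ 2) := by
    rw [← hasq, rpow_sub hn0, rpow_one]
  have hgoal : (n : ℝ) ^ (-((2 - s) / 2)) = a / n := by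
    rw [ha, ← rpow_sub_one hn0.ne']
    congr 1
    ring
  have hq1 : 1 ≤ ⌈a⌉₊ := Nat.one_le_ceil_iff.2 (by linarith)
  have hqa := Nat.le_ceil a
  have hqa' := (Nat.ceil_lt_add_one (a := a) (by positivity)).le
  have hRb := Nat.le_ceil b
  have hRb' := (Nat.ceil_lt_add_one (a := b) (by positivity)).le
  have hvar := finVar_schro_le (q := ⌈a⌉₊) (R := ⌈b⌉₊) (E := E) hcα hα hv hΛ hΛ0
    (ρ := r * (n : ℝ) ^ (1 - s)) (by positivity)
    (norm_sub_laurentSum_le hC₁ hc hp hv hdec N) (abs_le_fourierMajorant hC₁ hc hp hv hdec)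
    (sum_fourierCoeff_mul_exp_le hC₁ hc hp hdec hρ) hε hn1 hq1 (Nat.ceil_le_ceil haleb)
  rw [hgoal]
  refine hvar.trans ?_
  rw [hρeq]
  have hX : 4 * (B * a ^ 2) * n * exp (-(r * (n / a ^ 2) / 2) * ⌈a⌉₊) ≤ 1 := by
    have h1 := hn₂ n (le_of_max_le_left hn)
    have h2 : (n : ℝ) ^ (s + 1) = a ^ 2 * n := by rw [rpow_add_one hn0.ne', hasq]
    have h3 : (n : ℝ) ^ (1 - s / 2) = n / a := by rw [rpow_sub hn0, rpow_one]
    simp only [h2, h3] at h1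
    have h4 : exp (-(r * (n / a ^ 2) / 2) * ⌈a⌉₊) ≤ exp (-(r / 2) * (n / a)) := by
      refine exp_le_exp.2 ?_
      have h5 : r * (n / a ^ 2) / 2 * a ≤ r * (n / a ^ 2) / 2 * ⌈a⌉₊ := by gcongr
      have h6 : r * (n / a ^ 2) / 2 * a = r / 2 * (n / a) := by field_simp
      linarith
    calc _ ≤ 4 * (B * a ^ 2) * n * exp (-(r / 2) * (n / a)) := by gcongr
      _ = 4 * B * (a ^ 2 * n * exp (-(r / 2) * (n / a))) := by ring
      _ ≤ 1 := h1
  refine le_trans ?_ (variance_terms_le hn1' ha1 han hb1 hab hqa (by linarith) hRb (by linarith)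
    hΛ0 hr hcα (abs_nonneg κ) (Nat.cast_nonneg N) (exp_pos _).le (hasq ▸ hN) hX)
  gcongr
  exact le_abs_self κ

lemma abs_iteratedDeriv_le_of_gevreyNorm_le {s K C : ℝ} {f : ℝ → ℝ} (hK : 0 < K) (hC : 0 ≤ C)
    (h : gevreyNorm s K f ≤ ENNReal.ofReal C) (m : ℕ) (x : ℝ) :
    |iteratedDeriv m f x| ≤ C * K ^ m * (m.factorial : ℝ) ^ s := by
  have hfac : (0 : ℝ) < m.factorial := by exact_mod_cast m.factorial_pos
  set w := 4 * π ^ 2 / 3 * ((1 + (m : ℝ)) ^ 2 / (K ^ m * (m.factorial : ℝ) ^ s)) with hw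
  have hw0 : 0 ≤ w := by positivity
  have h1 : ENNReal.ofReal (w * |iteratedDeriv m f x|) ≤ ENNReal.ofReal C := by
    rw [ENNReal.ofReal_mul hw0]
    refine le_trans ?_ h
    refine le_trans ?_ (le_iSup _ m)
    gcongr
    exact le_iSup₂_of_le x (Set.mem_univ x) le_rfl
  rw [ENNReal.ofReal_le_ofReal_iff hC] at h1
  have hK' : 0 < K ^ m * (m.factorial : ℝ) ^ s := by positivity
  have h2 : 1 / (K ^ m * (m.factorial : ℝ) ^ s) ≤ w := by
    have h3 : (1 : ℝ) ≤ 4 * π ^ 2 / 3 := by nlinarith [Real.pi_gt_three]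
    have h4 : (1 : ℝ) ≤ (1 + (m : ℝ)) ^ 2 := one_le_pow₀ (by simp)
    have h5 : 1 / (K ^ m * (m.factorial : ℝ) ^ s) ≤
        (1 + (m : ℝ)) ^ 2 / (K ^ m * (m.factorial : ℝ) ^ s) := by gcongr
    exact h5.trans (le_mul_of_one_le_left (by positivity) h3)
  have h6 := (mul_le_mul_of_nonneg_right h2 (abs_nonneg (iteratedDeriv m f x))).trans h1
  rw [one_div_mul_eq_div, div_le_iff₀ hK'] at h6
  linarith

lemma periodic_iteratedDeriv {f : ℝ → ℝ} {T : ℝ} (hf : Function.Periodic f T) (m : ℕ) :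
    Function.Periodic (iteratedDeriv m f) T := by
  intro x
  have h := congrFun (iteratedDeriv_comp_add_const m f T) x
  rw [show (fun z => f (z + T)) = f from funext hf] at h
  exact h.symm

lemma lift_eq_liftIoc {f : ℝ → ℝ} (hf : Function.Periodic f circPeriod) :
    (fun x : Circ => (hf.lift x : ℂ)) = AddCircle.liftIoc circPeriod 0 fun x => (f x : ℂ) := by
  funext x
  obtain ⟨y, hy, rfl⟩ : x ∈ (fun y : ℝ => (y : Circ)) '' Set.Ioc 0 (0 + circPeriod) := by
    rw [AddCircle.coe_image_Ioc_eq]; trivial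
  rw [AddCircle.liftIoc_coe_apply hy, Function.Periodic.lift_coe]

lemma continuous_lift {f : ℝ → ℝ} (hf : Function.Periodic f circPeriod) (hc : Continuous f) :
    Continuous hf.lift :=
  continuous_coinduced_dom.2 hc

lemma norm_fourierCoeff_lift_mul {f f' : ℝ → ℝ} (hf : Function.Periodic f circPeriod)
    (hf' : Function.Periodic f' circPeriod) (hd : ∀ x, HasDerivAt f (f' x) x)
    (hc : Continuous f') {k : ℤ} (hk : k ≠ 0) :
    ‖fourierCoeff (fun x : Circ => (hf.lift x : ℂ)) k‖ * |(k : ℝ)| =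
      ‖fourierCoeff (fun x : Circ => (hf'.lift x : ℂ)) k‖ := by
  have hT : (0 : ℝ) < 2 * π := two_pi_pos
  rw [lift_eq_liftIoc, lift_eq_liftIoc, fourierCoeff_liftIoc_eq, fourierCoeff_liftIoc_eq,
    fourierCoeffOn_of_hasDerivAt _ hk (fun x _ => (hd x).ofReal_comp)
      (Continuous.intervalIntegrable (by fun_prop) _ _), hf 0, sub_self, mul_zero, zero_sub,
    norm_mul, norm_neg, norm_mul]
  have hk' : (0 : ℝ) < |(k : ℝ)| := by positivity
  have h1 : ‖((0 + circPeriod : ℝ) : ℂ) - ((0 : ℝ) : ℂ)‖ = 2 * π := by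
    rw [circPeriod, zero_add, Complex.ofReal_zero, sub_zero, Complex.norm_real,
      Real.norm_of_nonneg hT.le]
  have h2 : ‖1 / (-2 * (π : ℂ) * Complex.I * k)‖ = 1 / (2 * π * |(k : ℝ)|) := by
    simp [abs_of_pos pi_pos]
  rw [h1, h2]
  field_simp

lemma norm_fourierCoeff_le {g : Circ → ℂ} {C : ℝ} (hg : ∀ x, ‖g x‖ ≤ C) (k : ℤ) :
    ‖fourierCoeff g k‖ ≤ C := by
  have := norm_integral_le_of_norm_le_const (μ := circMeas) (C := C)
    (f := fun x => fourier (-k) x • g x) (ae_of_all _ fun x => by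
      rw [norm_smul, norm_fourier_arg, one_mul]; exact hg x)
  simpa [fourierCoeff] using this

lemma norm_fourierCoeff_lift_mul_pow_le {f : ℝ → ℝ} (hf : Function.Periodic f circPeriod)
    (hs : ContDiff ℝ (⊤ : ℕ∞) f) (m : ℕ) {C : ℝ} (hC : ∀ x, |iteratedDeriv m f x| ≤ C) {k : ℤ}
    (hk : k ≠ 0) :
    ‖fourierCoeff (fun x : Circ => (hf.lift x : ℂ)) k‖ * |(k : ℝ)| ^ m ≤ C := by
  have key : ∀ m, ‖fourierCoeff (fun x : Circ => (hf.lift x : ℂ)) k‖ * |(k : ℝ)| ^ m =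
      ‖fourierCoeff (fun x : Circ => ((periodic_iteratedDeriv hf m).lift x : ℂ)) k‖ := by
    intro m
    induction m with
    | zero => simp
    | succ m ih =>
      have hd : ∀ x, HasDerivAt (iteratedDeriv m f) (iteratedDeriv (m + 1) f x) x := fun x => by
        rw [iteratedDeriv_succ]
        exact ((hs.differentiable_iteratedDeriv m
          (by exact_mod_cast WithTop.coe_lt_top _)) x).hasDerivAt
      rw [pow_succ, ← mul_assoc, ih]
      exact norm_fourierCoeff_lift_mul _ _ hd
        (hs.continuous_iteratedDeriv (m + 1) (by exact_mod_cast le_top)) hk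
  rw [key]
  refine norm_fourierCoeff_le (fun x => ?_) k
  induction x using QuotientAddGroup.induction_on with
  | H y =>
    rw [Complex.norm_real]
    exact hC y

/-- Gevrey functions have stretched exponentially decaying Fourier coefficients. -/
lemma norm_fourierCoeff_le_of_gevrey {f : ℝ → ℝ} {s K C : ℝ}
    (hf : Function.Periodic f circPeriod) (hs : ContDiff ℝ (⊤ : ℕ∞) f) (hs1 : 1 ≤ s) (hK : 0 < K)
    (hC : 0 ≤ C) (hbd : ∀ m x, |iteratedDeriv m f x| ≤ C * K ^ m * (m.factorial : ℝ) ^ s)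
    (k : ℤ) :
    ‖fourierCoeff (fun x : Circ => (hf.lift x : ℂ)) k‖ ≤
      C * exp 1 * exp (-(1 / (exp 1 * K)) ^ (1 / s) * |(k : ℝ)| ^ (1 / s)) := by
  have hs0 : 0 < s := by linarith
  rcases eq_or_ne k 0 with rfl | hk
  · have h1 : ‖fourierCoeff (fun x : Circ => (hf.lift x : ℂ)) 0‖ ≤ C := by
      refine norm_fourierCoeff_le (fun x => ?_) 0
      induction x using QuotientAddGroup.induction_on with
      | H y =>
        rw [Complex.norm_real]
        have := hbd 0 y
        simp only [iteratedDeriv_zero, pow_zero, mul_one, Nat.factorial_zero, Nat.cast_one,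
          one_rpow] at this
        exact this
    have h2 : (0 : ℝ) ^ (1 / s) = 0 := zero_rpow (by positivity)
    simp only [Int.cast_zero, abs_zero, h2, mul_zero, exp_zero, mul_one]
    exact h1.trans (le_mul_of_one_le_right hC (one_le_exp zero_le_one))
  have hk0 : (0 : ℝ) < |(k : ℝ)| := by positivity
  set y := (|(k : ℝ)| / (exp 1 * K)) ^ (1 / s) with hy
  have hy0 : 0 ≤ y := by positivity
  set m := ⌊y⌋₊ with hm
  have hmy : (m : ℝ) ≤ y := Nat.floor_le hy0
  have hms : (m : ℝ) ^ s ≤ |(k : ℝ)| / (exp 1 * K) := by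
    calc (m : ℝ) ^ s ≤ y ^ s := rpow_le_rpow (Nat.cast_nonneg m) hmy hs0.le
      _ = _ := by
        rw [hy, ← rpow_mul (by positivity), one_div_mul_cancel hs0.ne', rpow_one]
  have h1 := norm_fourierCoeff_lift_mul_pow_le hf hs m (hbd m) hk
  have h2 : (m.factorial : ℝ) ^ s ≤ (|(k : ℝ)| / (exp 1 * K)) ^ m := by
    calc (m.factorial : ℝ) ^ s ≤ ((m : ℝ) ^ m) ^ s := by
          refine rpow_le_rpow (Nat.cast_nonneg _) ?_ hs0.le
          exact_mod_cast Nat.factorial_le_pow m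
      _ = ((m : ℝ) ^ s) ^ m := by
          rw [← rpow_natCast, ← rpow_natCast, ← rpow_mul (Nat.cast_nonneg _),
            ← rpow_mul (Nat.cast_nonneg _), mul_comm]
      _ ≤ _ := by gcongr
  have h3 : ‖fourierCoeff (fun x : Circ => (hf.lift x : ℂ)) k‖ ≤ C * exp (-m) := by
    refine le_of_mul_le_mul_right ?_ (pow_pos hk0 m)
    calc _ ≤ C * K ^ m * (m.factorial : ℝ) ^ s := h1
      _ ≤ C * K ^ m * (|(k : ℝ)| / (exp 1 * K)) ^ m := by gcongr
      _ = C * exp (-m) * |(k : ℝ)| ^ m := by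
        rw [div_pow, mul_pow, ← exp_nat_mul, mul_one, exp_neg]
        field_simp
  refine h3.trans ?_
  rw [mul_assoc, ← exp_add]
  gcongr
  have h4 := (Nat.lt_floor_add_one y).le
  have h5 : (1 / (exp 1 * K)) ^ (1 / s) * |(k : ℝ)| ^ (1 / s) = y := by
    rw [hy, ← mul_rpow (by positivity) hk0.le, one_div_mul_eq_div]
  rw [neg_mul, h5]
  linarith

/-- The complexification of a real `2 × 2` matrix. -/
def complexify (A : Matrix (Fin 2) (Fin 2) ℝ) : Mat2 := A.map (fun x : ℝ => (x : ℂ))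

lemma complexify_mul (A B : Matrix (Fin 2) (Fin 2) ℝ) :
    complexify (A * B) = complexify A * complexify B :=
  Matrix.map_mul (f := Complex.ofRealHom)

lemma norm_complexify_sq (A : Matrix (Fin 2) (Fin 2) ℝ) :
    ‖complexify A‖ ^ 2 = A 0 0 ^ 2 + A 0 1 ^ 2 + A 1 0 ^ 2 + A 1 1 ^ 2 := by
  rw [Mat2.norm_sq]
  simp [complexify]

lemma mnorm_nonneg (A : Matrix (Fin 2) (Fin 2) ℝ) : 0 ≤ mnorm A := norm_nonneg _

lemma mnorm_mul_le (A B : Matrix (Fin 2) (Fin 2) ℝ) : mnorm (A * B) ≤ mnorm A * mnorm B := by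
  rw [mnorm, map_mul]
  exact norm_mul_le _ _

lemma mnorm_le_norm_complexify (A : Matrix (Fin 2) (Fin 2) ℝ) : mnorm A ≤ ‖complexify A‖ := by
  refine ContinuousLinearMap.opNorm_le_bound _ (norm_nonneg _) fun x => ?_
  refine (sq_le_sq₀ (norm_nonneg _) (by positivity)).1 ?_
  rw [mul_pow, norm_complexify_sq, EuclideanSpace.norm_sq_eq, EuclideanSpace.norm_sq_eq]
  simp only [Matrix.ofLp_toEuclideanCLM, Matrix.mulVec, dotProduct, Fin.sum_univ_two,
    Real.norm_eq_abs, sq_abs]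
  nlinarith [sq_nonneg (A 0 0 * x 1 - A 0 1 * x 0), sq_nonneg (A 1 0 * x 1 - A 1 1 * x 0)]

lemma norm_complexify_le (A : Matrix (Fin 2) (Fin 2) ℝ) : ‖complexify A‖ ≤ 2 * mnorm A := by
  have hcol : ∀ j, A 0 j ^ 2 + A 1 j ^ 2 ≤ mnorm A ^ 2 := fun j => by
    have h := (Matrix.toEuclideanCLM (𝕜 := ℝ) A).le_opNorm (EuclideanSpace.single j 1)
    rw [PiLp.norm_single, norm_one, mul_one] at h
    have h2 := pow_le_pow_left₀ (norm_nonneg _) h 2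
    rw [EuclideanSpace.norm_sq_eq] at h2
    change _ ≤ mnorm A ^ 2 at h2
    simpa [Matrix.ofLp_toEuclideanCLM, Fin.sum_univ_two] using h2
  refine (sq_le_sq₀ (norm_nonneg _) (mul_nonneg zero_le_two (mnorm_nonneg A))).1 ?_
  rw [norm_complexify_sq]
  nlinarith [hcol 0, hcol 1, sq_nonneg (mnorm A)]

lemma continuous_mnorm : Continuous mnorm :=
  (LinearMap.continuous_of_finiteDimensional
    (Matrix.toEuclideanCLM (n := Fin 2) (𝕜 := ℝ)).toAlgEquiv.toLinearMap).norm

lemma cocycleIter_add (α : ℝ) (A : ℝ → Matrix (Fin 2) (Fin 2) ℝ) (m n : ℕ) (x : ℝ) :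
    cocycleIter α A (m + n) x = cocycleIter α A m (x + 2 * π * n * α) * cocycleIter α A n x := by
  induction m with
  | zero => simp [cocycleIter]
  | succ m ih =>
    have h : x + 2 * π * ((m + n : ℕ) : ℝ) * α = x + 2 * π * n * α + 2 * π * m * α := by
      push_cast
      ring
    rw [Nat.add_right_comm, cocycleIter, ih, cocycleIter, h]
    exact (mul_assoc _ _ _).symm

lemma cocycleIter_continuous {α : ℝ} {A : ℝ → Matrix (Fin 2) (Fin 2) ℝ} (hA : Continuous A)
    (n : ℕ) : Continuous (cocycleIter α A n) := by
  induction n with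
  | zero => exact continuous_const
  | succ n ih => exact (hA.comp (by fun_prop)).mul ih

lemma cocycleIter_periodic {α T : ℝ} {A : ℝ → Matrix (Fin 2) (Fin 2) ℝ}
    (hA : Function.Periodic A T) (n : ℕ) : Function.Periodic (cocycleIter α A n) T := by
  induction n with
  | zero => intro x; rfl
  | succ n ih =>
    intro x
    rw [cocycleIter, cocycleIter, ih, add_right_comm, hA]

lemma complexify_cocycleIter {α E : ℝ} {v : ℝ → ℝ} (hv : Function.Periodic v circPeriod) (n : ℕ)
    (x : ℝ) : complexify (cocycleIter α (schrodingerMap E v) n x) =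
      cyc ((2 * π * α : ℝ) : Circ) (schro E fun x => (hv.lift x : ℂ)) n (x : Circ) := by
  induction n with
  | zero => simp [cocycleIter, cyc, complexify]
  | succ n ih =>
    rw [cocycleIter, complexify_mul, ih, cyc]
    congr 1
    have h : (x : Circ) + n • ((2 * π * α : ℝ) : Circ) = ((x + 2 * π * n * α : ℝ) : Circ) := by
      rw [← AddCircle.coe_nsmul, ← AddCircle.coe_add, nsmul_eq_mul]
      congr 2
      ring
    rw [h, schro, Function.Periodic.lift_coe]
    ext i j
    fin_cases i <;> fin_cases j <;> simp [complexify, schrodingerMap, transfer]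

lemma integral_circMeas_eq (g : Circ → ℝ) :
    ∫ x, g x ∂circMeas = (2 * π)⁻¹ * ∫ x in (0 : ℝ)..(2 * π), g (x : Circ) := by
  have h := AddCircle.intervalIntegral_preimage circPeriod 0 g
  rw [zero_add] at h
  change _ = (2 * π)⁻¹ * ∫ x in (0 : ℝ)..circPeriod, g (x : Circ)
  rw [h, AddCircle.volume_eq_smul_haarAddCircle, integral_smul_measure,
    ENNReal.toReal_ofReal fact_circPeriod_pos.out.le, smul_eq_mul, ← mul_assoc]
  rw [show (2 * π)⁻¹ * circPeriod = 1 from inv_mul_cancel₀ two_pi_pos.ne', one_mul]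

lemma tendsto_finLyap {ω : Circ} {A : Circ → Mat2} (hA : Continuous A)
    (hd : ∀ x, (A x).det = 1) :
    ∃ l, Tendsto (finLyap ω A) atTop (nhds l) ∧ ∀ n, n ≠ 0 → l ≤ finLyap ω A n := by
  have hb : BddBelow (Set.range fun n : ℕ => (∫ x, logNorm ω A n x ∂circMeas) / (n : ℝ)) :=
    ⟨0, by rintro _ ⟨n, rfl⟩; exact finLyap_nonneg hd n⟩
  have h := finLyap_subadditive (ω := ω) hA hd
  exact ⟨h.lim, h.tendsto_lim hb, fun n hn => h.lim_le_div hb hn⟩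

/-- The averaged logarithm of the operator norm of the iterates. -/
def opLogInt (α : ℝ) (A : ℝ → Matrix (Fin 2) (Fin 2) ℝ) (n : ℕ) : ℝ :=
  (2 * π)⁻¹ * ∫ x in (0 : ℝ)..(2 * π), Real.log (mnorm (cocycleIter α A n x))

section LyapunovExponent

variable {α E : ℝ} {v : ℝ → ℝ}

lemma schrodingerMap_continuous (hc : Continuous v) : Continuous (schrodingerMap E v) := by
  refine continuous_matrix fun i j => ?_
  fin_cases i <;> fin_cases j <;> simp [schrodingerMap] <;> fun_prop

lemma mnorm_cocycleIter_pos (hv : Function.Periodic v circPeriod) (n : ℕ) (x : ℝ) :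
    0 < mnorm (cocycleIter α (schrodingerMap E v) n x) := by
  have h1 := norm_complexify_le (cocycleIter α (schrodingerMap E v) n x)
  rw [complexify_cocycleIter hv] at h1
  have h2 := cyc_norm_pos (ω := ((2 * π * α : ℝ) : Circ))
    (schro_det E fun x => (hv.lift x : ℂ)) n (x : Circ)
  linarith

lemma log_mnorm_continuous (hv : Function.Periodic v circPeriod) (hc : Continuous v) (n : ℕ) :
    Continuous fun x => Real.log (mnorm (cocycleIter α (schrodingerMap E v) n x)) :=
  (continuous_mnorm.comp (cocycleIter_continuous (schrodingerMap_continuous hc) n)).log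
    fun x => (mnorm_cocycleIter_pos hv n x).ne'

lemma logNorm_coe_continuous (hv : Function.Periodic v circPeriod) (hc : Continuous v) (n : ℕ) :
    Continuous fun x : ℝ => logNorm ((2 * π * α : ℝ) : Circ)
      (schro E fun x => (hv.lift x : ℂ)) n (x : Circ) :=
  (logNorm_continuous (schro_continuous E (Complex.continuous_ofReal.comp (continuous_lift hv hc)))
    (schro_det E _) n).comp (AddCircle.continuous_mk' _)

lemma opLogInt_le (hv : Function.Periodic v circPeriod) (hc : Continuous v) (n : ℕ) :
    opLogInt α (schrodingerMap E v) n ≤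
      ∫ x, logNorm ((2 * π * α : ℝ) : Circ) (schro E fun x => (hv.lift x : ℂ)) n x ∂circMeas := by
  rw [integral_circMeas_eq, opLogInt]
  gcongr
  refine intervalIntegral.integral_mono_on two_pi_pos.le
    ((log_mnorm_continuous hv hc n).intervalIntegrable _ _)
    ((logNorm_coe_continuous hv hc n).intervalIntegrable _ _) fun x _ => ?_
  refine Real.log_le_log (mnorm_cocycleIter_pos hv n x) ?_
  rw [← complexify_cocycleIter hv]
  exact mnorm_le_norm_complexify _

lemma le_opLogInt (hv : Function.Periodic v circPeriod) (hc : Continuous v) (n : ℕ) :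
    (∫ x, logNorm ((2 * π * α : ℝ) : Circ) (schro E fun x => (hv.lift x : ℂ)) n x ∂circMeas) -
      Real.log 2 ≤ opLogInt α (schrodingerMap E v) n := by
  have h2 : Real.log 2 = (2 * π)⁻¹ * ∫ _ in (0 : ℝ)..(2 * π), Real.log 2 := by
    rw [intervalIntegral.integral_const, smul_eq_mul, sub_zero, inv_mul_cancel_left₀ two_pi_pos.ne']
  have hi := (logNorm_coe_continuous (α := α) (E := E) hv hc n).intervalIntegrable (μ := volume) 0 (2 * π)
  rw [integral_circMeas_eq, opLogInt, h2, ← mul_sub, ← intervalIntegral.integral_sub hi (by simp)]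
  gcongr
  refine intervalIntegral.integral_mono_on two_pi_pos.le (hi.sub (by simp))
    ((log_mnorm_continuous hv hc n).intervalIntegrable _ _) fun x _ => ?_
  have hpos := mnorm_cocycleIter_pos (α := α) (E := E) hv n x
  have hpos' := cyc_norm_pos (ω := ((2 * π * α : ℝ) : Circ))
    (schro_det E fun x => (hv.lift x : ℂ)) n (x : Circ)
  rw [sub_le_iff_le_add, add_comm, ← Real.log_mul two_ne_zero hpos.ne']
  refine Real.log_le_log hpos' ?_
  rw [← complexify_cocycleIter hv]
  exact norm_complexify_le _

lemma opLogInt_subadditive (hv : Function.Periodic v circPeriod) (hc : Continuous v) :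
    Subadditive (opLogInt α (schrodingerMap E v)) := by
  intro m n
  set f := fun n x => Real.log (mnorm (cocycleIter α (schrodingerMap E v) n x)) with hf
  have hfc : ∀ n, Continuous (f n) := fun n => log_mnorm_continuous hv hc n
  have hfp : Function.Periodic (f m) (2 * π) := fun x => by
    have : Function.Periodic (schrodingerMap E v) (2 * π) := fun y => by
      rw [schrodingerMap, show v (y + 2 * π) = v y from hv y, schrodingerMap]
    simp only [hf, cocycleIter_periodic this m x]
  have hshift : ∫ x in (0 : ℝ)..(2 * π), f m x =
      ∫ x in (0 : ℝ)..(2 * π), f m (x + 2 * π * n * α) := by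
    rw [intervalIntegral.integral_comp_add_right, zero_add, add_comm (2 * π)]
    have := hfp.intervalIntegral_add_eq 0 (2 * π * n * α)
    rwa [zero_add] at this
  have hsi : Continuous fun x => f m (x + 2 * π * n * α) := (hfc m).comp (by fun_prop)
  change (2 * π)⁻¹ * ∫ x in (0 : ℝ)..(2 * π), f (m + n) x ≤
    (2 * π)⁻¹ * (∫ x in (0 : ℝ)..(2 * π), f m x) + (2 * π)⁻¹ * ∫ x in (0 : ℝ)..(2 * π), f n x
  rw [hshift, ← mul_add, ← intervalIntegral.integral_add (hsi.intervalIntegrable _ _)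
    ((hfc n).intervalIntegrable _ _)]
  gcongr
  refine intervalIntegral.integral_mono_on two_pi_pos.le ((hfc _).intervalIntegrable _ _)
    ((hsi.add (hfc n)).intervalIntegrable _ _) fun x _ => ?_
  simp only [hf]
  rw [← Real.log_mul (mnorm_cocycleIter_pos hv _ _).ne' (mnorm_cocycleIter_pos hv _ _).ne']
  refine Real.log_le_log (mnorm_cocycleIter_pos hv _ _) ?_
  rw [cocycleIter_add]
  exact mnorm_mul_le _ _

/-- The Lyapunov exponent is the limit of the finite-scale exponents of the circle cocycle. -/
lemma lyapunovExp_eq (hv : Function.Periodic v circPeriod) (hc : Continuous v) {l : ℝ}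
    (hl : Tendsto (finLyap ((2 * π * α : ℝ) : Circ) (schro E fun x => (hv.lift x : ℂ))) atTop
      (nhds l)) :
    lyapunovExp α (schrodingerMap E v) = l := by
  have hsub := opLogInt_subadditive (α := α) (E := E) hv hc
  set u := opLogInt α (schrodingerMap E v) with hu
  have hd := schro_det E fun x => (hv.lift x : ℂ)
  have hlow : ∀ n : ℕ, finLyap ((2 * π * α : ℝ) : Circ) (schro E fun x => (hv.lift x : ℂ)) n -
      Real.log 2 / n ≤ u n / n := fun n => by
    rw [finLyap, ← sub_div]
    gcongr
    exact le_opLogInt hv hc n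
  have hup : ∀ n : ℕ, u n / n ≤
      finLyap ((2 * π * α : ℝ) : Circ) (schro E fun x => (hv.lift x : ℂ)) n := fun n => by
    rw [finLyap]
    gcongr
    exact opLogInt_le hv hc n
  have hlim : Tendsto (fun n : ℕ => u n / n) atTop (nhds l) := by
    refine tendsto_of_tendsto_of_tendsto_of_le_of_le ?_ hl hlow hup
    simpa using hl.sub (tendsto_const_div_atTop_nhds_zero_nat (Real.log 2))
  have hbdd : BddBelow (Set.range fun n : ℕ => u n / (n : ℝ)) := by
    obtain ⟨b, hb⟩ := hlim.bddBelow_range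
    exact ⟨b, hb⟩
  have hlim' := tendsto_nhds_unique hlim (hsub.tendsto_lim hbdd)
  have hform : lyapunovExp α (schrodingerMap E v) = ⨅ n : ℕ, u (n + 1) / ((n + 1 : ℕ) : ℝ) := by
    rw [lyapunovExp]
    refine iInf_congr fun n => ?_
    rw [one_div_mul_eq_div, Nat.cast_add_one]
    rfl
  have hbdd' : BddBelow (Set.range fun n : ℕ => u (n + 1) / ((n + 1 : ℕ) : ℝ)) :=
    hbdd.mono (by rintro _ ⟨n, rfl⟩; exact ⟨n + 1, rfl⟩)
  rw [hform]
  refine le_antisymm ?_ ?_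
  · exact ge_of_tendsto' (hlim.comp (tendsto_add_atTop_nat 1)) fun n => ciInf_le hbdd' n
  · rw [hlim']
    exact le_ciInf fun n => hsub.lim_le_div hbdd n.succ_ne_zero

end LyapunovExponent

lemma abs_log_sub_log_le_of_one_le {x y : ℝ} (hx : 1 ≤ x) (hy : 1 ≤ y) :
    |Real.log x - Real.log y| ≤ |x - y| := by
  have key : ∀ {x y : ℝ}, 1 ≤ x → 1 ≤ y → Real.log x - Real.log y ≤ |x - y| := by
    intro x y hx hy
    have hy0 : 0 < y := by linarith
    rw [← Real.log_div (by linarith) hy0.ne']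
    have h1 := Real.log_le_sub_one_of_pos (show 0 < x / y by positivity)
    have h2 : x / y - 1 = (x - y) / y := by field_simp
    have h3 : (x - y) / y ≤ |x - y| :=
      (div_le_div_of_nonneg_right (le_abs_self _) hy0.le).trans (div_le_self (abs_nonneg _) hy)
    linarith
  rw [abs_sub_le_iff]
  exact ⟨key hx hy, abs_sub_comm x y ▸ key hy hx⟩

lemma abs_finLyap_sub_le {ω : Circ} {A B : Circ → Mat2} {Λ ε : ℝ} (hAc : Continuous A)
    (hBc : Continuous B) (hAd : ∀ x, (A x).det = 1) (hBd : ∀ x, (B x).det = 1)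
    (hA : ∀ x, ‖A x‖ ≤ exp Λ) (hΛ : 0 ≤ Λ) (hB : ∀ x, ‖B x‖ ≤ exp Λ)
    (hAB : ∀ x, ‖B x - A x‖ ≤ ε) (n : ℕ) :
    |finLyap ω B n - finLyap ω A n| ≤ 2 * ε * exp (Λ * n) := by
  have hε : 0 ≤ ε := (norm_nonneg _).trans (hAB 0)
  rcases Nat.eq_zero_or_pos n with rfl | hn
  · simp [finLyap, hε]
  have hn0 : (0 : ℝ) < n := by exact_mod_cast hn
  have hx : ∀ x, ‖logNorm ω B n x - logNorm ω A n x‖ ≤ 2 * n * ε * exp (Λ * n) := fun x => by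
    refine (abs_log_sub_log_le_of_one_le (Mat2.one_le_norm (cyc_det hBd n x))
      (Mat2.one_le_norm (cyc_det hAd n x))).trans ?_
    exact (abs_norm_sub_norm_le _ _).trans (cyc_sub_norm_le hA hΛ hB hAB n x)
  have hInt := norm_integral_le_of_norm_le_const (μ := circMeas)
    (f := fun x => logNorm ω B n x - logNorm ω A n x) (ae_of_all _ hx)
  rw [integral_sub (continuous_integrable (logNorm_continuous hBc hBd n))
    (continuous_integrable (logNorm_continuous hAc hAd n)), probReal_univ, mul_one,
    Real.norm_eq_abs] at hInt
  rw [finLyap, finLyap, ← sub_div, abs_div, abs_of_pos hn0, div_le_iff₀ hn0]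
  linarith

lemma norm_schro_sub (E : ℝ) (v w : Circ → ℝ) (x : Circ) :
    ‖schro E (fun x => (w x : ℂ)) x - schro E (fun x => (v x : ℂ)) x‖ = |w x - v x| := by
  rw [schro, schro, transfer_sub_norm, sub_sub_sub_cancel_left, ← Complex.ofReal_sub,
    Complex.norm_real, Real.norm_eq_abs, abs_sub_comm]

/-- Continuity of the Lyapunov exponent along uniformly convergent sequences of potentials with
uniform stretched exponential decay of the Fourier coefficients. -/
theorem tendsto_lyapunov_of_decay {cα α s C₁ c E : ℝ} (hcα : 0 < cα) (hα : BadlyApprox cα α)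
    (hs1 : 1 ≤ s) (hs2 : s < 2) (hC₁ : 0 ≤ C₁) (hc : 0 < c) {v : Circ → ℝ} {w : ℕ → Circ → ℝ}
    (hv : Continuous v) (hw : ∀ j, Continuous (w j))
    (hvdec : ∀ k : ℤ,
      ‖fourierCoeff (fun x => (v x : ℂ)) k‖ ≤ C₁ * exp (-c * |(k : ℝ)| ^ (1 / s)))
    (hwdec : ∀ᶠ j in atTop, ∀ k : ℤ,
      ‖fourierCoeff (fun x => (w j x : ℂ)) k‖ ≤ C₁ * exp (-c * |(k : ℝ)| ^ (1 / s)))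
    (hwv : ∀ δ > 0, ∀ᶠ j in atTop, ∀ x, |w j x - v x| ≤ δ) {l : ℝ} {lw : ℕ → ℝ}
    (hl : Tendsto (finLyap ((2 * π * α : ℝ) : Circ) (schro E fun x => (v x : ℂ))) atTop (nhds l))
    (hlw : ∀ j, Tendsto (finLyap ((2 * π * α : ℝ) : Circ) (schro E fun x => (w j x : ℂ))) atTop
      (nhds (lw j))) :
    Tendsto lw atTop (nhds l) := by
  set ω : Circ := ((2 * π * α : ℝ) : Circ)
  have hp : 0 < 1 / s := by positivity
  set C₂ := fourierMajorant C₁ c (1 / s) with hC₂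
  have hC₂0 : 0 ≤ C₂ := fourierMajorant_nonneg hC₁
  set Λ := Real.log (|E| + C₂ + 2) with hΛdef
  have hpos : (1 : ℝ) ≤ |E| + C₂ + 2 := by linarith [abs_nonneg E]
  have hΛ0 : 0 ≤ Λ := Real.log_nonneg hpos
  have hΛ : |E| + C₂ + 2 ≤ exp Λ := (Real.exp_log (by linarith)).ge
  have hcont : ∀ {u : Circ → ℝ}, Continuous u → Continuous (schro E fun x => (u x : ℂ)) :=
    fun hu => schro_continuous E (Complex.continuous_ofReal.comp hu)
  have hnorm : ∀ {u : Circ → ℝ}, Continuous u → (∀ k : ℤ,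
      ‖fourierCoeff (fun x => (u x : ℂ)) k‖ ≤ C₁ * exp (-c * |(k : ℝ)| ^ (1 / s))) →
      ∀ x, ‖schro E (fun x => (u x : ℂ)) x‖ ≤ exp Λ := fun hu hdec x =>
    schro_norm_le hΛ (by
      rw [Complex.norm_real]
      exact abs_le_fourierMajorant hC₁ hc hp hu hdec x)
  have hfix : ∀ n, Tendsto (fun j => finLyap ω (schro E fun x => (w j x : ℂ)) n) atTop
      (nhds (finLyap ω (schro E fun x => (v x : ℂ)) n)) := fun n => by
    rw [Metric.tendsto_nhds]
    intro η hη
    filter_upwards [hwdec, hwv (η / (4 * exp (Λ * n))) (by positivity)] with j hj hd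
    rw [Real.dist_eq]
    refine (abs_finLyap_sub_le (hcont hv) (hcont (hw j)) (schro_det E _) (schro_det E _)
      (hnorm hv hvdec) hΛ0 (hnorm (hw j) hj) (fun x => (norm_schro_sub E v (w j) x).trans_le (hd x))
      n).trans_lt ?_
    have : 2 * (η / (4 * exp (Λ * n))) * exp (Λ * n) = η / 2 := by field_simp; norm_num
    linarith
  have hlim_le : ∀ j n, n ≠ 0 → lw j ≤ finLyap ω (schro E fun x => (w j x : ℂ)) n := by
    intro j n hn
    obtain ⟨l', hl', hle⟩ := tendsto_finLyap (ω := ω) (hcont (hw j)) (schro_det E _)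
    rw [tendsto_nhds_unique (hlw j) hl']
    exact hle n hn
  refine tendsto_order.2 ⟨fun b hb => ?_, fun b hb => ?_⟩
  · rcases lt_or_ge b 0 with hb0 | hb0
    · exact Eventually.of_forall fun j =>
        hb0.trans_le (ge_of_tendsto' (hlw j) fun n => finLyap_nonneg (schro_det E _) n)
    set γ := (b + l) / 2 with hγdef
    have hγ : 0 < γ := by linarith
    have hγl : γ < l := by linarith
    obtain ⟨C₀, hC₀, n₁, hvar⟩ := exists_finVar_le hcα hα hs1 hs2 hC₁ hc E
    have hσ : 0 < (2 - s) / 2 := by linarith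
    obtain ⟨n₀, B, -, hind⟩ := scale_induction hσ (by linarith) hC₀ hΛ0 hγ n₁
    have hl2 : Tendsto (fun n : ℕ => finLyap ω (schro E fun x => (v x : ℂ)) (2 * n)) atTop
        (nhds l) := hl.comp (tendsto_id.const_mul_atTop' two_pos)
    have herr : Tendsto (fun n : ℕ => B / (n : ℝ) ^ ((2 - s) / 2 / 2)) atTop (nhds 0) :=
      ((tendsto_rpow_atTop (half_pos hσ)).comp tendsto_natCast_atTop_atTop).const_div_atTop B
    have hdef := hl.sub hl2
    have hF := (hl.sub (hdef.const_mul 2)).sub herr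
    simp only [sub_self, mul_zero, sub_zero] at hdef hF
    obtain ⟨n, hn, hn1, hn2⟩ := ((eventually_ge_atTop n₀).and
      ((hdef.eventually_lt_const (show 0 < γ / 10 by positivity)).and
        (hF.eventually_const_lt hγl))).exists
    have hdefj := (hfix n).sub (hfix (2 * n))
    have hFj := ((hfix n).sub (hdefj.const_mul 2)).sub_const (B / (n : ℝ) ^ ((2 - s) / 2 / 2))
    filter_upwards [hwdec, hdefj.eventually_lt_const hn1, hFj.eventually_const_lt hn2]
      with j hj hj1 hj2
    have hlower := hind (finLyap ω (schro E fun x => (w j x : ℂ)))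
      (finVar ω (schro E fun x => (w j x : ℂ)))
      (finLyap_two_mul_le (hcont (hw j)) (schro_det E _)) (hvar (w j) (hw j) hj)
      (avalanche_averaged (hcont (hw j)) (schro_det E _) (hnorm (hw j) hj) hγ)
      (lw j) (hlw j) n hn hj1.le hj2.le
    linarith
  · obtain ⟨n, hn, hn0⟩ := ((hl.eventually_lt_const hb).and (eventually_ne_atTop 0)).exists
    filter_upwards [(hfix n).eventually_lt_const hn] with j hj
    exact (hlim_le j n hn0).trans_lt hj

/-- Convergence of Gevrey potentials gives uniform derivative bounds and uniform convergence. -/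
lemma gevrey_convergence_bounds {s K : ℝ} {v : ℝ → ℝ} {vseq : ℕ → ℝ → ℝ} (hv : GevreyCircle s v)
    (hvseq : ∀ n, GevreyCircle s (vseq n)) (hK : 0 < K)
    (hconv : Tendsto (fun n => gevreyNorm s K (fun x => vseq n x - v x)) atTop (nhds 0)) :
    ∃ C K' : ℝ, 0 ≤ C ∧ 0 < K' ∧
      (∀ m x, |iteratedDeriv m v x| ≤ C * K' ^ m * (m.factorial : ℝ) ^ s) ∧
      (∀ᶠ j in atTop, ∀ m x,
        |iteratedDeriv m (vseq j) x| ≤ C * K' ^ m * (m.factorial : ℝ) ^ s) ∧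
      ∀ δ > 0, ∀ᶠ j in atTop, ∀ x, |vseq j x - v x| ≤ δ := by
  obtain ⟨hsm, -, K₀, hK₀, hfin⟩ := hv
  set C₀ := (gevreyNorm s K₀ v).toReal with hC₀
  have hC₀0 : 0 ≤ C₀ := ENNReal.toReal_nonneg
  have hbd := fun m x => abs_iteratedDeriv_le_of_gevreyNorm_le hK₀ hC₀0
    (ENNReal.ofReal_toReal hfin.ne).ge m x
  have hev : ∀ δ > 0, ∀ᶠ j in atTop, ∀ m x, |iteratedDeriv m (fun x => vseq j x - v x) x| ≤
      δ * K ^ m * (m.factorial : ℝ) ^ s := fun δ hδ => by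
    filter_upwards [hconv.eventually_le_const (ENNReal.ofReal_pos.2 hδ)] with j hj
    exact abs_iteratedDeriv_le_of_gevreyNorm_le hK hδ.le hj
  have hmax : 0 < max K₀ K := lt_max_of_lt_left hK₀
  have hbd' : ∀ m x, |iteratedDeriv m v x| ≤ C₀ * max K₀ K ^ m * (m.factorial : ℝ) ^ s :=
    fun m x => (hbd m x).trans (by gcongr; exact le_max_left _ _)
  refine ⟨C₀ + 1, max K₀ K, by positivity, hmax, fun m x => (hbd' m x).trans ?_, ?_,
    fun δ hδ => ?_⟩
  · gcongr
    linarith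
  · filter_upwards [hev 1 one_pos] with j hj m x
    have h1 := hj m x
    have h2 : 1 * K ^ m * (m.factorial : ℝ) ^ s ≤
        1 * max K₀ K ^ m * (m.factorial : ℝ) ^ s := by gcongr; exact le_max_right _ _
    have hle : ((m : ℕ∞) : WithTop ℕ∞) ≤ ((⊤ : ℕ∞) : WithTop ℕ∞) := by exact_mod_cast le_top
    rw [iteratedDeriv_fun_sub ((hvseq j).1.contDiffAt.of_le hle) (hsm.contDiffAt.of_le hle)] at h1
    calc |iteratedDeriv m (vseq j) x|
        = |iteratedDeriv m v x + (iteratedDeriv m (vseq j) x - iteratedDeriv m v x)| := by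
          rw [add_sub_cancel]
      _ ≤ _ := abs_add_le _ _
      _ ≤ C₀ * max K₀ K ^ m * (m.factorial : ℝ) ^ s +
          1 * max K₀ K ^ m * (m.factorial : ℝ) ^ s := add_le_add (hbd' m x) (h1.trans h2)
      _ = _ := by ring
  · filter_upwards [hev δ hδ] with j hj x
    simpa using hj 0 x

end

/-- **Continuity of the Lyapunov exponent in `G^s`, `1 ≤ s < 2`** (Theorem 1.1, part (1)).
If `α` is irrational of bounded type, `1 ≤ s < 2`, `v, v_n ∈ G^s(𝕊¹)` and
`|v_n − v|_{s,K} → 0` for some `K > 0`, then `L(S_{E,v_n}) → L(S_{E,v})`. -/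
theorem lyapunov_continuous_gevrey_lt_two
    (α M : ℝ) (hα : Irrational α) (hM : 0 < M) (hbdd : BoundedType α M)
    (E s : ℝ) (hs1 : 1 ≤ s) (hs2 : s < 2)
    (v : ℝ → ℝ) (hv : GevreyCircle s v)
    (vseq : ℕ → ℝ → ℝ) (hvseq : ∀ n, GevreyCircle s (vseq n))
    (K : ℝ) (hK : 0 < K)
    (hconv : Tendsto (fun n => gevreyNorm s K (fun x => vseq n x - v x)) atTop (nhds 0)) :
    Tendsto (fun n => lyapunovExp α (schrodingerMap E (vseq n))) atTop
      (nhds (lyapunovExp α (schrodingerMap E v))) := by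
  obtain ⟨cα, hcα, hcα'⟩ := BoundedType.exists_badly_approximable hα hM hbdd
  obtain ⟨C, K', hC, hK', hvb, hwb, hconv'⟩ := gevrey_convergence_bounds hv hvseq hK hconv
  have hvp : Function.Periodic v circPeriod := hv.2.1
  have hwp : ∀ j, Function.Periodic (vseq j) circPeriod := fun j => (hvseq j).2.1
  have hvc := continuous_lift hvp hv.1.continuous
  have hwc := fun j => continuous_lift (hwp j) (hvseq j).1.continuous
  have hlim : ∀ {u : Circ → ℝ}, Continuous u → ∃ l, Tendsto (finLyap ((2 * π * α : ℝ) : Circ)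
      (schro E fun x => (u x : ℂ))) atTop (nhds l) := fun hu =>
    (tendsto_finLyap (schro_continuous E (Complex.continuous_ofReal.comp hu))
      (schro_det E _)).imp fun _ h => h.1
  obtain ⟨l, hl⟩ := hlim hvc
  choose lw hlw using fun j => hlim (hwc j)
  rw [lyapunovExp_eq hvp hv.1.continuous hl]
  simp only [fun j => lyapunovExp_eq (hwp j) (hvseq j).1.continuous (hlw j)]
  refine tendsto_lyapunov_of_decay hcα hcα' hs1 hs2 (mul_nonneg hC (exp_pos 1).le)
    (rpow_pos_of_pos (by positivity) _) hvc hwc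
    (norm_fourierCoeff_le_of_gevrey hvp hv.1 hs1 hK' hC hvb) ?_ (fun δ hδ => ?_) hl hlw
  · filter_upwards [hwb] with j hj
    exact norm_fourierCoeff_le_of_gevrey (hwp j) (hvseq j).1 hs1 hK' hC hj
  · filter_upwards [hconv' δ hδ] with j hj x
    induction x using QuotientAddGroup.induction_on with
    | H y => exact hj y

end
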